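/- Let Ω be a domain in ℝ², x₀ ∈ Ω, R > 0 with the closure of B_{2R}(x₀) contained in Ω, p > 1, l > 1, f ∈ C²(Ω), and let u ∈ C¹ up to the closure of B_{2R}(x₀) be a weak solution of −Δ_p u = f in B_{2R}(x₀). Fix 0 < k ≤ 1, indices i, j ∈ {1,2}, a real number r > 2l/(l−1), and set ŝ := 1/k. Then there exists 𝔠 = 𝔠(k, l, r) > 0 such that if |p − 2| < 𝔠, the following holds: for every ν with 2l/(l−1) < ν < r there exists a constant C > 0 (depending only on k, l, ν, r, R, p, the L^∞-norm of ∇u on B_{2R}(x₀) and the W^{2,l}-norm of f on B_{2R}(x₀), but independent of ε and of q) such that for every ε ∈ (0,1), every u_ε ∈ C³(B_{2R}(x₀)) which is continuous up to the closure, solves the regularized problem in B_{2R}(x₀) and equals u on ∂B_{2R}(x₀), every q ≥ 1/k and all 0 < h' < h < R: ‖g_ε‖_{L^{rq}(B_{h'}(x₀))}^q ≤ C · (q/(h − h')) · ‖g_ε‖_{L^{ν(q−ŝ)}(B_h(x₀))}^{q−ŝ}, where g_ε(x) := (ε + |∇u_ε(x)|²)^{k/2} |u_{ε,ij}(x)|.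 -/

import Mathlib

open MeasureTheory Metric Real Set
open scoped RealInnerProductSpace ENNReal Topology

noncomputable section

abbrev Euc (n : ℕ) : Type := EuclideanSpace ℝ (Fin n)

/-- The `i`-th partial derivative of `u`. -/
noncomputable def pd {n : ℕ} (i : Fin n) (u : Euc n → ℝ) (x : Euc n) : ℝ :=
  fderiv ℝ u x (EuclideanSpace.single i 1)

/-- The second partial derivative `u_{ij} = ∂²u/∂xⱼ∂xᵢ`. -/
noncomputable def pd2 {n : ℕ} (i j : Fin n) (u : Euc n → ℝ) (x : Euc n) : ℝ :=
  fderiv ℝ (pd i u) x (EuclideanSpace.single j 1)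

/-- Frobenius norm of the Hessian matrix of `u` at `x`. -/
noncomputable def hessNorm {n : ℕ} (u : Euc n → ℝ) (x : Euc n) : ℝ :=
  Real.sqrt (∑ i : Fin n, ∑ j : Fin n, pd2 i j u x ^ 2)

/-- `u` is a weak solution of `-Δ_p u = f` on `Ω`. -/
def IsWeakPSol {n : ℕ} (p : ℝ) (f u : Euc n → ℝ) (Ω : Set (Euc n)) : Prop :=
  ∀ ψ : Euc n → ℝ, ContDiff ℝ (⊤ : ℕ∞) ψ → HasCompactSupport ψ → tsupport ψ ⊆ Ω →
    (∫ x in Ω, ‖gradient u x‖ ^ (p - 2) * ⟪gradient u x, gradient ψ x⟫) =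
      ∫ x in Ω, f x * ψ x

/-- `u` solves the regularized problem `-div((ε + |∇u|²)^((p-2)/2) ∇u) = f` pointwise on `B`. -/
def SolvesReg {n : ℕ} (p ε : ℝ) (f u : Euc n → ℝ) (B : Set (Euc n)) : Prop :=
  ∀ x ∈ B,
    -(∑ i : Fin n,
        fderiv ℝ (fun y => (((ε + ‖gradient u y‖ ^ 2) ^ ((p - 2) / 2)) • gradient u y) i) x
          (EuclideanSpace.single i 1)) = f x

/-- The weighted function `g_ε(x) = (ε + |∇u(x)|²)^(k/2) |u_{ij}(x)|`. -/
noncomputable def gfun {n : ℕ} (k ε : ℝ) (i j : Fin n) (u : Euc n → ℝ) (x : Euc n) : ℝ :=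
  (ε + ‖gradient u x‖ ^ 2) ^ (k / 2) * |pd2 i j u x|

/-- The `L^e` norm of `g` on the set `s`. -/
noncomputable def lpOn {n : ℕ} (g : Euc n → ℝ) (e : ℝ) (s : Set (Euc n)) : ℝ :=
  (∫ x in s, g x ^ e) ^ (1 / e)


lemma burk_young (j : ℕ) (A : ℝ) (hA : 0 ≤ A) (x y : ℝ) :
    A * x ^ 2 * y ^ (2 * j + 2) ≤ 1 / 2 * y ^ (2 * j + 4) + A * (2 * A) ^ (j + 1) * x ^ (2 * j + 4) := by
  have e1 : y ^ (2 * j + 2) = (y ^ 2) ^ (j + 1) := by rw [← pow_mul]; congr 1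
  have e2 : y ^ (2 * j + 4) = (y ^ 2) ^ (j + 1) * y ^ 2 := by rw [← pow_mul, ← pow_add]; congr 1
  have e3 : x ^ (2 * j + 4) = (x ^ 2) ^ (j + 1) * x ^ 2 := by rw [← pow_mul, ← pow_add]; congr 1
  rw [e1, e2, e3]
  have hx := sq_nonneg x
  have hy := sq_nonneg y
  generalize x ^ 2 = a at *
  generalize y ^ 2 = b at *
  have hb : 0 ≤ b ^ (j + 1) := by positivity
  by_cases h : 2 * A * a ≤ b
  · have h2 : 0 ≤ A * (2 * A) ^ (j + 1) * (a ^ (j + 1) * a) := by positivity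
    nlinarith
  · push Not at h
    have : b ^ (j + 1) ≤ (2 * A * a) ^ (j + 1) := pow_le_pow_left₀ hy h.le _
    rw [mul_pow] at this
    have h3 : A * a * b ^ (j + 1) ≤ A * a * ((2 * A) ^ (j + 1) * a ^ (j + 1)) :=
      mul_le_mul_of_nonneg_left this (by positivity)
    have h2 : 0 ≤ b ^ (j + 1) * b := by positivity
    nlinarith

lemma burk_cross (n : ℕ) (T a b : ℝ) (hT : 0 ≤ T) (ha : 0 ≤ a) (hb : 0 ≤ b) :
    T * a * b ^ (n + 1) ≤ b ^ (n + 2) + T ^ (n + 2) * a ^ (n + 2) := by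
  by_cases h : T * a ≤ b
  · have : T * a * b ^ (n + 1) ≤ b * b ^ (n + 1) := mul_le_mul_of_nonneg_right h (by positivity)
    have h2 : 0 ≤ T ^ (n + 2) * a ^ (n + 2) := by positivity
    calc _ ≤ _ := this
      _ = b ^ (n + 2) := by ring
      _ ≤ _ := by linarith
  · push Not at h
    have : b ^ (n + 1) ≤ (T * a) ^ (n + 1) := pow_le_pow_left₀ hb h.le _
    have h3 : T * a * b ^ (n + 1) ≤ T * a * (T * a) ^ (n + 1) :=
      mul_le_mul_of_nonneg_left this (by positivity)
    have h2 : 0 ≤ b ^ (n + 2) := by positivity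
    calc _ ≤ _ := h3
      _ = T ^ (n + 2) * a ^ (n + 2) := by ring
      _ ≤ _ := by linarith

lemma burk (j : ℕ) : ∃ (U : ℝ → ℝ → ℝ) (K : ℝ), 0 < K ∧ (∀ x, U x 0 ≤ 0) ∧
    (∀ x y, 1 / 2 * y ^ (2 * j + 4) - K * x ^ (2 * j + 4) ≤ U x y) ∧
    (∀ x y d, (U (x + d) y + U (x - d) y) / 2 ≤ U x y) ∧
    (∀ x y d, (U (x + d) (y + d) + U (x - d) (y - d)) / 2 ≤ U x y) := by
  set s : ℝ := (2 * j + 4 : ℝ) with hs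
  have hs4 : 4 ≤ s := by rw [hs]; have : (0:ℝ) ≤ j := by positivity
                         linarith
  set A : ℝ := (s * (s - 1) + 1) / 2 with hA
  have hA0 : 0 < A := by rw [hA]; nlinarith
  set T : ℝ := 4 * A * (s - 2) with hT
  have hT0 : 0 ≤ T := by rw [hT]; have : 0 ≤ s - 2 := by linarith
                         positivity
  set B : ℝ := T ^ (2 * j + 2) with hB
  have hB0 : 0 ≤ B := by positivity
  have ev : Even (2 * j + 4) := ⟨j + 2, by ring⟩
  have ev2 : Even (2 * j + 2) := ⟨j + 1, by ring⟩
  have ev0 : Even (2 * j) := ⟨j, by ring⟩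
  refine ⟨fun x y => y ^ (2 * j + 4) - A * x ^ 2 * y ^ (2 * j + 2) - B * x ^ (2 * j + 4),
    A * (2 * A) ^ (j + 1) + B + 1, by positivity, ?_, ?_, ?_, ?_⟩
  · intro x
    have : 0 ≤ B * x ^ (2 * j + 4) := mul_nonneg hB0 (ev.pow_nonneg _)
    simp only [ne_eq, Nat.add_eq_zero_iff, OfNat.ofNat_ne_zero, and_false, not_false_eq_true, zero_pow]
    linarith
  · intro x y
    have := burk_young j A hA0.le x y
    have h2 := ev.pow_nonneg x
    have h3 := ev.pow_nonneg y
    simp only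
    nlinarith
  · intro x y d
    have c : ConvexOn ℝ univ fun x : ℝ => x ^ (2 * j + 4) := ev.convexOn_pow
    have := c.2 (mem_univ (x + d)) (mem_univ (x - d)) (by norm_num : (0:ℝ) ≤ 1/2)
      (by norm_num : (0:ℝ) ≤ 1/2) (by norm_num)
    simp only [smul_eq_mul] at this
    rw [show 1 / 2 * (x + d) + 1 / 2 * (x - d) = x by ring] at this
    have h1 := mul_le_mul_of_nonneg_left this hB0
    have h2 : 0 ≤ A * y ^ (2 * j + 2) * d ^ 2 := by
      have := ev2.pow_nonneg y
      positivity
    simp only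
    nlinarith
  · intro x y d
    have c : ConcaveOn ℝ univ fun t : ℝ => (y + t) ^ (2 * j + 4) -
        A * (x + t) ^ 2 * (y + t) ^ (2 * j + 2) - B * (x + t) ^ (2 * j + 4) := by
      have hx (n : ℕ) (t : ℝ) : HasDerivAt (fun t : ℝ => (x + t) ^ (n+1)) ((n+1) * (x + t) ^ n) t := by
        have := ((hasDerivAt_id t).const_add x).fun_pow (n+1)
        simpa using this
      have hy (n : ℕ) (t : ℝ) : HasDerivAt (fun t : ℝ => (y + t) ^ (n+1)) ((n+1) * (y + t) ^ n) t := by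
        have := ((hasDerivAt_id t).const_add y).fun_pow (n+1)
        simpa using this
      refine concaveOn_of_hasDerivWithinAt2_nonpos convex_univ
        (f' := fun t => ((2 * j + 3 : ℕ) + 1) * (y + t) ^ (2 * j + 3) -
          A * ((((1:ℕ):ℝ) + 1) * (x + t) ^ 1 * (y + t) ^ (2 * j + 2)
            + (x + t) ^ 2 * (((2 * j + 1 : ℕ) + 1) * (y + t) ^ (2 * j + 1)))
          - B * (((2 * j + 3 : ℕ) + 1) * (x + t) ^ (2 * j + 3)))
        (f'' := fun t => ((2 * j + 3 : ℕ) + 1) * (((2 * j + 2 : ℕ) + 1) * (y + t) ^ (2 * j + 2)) -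
          A * ((((1:ℕ):ℝ) + 1) * ((((0:ℕ):ℝ) + 1) * (x + t) ^ 0 * (y + t) ^ (2 * j + 2)
               + (x + t) ^ 1 * (((2 * j + 1 : ℕ) + 1) * (y + t) ^ (2 * j + 1)))
            + ((((1:ℕ):ℝ) + 1) * (x + t) ^ 1 * (((2 * j + 1 : ℕ) + 1) * (y + t) ^ (2 * j + 1))
              + (x + t) ^ 2 * (((2 * j + 1 : ℕ) + 1) * (((2 * j : ℕ) + 1) * (y + t) ^ (2 * j)))))
          - B * (((2 * j + 3 : ℕ) + 1) * (((2 * j + 2 : ℕ) + 1) * (x + t) ^ (2 * j + 2)))) ?_ ?_ ?_ ?_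
      · fun_prop
      · intro t _
        apply HasDerivAt.hasDerivWithinAt
        have := ((hy (2*j+3) t).sub (((hx 1 t).mul (hy (2*j+1) t)).const_mul A)).sub
          ((hx (2*j+3) t).const_mul B)
        convert this using 1
        ext t; simp; ring
      · intro t _
        apply HasDerivAt.hasDerivWithinAt
        have := (((hy (2*j+2) t).const_mul (((2 * j + 3 : ℕ):ℝ) + 1)).sub
          (((((hx 0 t).mul (hy (2*j+1) t)).const_mul (((1:ℕ):ℝ) + 1)).add
            ((hx 1 t).mul ((hy (2*j) t).const_mul (((2*j+1:ℕ):ℝ) + 1)))).const_mul A)).sub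
          (((hx (2*j+2) t).const_mul (((2*j+3:ℕ):ℝ) + 1)).const_mul B)
        convert this using 1
        ext t; simp only [Pi.sub_apply, Pi.add_apply, Pi.mul_apply]; ring
      · intro t _
        have k1 := burk_cross (2*j) T |x+t| |y+t| hT0 (abs_nonneg _) (abs_nonneg _)
        rw [ev2.pow_abs, ev2.pow_abs] at k1
        have k2 : -(T * |x+t| * |y+t|^(2*j+1)) ≤ T * (x+t) * (y+t)^(2*j+1) := by
          have h := mul_le_mul_of_nonneg_left (neg_abs_le ((x+t)*(y+t)^(2*j+1))) hT0
          rw [abs_mul, abs_pow] at h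
          generalize T = T' at h
          linarith [h]
        have k3 : 0 ≤ A * ((x + t) ^ 2 * ((s - 2) * ((s-3) * (y + t) ^ (2 * j)))) := by
          have := ev0.pow_nonneg (y+t)
          have h2 : 0 ≤ s - 2 := by linarith
          have h3 : 0 ≤ s - 3 := by linarith
          positivity
        have k4 : 0 ≤ B * (x+t)^(2*j+2) := mul_nonneg hB0 (ev2.pow_nonneg _)
        have k5 : B * (x+t)^(2*j+2) ≤ B * (x+t)^(2*j+2) * (s * (s-1)) := by
          apply le_mul_of_one_le_right k4; nlinarith
        have e : ((j:ℝ)) = (s-4)/2 := by rw [hs]; ring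
        push_cast
        rw [e]
        have k6 : 2 * A = s*(s-1) + 1 := by rw [hA]; ring
        rw [← hB] at k1
        have : 2 * A * (y+t)^(2*j+2) = (s*(s-1) + 1) * (y+t)^(2*j+2) := by rw [k6]
        have : T * (x+t) * (y+t)^(2*j+1) = 4 * A * (s-2) * (x+t) * (y+t)^(2*j+1) := by rw [hT]
        ring_nf at *
        linarith
    have := c.2 (mem_univ d) (mem_univ (-d)) (by norm_num : (0:ℝ) ≤ 1/2)
      (by norm_num : (0:ℝ) ≤ 1/2) (by norm_num)
    simp only [smul_eq_mul] at this
    rw [show 1 / 2 * d + 1 / 2 * -d = 0 by ring] at this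
    simp only [add_zero, ← sub_eq_add_neg] at this
    simp only
    linarith

lemma burk_term (j : ℕ) (g t : ℝ) : g * t ^ (2*j+3) ≤ 1/2 * g ^ (2*j+4) + 2 * t ^ (2*j+4) := by
  have ev : Even (2 * j + 4) := ⟨j + 2, by ring⟩
  have h1 : g * t ^ (2*j+3) ≤ |g| * |t| ^ (2*j+3) := by
    rw [← abs_pow, ← abs_mul]; exact le_abs_self _
  rw [← ev.pow_abs g, ← ev.pow_abs t]
  have hg := abs_nonneg g
  have ht := abs_nonneg t
  refine h1.trans ?_
  generalize |g| = a at *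
  generalize |t| = b at *
  by_cases h : 2 * b ≤ a
  · have h2 : (2*b) ^ (2*j+3) ≤ a ^ (2*j+3) := pow_le_pow_left₀ (by positivity) h _
    rw [mul_pow] at h2
    have h4 : (2:ℝ) ≤ 2 ^ (2*j+3) := by
      calc (2:ℝ) = 2^1 := by norm_num
        _ ≤ _ := pow_le_pow_right₀ (by norm_num) (by omega)
    have h5 : 2 * b ^ (2*j+3) ≤ a ^ (2*j+3) := le_trans (mul_le_mul_of_nonneg_right h4 (by positivity)) h2
    have h6 : a * (2 * b ^ (2*j+3)) ≤ a * a ^ (2*j+3) := mul_le_mul_of_nonneg_left h5 hg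
    have h7 : 0 ≤ 2 * b ^ (2*j+4) := by positivity
    have : a * a ^ (2*j+3) = a ^ (2*j+4) := by ring
    linarith
  · push Not at h
    have : a * b ^ (2*j+3) ≤ 2 * b * b ^ (2*j+3) := mul_le_mul_of_nonneg_right h.le (by positivity)
    have h7 : 0 ≤ 1/2 * a ^ (2*j+4) := by positivity
    have : 2 * b * b ^ (2*j+3) = 2 * b ^ (2*j+4) := by ring
    linarith


/-- Continuous with compact support. -/
def CCs (g : Euc 2 → ℝ) : Prop := Continuous g ∧ HasCompactSupport g

/-- Symmetric average. -/
def Qav (a : Euc 2) (g : Euc 2 → ℝ) (x : Euc 2) : ℝ := (g (x + a) + g (x - a)) / 2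

lemma CCs.integrable {g : Euc 2 → ℝ} (hg : CCs g) : Integrable g :=
  hg.1.integrable_of_hasCompactSupport hg.2

lemma CCs.shift {g : Euc 2 → ℝ} (hg : CCs g) (a : Euc 2) : CCs (fun x => g (x + a)) :=
  ⟨hg.1.comp (by fun_prop), hg.2.comp_homeomorph (Homeomorph.addRight a)⟩

lemma CCs.add {g h : Euc 2 → ℝ} (hg : CCs g) (hh : CCs h) : CCs (fun x => g x + h x) :=
  ⟨hg.1.add hh.1, hg.2.add hh.2⟩

lemma CCs.sub {g h : Euc 2 → ℝ} (hg : CCs g) (hh : CCs h) : CCs (fun x => g x - h x) :=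
  ⟨hg.1.sub hh.1, hg.2.sub hh.2⟩

lemma CCs.mul {g h : Euc 2 → ℝ} (hg : CCs g) (hh : CCs h) : CCs (fun x => g x * h x) :=
  ⟨hg.1.mul hh.1, hg.2.mul_right⟩

lemma CCs.mul_cont {g h : Euc 2 → ℝ} (hg : CCs g) (hh : Continuous h) : CCs (fun x => g x * h x) :=
  ⟨hg.1.mul hh, hg.2.mul_right⟩

lemma CCs.const_mul {h : Euc 2 → ℝ} (c : ℝ) (hh : CCs h) : CCs (fun x => c * h x) :=
  ⟨by have := hh.1; fun_prop, hh.2.mul_left (f := fun _ => c)⟩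

lemma CCs.pow {g : Euc 2 → ℝ} (hg : CCs g) (n : ℕ) (hn : n ≠ 0) : CCs (fun x => g x ^ n) :=
  ⟨hg.1.pow n, hg.2.comp_left (g := fun t => t ^ n) (by simp [hn])⟩

lemma CCs.Q {g : Euc 2 → ℝ} (hg : CCs g) (a : Euc 2) : CCs (Qav a g) := by
  have := ((hg.shift a).add (hg.shift (-a))).const_mul (1/2)
  convert this using 1
  ext x; simp only [Qav, sub_eq_add_neg]; ring

lemma Q_int {g : Euc 2 → ℝ} (hg : CCs g) (a : Euc 2) : ∫ x, Qav a g x = ∫ x, g x := by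
  have h1 : ∫ x, g (x + a) = ∫ x, g x := integral_add_right_eq_self g a
  have h2 : ∫ x, g (x - a) = ∫ x, g x := integral_sub_right_eq_self g a
  have i1 := (hg.shift a).integrable
  have i2 : Integrable (fun x => g (x - a)) := by
    have := (hg.shift (-a)).integrable
    simpa only [sub_eq_add_neg] using this
  simp only [Qav]
  rw [integral_div, integral_add i1 i2, h1, h2]; ring

lemma Q_comm (a b : Euc 2) (g : Euc 2 → ℝ) : Qav a (Qav b g) = Qav b (Qav a g) := by
  ext x
  simp only [Qav]
  rw [add_right_comm, show x + a - b = x - b + a by abel, show x - a + b = x + b - a by abel,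
    show x - a - b = x - b - a by abel]
  ring

lemma Q_adj {g h : Euc 2 → ℝ} (hg : CCs g) (hh : CCs h) (a : Euc 2) :
    ∫ x, Qav a g x * h x = ∫ x, g x * Qav a h x := by
  have e (u v : Euc 2 → ℝ) (hu : CCs u) (hv : CCs v) (c : Euc 2) :
      ∫ x, u (x + c) * v x = ∫ x, u x * v (x - c) := by
    rw [← integral_add_right_eq_self (fun x => u x * v (x - c)) c]
    simp
  have i (u v : Euc 2 → ℝ) (hu : CCs u) (hv : CCs v) (c : Euc 2) :
      Integrable (fun x => u (x + c) * v x) := ((hu.shift c).mul hv).integrable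
  have e1 := e g h hg hh a
  have e2 := e g h hg hh (-a)
  have i1 := i g h hg hh a
  have i2 := i g h hg hh (-a)
  have i3 := i h g hh hg a
  have i4 := i h g hh hg (-a)
  have l1 : ∫ x, Qav a g x * h x = (∫ x, g (x + a) * h x + g (x + -a) * h x) / 2 := by
    rw [← integral_div]; congr 1; ext x; simp only [Qav, sub_eq_add_neg]; ring
  have l2 : ∫ x, g x * Qav a h x = (∫ x, h (x + a) * g x + h (x + -a) * g x) / 2 := by
    rw [← integral_div]; congr 1; ext x; simp only [Qav, sub_eq_add_neg]; ring
  rw [l1, l2, integral_add i1 i2, integral_add i3 i4, e1, e2]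
  simp only [sub_eq_add_neg, neg_neg]
  simp only [mul_comm]
  ring

lemma Q_sub (a : Euc 2) (g h : Euc 2 → ℝ) :
    Qav a (fun x => g x - h x) = fun x => Qav a g x - Qav a h x := by
  ext x; simp only [Qav]; ring

/-- The two-step average. -/
def Tav (a b : Euc 2) (g : Euc 2 → ℝ) : Euc 2 → ℝ := Qav b (Qav a g)

lemma CCs.Tn {g : Euc 2 → ℝ} (hg : CCs g) (a b : Euc 2) (n : ℕ) : CCs ((Tav a b)^[n] g) := by
  induction n with
  | zero => exact hg
  | succ n ih => rw [Function.iterate_succ_apply']; exact (ih.Q a).Q b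

lemma T_adj {g h : Euc 2 → ℝ} (hg : CCs g) (hh : CCs h) (a b : Euc 2) :
    ∫ x, Tav a b g x * h x = ∫ x, g x * Tav a b h x := by
  unfold Tav
  rw [Q_adj (hg.Q a) hh, Q_adj hg (hh.Q b), Q_comm a b]

lemma T_adjn {g h : Euc 2 → ℝ} (hg : CCs g) (hh : CCs h) (a b : Euc 2) (n : ℕ) :
    ∫ x, (Tav a b)^[n] g x * h x = ∫ x, g x * (Tav a b)^[n] h x := by
  induction n generalizing g with
  | zero => rfl
  | succ n ih =>
    rw [Function.iterate_succ_apply, Function.iterate_succ_apply', ih (g := Tav a b g) ((hg.Q a).Q b),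
      T_adj hg (hh.Tn a b n)]

lemma QT_comm (a b : Euc 2) (g : Euc 2 → ℝ) (n : ℕ) :
    (Tav a b)^[n] (Qav a g) = Qav a ((Tav a b)^[n] g) := by
  induction n generalizing g with
  | zero => rfl
  | succ n ih =>
    rw [Function.iterate_succ_apply, Function.iterate_succ_apply,
      show Tav a b (Qav a g) = Qav a (Tav a b g) by unfold Tav; rw [Q_comm b a], ih]

lemma T_sub (a b : Euc 2) (g h : Euc 2 → ℝ) (n : ℕ) :
    (Tav a b)^[n] (fun x => g x - h x) = fun x => (Tav a b)^[n] g x - (Tav a b)^[n] h x := by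
  induction n with
  | zero => rfl
  | succ n ih =>
    simp only [Function.iterate_succ_apply']
    rw [ih]; unfold Tav; rw [Q_sub, Q_sub]

lemma key_inv (j : ℕ) {U : ℝ → ℝ → ℝ} {K : ℝ}
    (h2 : ∀ x y, 1 / 2 * y ^ (2 * j + 4) - K * x ^ (2 * j + 4) ≤ U x y)
    (h3 : ∀ x y d, (U (x + d) y + U (x - d) y) / 2 ≤ U x y)
    (h4 : ∀ x y d, (U (x + d) (y + d) + U (x - d) (y - d)) / 2 ≤ U x y)
    {f θ : Euc 2 → ℝ} (hf : CCs f) (hθ : CCs θ) (a b : Euc 2) (N : ℕ) :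
    ∃ L W : Euc 2 → ℝ, CCs L ∧ CCs W ∧
      (∫ x, W x = ∫ x, (K * f x ^ (2*j+4) + 2 * θ x ^ (2*j+4))) ∧
      (∫ x, L x = ∑ n ∈ Finset.range N, ∫ x, (Tav a b)^[2*n] f x *
        (θ x ^ (2*j+3) - Qav a (Qav a (fun y => θ y ^ (2*j+3))) x)) ∧
      ∀ x g, g * (Tav a b)^[N] (fun y => θ y ^ (2*j+3)) x + L x ≤ U ((Tav a b)^[N] f x) g + W x := by
  induction N with
  | zero =>
    refine ⟨fun _ => 0, _, ⟨continuous_const, HasCompactSupport.zero⟩,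
      ((hf.pow (2*j+4) (by omega)).const_mul K).add ((hθ.pow (2*j+4) (by omega)).const_mul 2), rfl, by simp, ?_⟩
    intro x g
    have := burk_term j g (θ x)
    have := h2 (f x) g
    simp only [Function.iterate_zero, id]
    linarith
  | succ N ih =>
    obtain ⟨L, W, hL, hW, iW, iL, H⟩ := ih
    set ψ : Euc 2 → ℝ := fun y => θ y ^ (2*j+3) with hψ
    have cψ : CCs ψ := hθ.pow _ (by omega)
    set F := (Tav a b)^[N] f with hF
    set P := (Tav a b)^[N] ψ with hP
    have cF : CCs F := hf.Tn a b N
    have cP : CCs P := cψ.Tn a b N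
    have c1 : CCs (fun x => Qav a L x + (Qav a (fun y => F y * P y) x - Qav a F x * Qav a P x)) :=
      (hL.Q a).add (((cF.mul cP).Q a).sub ((cF.Q a).mul (cP.Q a)))
    refine ⟨Qav b (fun x => Qav a L x + (Qav a (fun y => F y * P y) x - Qav a F x * Qav a P x)),
      Qav b (Qav a W), c1.Q b, (hW.Q a).Q b, ?_, ?_, ?_⟩
    · rw [Q_int (hW.Q a), Q_int hW, iW]
    · rw [Q_int c1, Finset.sum_range_succ, ← iL, integral_add (hL.Q a).integrable
        (((cF.mul cP).Q a).sub ((cF.Q a).mul (cP.Q a))).integrable, Q_int hL,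
        integral_sub ((cF.mul cP).Q a).integrable ((cF.Q a).mul (cP.Q a)).integrable,
        Q_int (cF.mul cP), Q_adj cF (cP.Q a)]
      congr 1
      have : (Tav a b)^[2*N] f = (Tav a b)^[N] F := by
        rw [hF, ← Function.iterate_add_apply]; congr 2; ring
      rw [this, T_adjn cF (cψ.sub ((cψ.Q a).Q a)), T_sub, QT_comm, QT_comm, ← hP,
        ← integral_sub (cF.mul cP).integrable (cF.mul ((cP.Q a).Q a)).integrable]
      congr 1; ext x; ring
    · have H1 : ∀ x g, g * Qav a P x + (Qav a L x + (Qav a (fun y => F y * P y) x - Qav a F x * Qav a P x))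
          ≤ U (Qav a F x) g + Qav a W x := by
        intro x g
        have p1 := H (x + a) (g + (F (x+a) - F (x-a))/2)
        have p2 := H (x - a) (g - (F (x+a) - F (x-a))/2)
        have p3 := h4 (Qav a F x) g ((F (x+a) - F (x-a))/2)
        rw [show Qav a F x + (F (x+a) - F (x-a))/2 = F (x+a) by simp only [Qav]; ring,
          show Qav a F x - (F (x+a) - F (x-a))/2 = F (x-a) by simp only [Qav]; ring] at p3
        simp only [Qav] at *
        linarith
      intro x g
      have p1 := H1 (x + b) g
      have p2 := H1 (x - b) g
      have p3 := h3 (Qav b (Qav a F) x) g ((Qav a F (x+b) - Qav a F (x-b))/2)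
      rw [show Qav b (Qav a F) x + (Qav a F (x+b) - Qav a F (x-b))/2 = Qav a F (x+b) by
          simp only [Qav]; ring,
        show Qav b (Qav a F) x - (Qav a F (x+b) - Qav a F (x-b))/2 = Qav a F (x-b) by
          simp only [Qav]; ring] at p3
      rw [Function.iterate_succ_apply', Function.iterate_succ_apply', ← hF, ← hP]
      change g * Qav b (Qav a P) x + _ ≤ U (Qav b (Qav a F) x) g + _
      generalize Qav a L = A1 at *
      generalize Qav a W = A2 at *
      generalize hA3 : Qav a P = A3 at *
      generalize hA4 : Qav a F = A4 at *
      generalize Qav a (fun y => F y * P y) = A5 at *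
      simp only [Qav] at p1 p2 p3 ⊢
      linarith

lemma key_sum (j : ℕ) : ∃ K : ℝ, 0 < K ∧ ∀ (f θ : Euc 2 → ℝ), CCs f → CCs θ → ∀ (a b : Euc 2) (N : ℕ),
    ∑ n ∈ Finset.range N, ∫ x, (Tav a b)^[2*n] f x *
        (θ x ^ (2*j+3) - Qav a (Qav a (fun y => θ y ^ (2*j+3))) x) ≤
      ∫ x, (K * f x ^ (2*j+4) + 2 * θ x ^ (2*j+4)) := by
  obtain ⟨U, K, hK, h1, h2, h3, h4⟩ := burk j
  refine ⟨K, hK, fun f θ hf hθ a b N => ?_⟩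
  obtain ⟨L, W, hL, hW, iW, iL, H⟩ := key_inv j h2 h3 h4 hf hθ a b N
  rw [← iL, ← iW]
  refine integral_mono hL.integrable hW.integrable fun x => ?_
  have := H x 0
  have := h1 ((Tav a b)^[N] f x)
  linarith

lemma key_disc (j : ℕ) : ∃ K : ℝ, 0 < K ∧ ∀ (φ θ : Euc 2 → ℝ), CCs φ → CCs θ → ∀ (a b : Euc 2),
    ∫ x, (φ x - Qav a (Qav a φ) x) * θ x ^ (2*j+3) ≤
      ∫ x, (K * (φ x - Tav a b (Tav a b φ) x) ^ (2*j+4) + 2 * θ x ^ (2*j+4)) := by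
  obtain ⟨K, hK, H⟩ := key_sum j
  refine ⟨K, hK, fun φ θ hφ hθ a b => ?_⟩
  set ψ : Euc 2 → ℝ := fun y => θ y ^ (2*j+3) with hψ
  have cψ : CCs ψ := hθ.pow _ (by omega)
  have cd : CCs (fun x => ψ x - Qav a (Qav a ψ) x) := cψ.sub ((cψ.Q a).Q a)
  set y : ℕ → ℝ := fun N => ∫ x, (Tav a b)^[2*N] φ x * (ψ x - Qav a (Qav a ψ) x) with hy
  have hX : ∫ x, (φ x - Qav a (Qav a φ) x) * θ x ^ (2*j+3) = y 0 := by
    have e1 : ∫ x, Qav a (Qav a φ) x * ψ x = ∫ x, φ x * Qav a (Qav a ψ) x := by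
      rw [Q_adj (hφ.Q a) cψ, Q_adj hφ (cψ.Q a)]
    have l1 : ∫ x, (φ x - Qav a (Qav a φ) x) * θ x ^ (2*j+3) = ∫ x, φ x * ψ x - Qav a (Qav a φ) x * ψ x := by
      congr 1; ext x; rw [hψ]; ring
    have l2 : y 0 = ∫ x, φ x * ψ x - φ x * Qav a (Qav a ψ) x := by
      refine integral_congr_ae (.of_forall fun x => ?_)
      simp only [mul_zero, Function.iterate_zero, id]; ring
    rw [l1, l2, integral_sub (hφ.mul cψ).integrable (((hφ.Q a).Q a).mul cψ).integrable,
      integral_sub (hφ.mul cψ).integrable (hφ.mul ((cψ.Q a).Q a)).integrable, e1]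
  rw [hX]
  set B := ∫ x, (K * (φ x - Tav a b (Tav a b φ) x) ^ (2*j+4) + 2 * θ x ^ (2*j+4)) with hB
  have cT : CCs (Tav a b (Tav a b φ)) := hφ.Tn a b 2
  have h1 : ∀ N, y 0 - y N ≤ B := by
    intro N
    have h := H (fun x => φ x - Tav a b (Tav a b φ) x) θ (hφ.sub cT) hθ a b N
    rw [← hB] at h
    refine le_trans (le_of_eq ?_) h
    have := Finset.sum_range_sub' y N
    rw [← this]
    refine Finset.sum_congr rfl fun n _ => ?_
    rw [T_sub]
    have e : Tav a b (Tav a b φ) = (Tav a b)^[2] φ := rfl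
    rw [e, ← Function.iterate_add_apply]
    rw [hy]
    simp only
    rw [← integral_sub ((hφ.Tn a b _).mul cd).integrable ((hφ.Tn a b _).mul cd).integrable]
    congr 1; ext x
    rw [show 2 * (n+1) = 2 * n + 2 by ring]
    ring
  set K1 := ∫ x, (K * φ x ^ (2*j+4) + 2 * θ x ^ (2*j+4)) with hK1
  have h2 : ∀ M, ∑ N ∈ Finset.range M, y N ≤ K1 := fun M => H φ θ hφ hθ a b M
  by_contra hc
  push Not at hc
  obtain ⟨M, hM⟩ := exists_nat_gt (K1 / (y 0 - B))
  rw [div_lt_iff₀ (by linarith)] at hM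
  have : ∑ N ∈ Finset.range M, (y 0 - B) ≤ ∑ N ∈ Finset.range M, y N :=
    Finset.sum_le_sum fun N _ => by have := h1 N; linarith
  rw [Finset.sum_const, Finset.card_range, nsmul_eq_mul] at this
  linarith [h2 M]


lemma sd1 {G G' G'' : ℝ → ℝ} (h1 : ∀ t, HasDerivAt G (G' t) t) (h2 : ∀ t, HasDerivAt G' (G'' t) t)
    {c δ t : ℝ} (ht : 0 ≤ t) (hδ : 0 ≤ δ) (H : ∀ τ, |τ| ≤ t → |G'' τ - c| ≤ δ) :
    |G t + G (-t) - 2 * G 0 - c * t ^ 2| ≤ 2 * δ * t ^ 2 := by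
  have hR : ∀ τ ∈ Icc 0 t, |(G' τ - c * τ) - (G' (-τ) - c * (-τ))| ≤ δ * (2 * τ) := by
    intro τ hτ
    have := (convex_Icc (-t) t).norm_image_sub_le_of_norm_hasDerivWithin_le
      (f := fun s => G' s - c * s) (f' := fun s => G'' s - c) (C := δ) (x := -τ) (y := τ)
      (fun s _ => by
        have := (h2 s).sub ((hasDerivAt_id s).const_mul c)
        simp only [mul_one] at this
        exact this.hasDerivWithinAt) (fun s hs => H s (abs_le.2 hs)) ⟨by linarith [hτ.2], by linarith [hτ.1]⟩
        ⟨by linarith [hτ.1], hτ.2⟩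
    rw [Real.norm_eq_abs, Real.norm_eq_abs] at this
    rw [show τ - -τ = 2 * τ by ring, abs_of_nonneg (a := 2 * τ) (by linarith [hτ.1])] at this
    exact this
  have := (convex_Icc 0 t).norm_image_sub_le_of_norm_hasDerivWithin_le
      (f := fun s => G s + G (-s) - c * s ^ 2) (f' := fun s => G' s - G' (-s) - c * (2 * s)) (C := 2 * δ * t)
      (x := 0) (y := t)
      (fun s _ => by
        have e1 : HasDerivAt (fun s => G (-s)) (-G' (-s)) s := by
          have := (h1 (-s)).scomp s (hasDerivAt_neg s)
          simp only [smul_eq_mul, neg_one_mul] at this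
          exact this
        have := ((h1 s).add e1).sub ((hasDerivAt_pow 2 s).const_mul c)
        refine HasDerivAt.hasDerivWithinAt ?_
        refine this.congr_deriv ?_
        norm_num; ring) (fun s hs => by
          have := hR s hs
          rw [Real.norm_eq_abs]
          rw [show G' s - G' (-s) - c * (2 * s) = (G' s - c * s) - (G' (-s) - c * (-s)) by ring]
          refine this.trans ?_
          have := mul_le_mul_of_nonneg_left hs.2 hδ
          linarith) ⟨le_rfl, ht⟩ ⟨ht, le_rfl⟩
  simp only [Real.norm_eq_abs, neg_zero, sub_zero, abs_of_nonneg ht] at this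
  rw [show G t + G (-t) - 2 * G 0 - c * t ^ 2 = G t + G (-t) - c * t ^ 2 - (G 0 + G 0 - c * 0 ^ 2) by ring]
  refine this.trans (le_of_eq (by ring))

/-- Second directional derivative. -/
def Dd (a : Euc 2) (φ : Euc 2 → ℝ) (x : Euc 2) : ℝ := fderiv ℝ (fun y => fderiv ℝ φ y a) x a

lemma Dd_ccs (a : Euc 2) {φ : Euc 2 → ℝ} (hφ : ContDiff ℝ 2 φ) (hc : HasCompactSupport φ) :
    CCs (Dd a φ) := by
  have h1 : ContDiff ℝ 1 (fun y => fderiv ℝ φ y a) :=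
    (hφ.fderiv_right (m := 1) (by norm_num)).clm_apply contDiff_const
  have c1 : HasCompactSupport (fun y => fderiv ℝ φ y a) := hc.fderiv_apply (𝕜 := ℝ) a
  exact ⟨(h1.continuous_fderiv (by norm_num)).clm_apply continuous_const,
    c1.fderiv_apply (𝕜 := ℝ) a⟩

lemma line_deriv {φ : Euc 2 → ℝ} (hφ : Differentiable ℝ φ) (x a : Euc 2) (t : ℝ) :
    HasDerivAt (fun t : ℝ => φ (x + t • a)) (fderiv ℝ φ (x + t • a) a) t := by
  have h1 : HasDerivAt (fun t : ℝ => x + t • a) a t := by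
    simpa using ((hasDerivAt_id t).smul_const a).const_add x
  exact (hφ _).hasFDerivAt.comp_hasDerivAt t h1

lemma ccs_unif {g : Euc 2 → ℝ} (hg : CCs g) {δ : ℝ} (hδ : 0 < δ) :
    ∃ η > 0, ∀ x y, ‖y‖ ≤ η → |g (x + y) - g x| ≤ δ := by
  have := hg.2.uniformContinuous_of_continuous hg.1
  rw [Metric.uniformContinuous_iff] at this
  obtain ⟨η, h0, H⟩ := this δ hδ
  refine ⟨η / 2, by linarith, fun x y hy => ?_⟩
  have := H (a := x + y) (b := x) (by simp [dist_eq_norm]; linarith)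
  rw [Real.dist_eq] at this
  exact this.le

lemma sd2 (a : Euc 2) {φ : Euc 2 → ℝ} (hφ : ContDiff ℝ 2 φ) (hc : HasCompactSupport φ) {δ : ℝ} (hδ : 0 < δ) :
    ∀ᶠ h in 𝓝[>] (0:ℝ), ∀ x, |(φ x - Qav (h • a) (Qav (h • a) φ) x) / h ^ 2 - (- Dd a φ x)| ≤ δ := by
  obtain ⟨η, h0, H⟩ := ccs_unif (Dd_ccs a hφ hc) (δ := δ/2) (by linarith)
  have h1 : ContDiff ℝ 1 (fun y => fderiv ℝ φ y a) :=
    (hφ.fderiv_right (m := 1) (by norm_num)).clm_apply contDiff_const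
  have ha : 0 < 2 * ‖a‖ + 1 := by positivity
  filter_upwards [Ioo_mem_nhdsGT (show (0:ℝ) < η / (2 * ‖a‖ + 1) by positivity)] with h hh x
  have hh0 := hh.1
  have hh1 := hh.2
  rw [lt_div_iff₀ ha] at hh1
  have := sd1 (G := fun t => φ (x + t • a)) (G' := fun t => fderiv ℝ φ (x + t • a) a)
    (G'' := fun t => Dd a φ (x + t • a)) (line_deriv (hφ.differentiable (by norm_num)) x a)
    (fun t => line_deriv (h1.differentiable (by norm_num)) x a t) (c := Dd a φ x) (δ := δ/2) (t := 2 * h) (by linarith)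
    (by linarith) (fun τ hτ => H x _ (by
      rw [norm_smul, Real.norm_eq_abs]
      have := mul_le_mul_of_nonneg_right hτ (norm_nonneg a)
      nlinarith))
  have e : φ x - Qav (h • a) (Qav (h • a) φ) x =
    - (φ (x + (2 * h) • a) + φ (x + (-(2 * h)) • a) - 2 * φ (x + (0:ℝ) • a)) / 4 := by
    simp only [Qav]
    rw [show x + h • a + h • a = x + (2 * h) • a by module,
      show x + h • a - h • a = x by module, show x - h • a + h • a = x by module,
      show x - h • a - h • a = x + (-(2 * h)) • a by module,
      show x + (0:ℝ) • a = x by simp]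
    ring
  rw [e]
  generalize φ (x + (2 * h) • a) + φ (x + (-(2 * h)) • a) - 2 * φ (x + (0:ℝ) • a) = A at *
  have e2 : (-A/4)/h^2 - (-Dd a φ x) = - (A - Dd a φ x * (2 * h) ^ 2) / (4 * h ^ 2) := by
    field_simp; ring
  rw [e2, abs_div, abs_neg, abs_of_pos (a := 4 * h ^ 2) (by positivity), div_le_iff₀ (by positivity)]
  refine this.trans (le_of_eq (by ring))

lemma Q_bd {g : Euc 2 → ℝ} {x a : Euc 2} {c δ : ℝ} (h1 : |g (x + a) - c| ≤ δ) (h2 : |g (x - a) - c| ≤ δ) :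
    |Qav a g x - c| ≤ δ := by
  rw [abs_le] at *
  simp only [Qav]
  constructor <;> linarith [h1.1, h1.2, h2.1, h2.2]

lemma sd3 (a b : Euc 2) {φ : Euc 2 → ℝ} (hφ : ContDiff ℝ 2 φ) (hc : HasCompactSupport φ) {δ : ℝ} (hδ : 0 < δ) :
    ∀ᶠ h in 𝓝[>] (0:ℝ), ∀ x, |(φ x - Tav (h • a) (h • b) (Tav (h • a) (h • b) φ) x) / h ^ 2
      - (- (Dd a φ x + Dd b φ x))| ≤ δ := by
  obtain ⟨η, h0, H⟩ := ccs_unif (Dd_ccs b hφ hc) (δ := δ/4) (by linarith)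
  have ha : 0 < 2 * ‖a‖ + 1 := by positivity
  filter_upwards [Ioo_mem_nhdsGT (show (0:ℝ) < η / (2 * ‖a‖ + 1) by positivity),
    sd2 a hφ hc (δ := δ/2) (by linarith), sd2 b hφ hc (δ := δ/4) (by linarith)] with h hh h1 h2 x
  have hh0 := hh.1
  have hh1 := hh.2
  rw [lt_div_iff₀ ha] at hh1
  set Gb : Euc 2 → ℝ := fun x => (φ x - Qav (h • b) (Qav (h • b) φ) x) / h ^ 2 with hGb
  have e : (φ x - Tav (h • a) (h • b) (Tav (h • a) (h • b) φ) x) / h ^ 2 =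
      (φ x - Qav (h • a) (Qav (h • a) φ) x) / h ^ 2 + Qav (h • a) (Qav (h • a) Gb) x := by
    unfold Tav
    rw [Q_comm (h • a) (h • b) (Qav (h • a) φ), Q_comm (h • b) (h • a), Q_comm (h • b) (h • a),
      Q_comm (h • b) (h • a), Q_comm (h • b) (h • a)]
    generalize hφ2 : Qav (h • b) (Qav (h • b) φ) = φ2 at *
    simp only [Qav, hGb]
    ring
  have key : ∀ y : Euc 2, ‖y‖ ≤ 2 * h * ‖a‖ → |Gb (x + y) - (-Dd b φ x)| ≤ δ / 2 := by
    intro y hy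
    have p1 := h2 (x + y)
    have p2 := H x y (by nlinarith)
    rw [abs_le] at *
    change -(δ/4) ≤ Gb (x + y) - _ ∧ Gb (x + y) - _ ≤ _ at p1
    constructor <;> linarith [p1.1, p1.2, p2.1, p2.2]
  have nh : ‖h • a‖ = h * ‖a‖ := by rw [norm_smul, Real.norm_eq_abs, abs_of_pos hh0]
  have n0 := norm_nonneg a
  have p3 : |Qav (h • a) (Qav (h • a) Gb) x - (-Dd b φ x)| ≤ δ / 2 := by
    apply Q_bd <;> apply Q_bd
    · have := key (h • a + h • a) ((norm_add_le _ _).trans (by rw [nh]; linarith))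
      rwa [← add_assoc] at this
    · have := key 0 (by simp; positivity)
      rwa [show x + h • a - h • a = x + 0 by module]
    · have := key 0 (by simp; positivity)
      rwa [show x - h • a + h • a = x + 0 by module]
    · have := key (-(h • a) - h • a) ((norm_sub_le _ _).trans (by rw [norm_neg, nh]; linarith))
      rwa [show x - h • a - h • a = x + (-(h • a) - h • a) by module]
  have p4 := h1 x
  rw [e]
  rw [abs_le] at *
  constructor <;> linarith [p3.1, p3.2, p4.1, p4.2]

lemma Q_supp {g : Euc 2 → ℝ} {ρ : ℝ} (hg : ∀ x, ρ < ‖x‖ → g x = 0) (a : Euc 2) {m : ℝ} (ha : ‖a‖ ≤ m) :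
    ∀ x, ρ + m < ‖x‖ → Qav a g x = 0 := by
  intro x hx
  simp only [Qav]
  rw [hg, hg]; simp
  · have := norm_sub_norm_le x a; linarith
  · have := norm_sub_norm_le x (-a); rw [norm_neg, sub_neg_eq_add] at this; linarith

lemma lim_int {F : ℝ → Euc 2 → ℝ} {F0 θ : Euc 2 → ℝ} {ρ : ℝ} (n : ℕ) (hn : n ≠ 0)
    (hF : ∀ h, Continuous (F h)) (hF0 : Continuous F0) (hθ : Continuous θ)
    (hu : ∀ δ > 0, ∀ᶠ h in 𝓝[>] (0:ℝ), ∀ x, |F h x - F0 x| ≤ δ)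
    (hs : ∀ᶠ h in 𝓝[>] (0:ℝ), ∀ x, ρ < ‖x‖ → F h x = 0) :
    Filter.Tendsto (fun h => ∫ x, F h x ^ n * θ x) (𝓝[>] 0) (𝓝 (∫ x, F0 x ^ n * θ x)) := by
  obtain ⟨M, hM⟩ := (isCompact_closedBall (0 : Euc 2) ρ).exists_bound_of_continuousOn hF0.continuousOn
  obtain ⟨M2, hM2⟩ := (isCompact_closedBall (0 : Euc 2) ρ).exists_bound_of_continuousOn hθ.continuousOn
  refine tendsto_integral_filter_of_dominated_convergence
    ((closedBall (0:Euc 2) ρ).indicator fun _ => (M + 1) ^ n * M2) ?_ ?_ ?_ ?_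
  · exact .of_forall fun h => (((hF h).pow n).mul hθ).aestronglyMeasurable
  · filter_upwards [hu 1 one_pos, hs] with h h1 h2
    refine .of_forall fun x => ?_
    by_cases hx : x ∈ closedBall (0:Euc 2) ρ
    · rw [indicator_of_mem hx, norm_mul, norm_pow]
      have a1 := hM x hx
      have a2 := hM2 x hx
      have a3 := h1 x
      have a4 : ‖F h x‖ ≤ M + 1 := by
        have := norm_sub_norm_le (F h x) (F0 x)
        rw [← Real.norm_eq_abs] at a3
        linarith
      have : 0 ≤ M + 1 := (norm_nonneg _).trans a4
      gcongr
    · rw [indicator_of_notMem hx, h2 x (by simpa using hx)]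
      simp [hn]
  · exact (integrable_indicator_iff measurableSet_closedBall).2
      (integrableOn_const measure_closedBall_lt_top.ne)
  · refine .of_forall fun x => ?_
    refine Filter.Tendsto.mul_const _ (Filter.Tendsto.pow ?_ n)
    rw [Metric.tendsto_nhds]
    intro δ hδ
    filter_upwards [hu (δ/2) (by linarith)] with h h1
    rw [Real.dist_eq]; linarith [h1 x]

lemma key_cont (j : ℕ) : ∃ K : ℝ, 0 < K ∧ ∀ (φ θ : Euc 2 → ℝ), ContDiff ℝ 2 φ → HasCompactSupport φ →
    CCs θ → ∀ (a b : Euc 2),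
    ∫ x, (-Dd a φ x) * θ x ^ (2*j+3) ≤
      K * (∫ x, (Dd a φ x + Dd b φ x) ^ (2*j+4)) + 2 * ∫ x, θ x ^ (2*j+4) := by
  obtain ⟨K, hK, H⟩ := key_disc j
  refine ⟨K, hK, fun φ θ hφ hc hθ a b => ?_⟩
  have cφ : CCs φ := ⟨hφ.continuous, hc⟩
  obtain ⟨ρ, hρ⟩ : ∃ ρ, ∀ x, ρ < ‖x‖ → φ x = 0 := by
    obtain ⟨ρ, hρ⟩ := hc.isCompact.isBounded.subset_closedBall (0:Euc 2)
    refine ⟨ρ, fun x hx => ?_⟩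
    by_contra h
    have := hρ (subset_tsupport φ h)
    simp at this; linarith
  have ev : Even (2 * j + 4) := ⟨j + 2, by ring⟩
  have L1 := lim_int (F := fun h x => (φ x - Qav (h • a) (Qav (h • a) φ) x) / h ^ 2)
    (F0 := fun x => -Dd a φ x) (θ := fun x => θ x ^ (2*j+3)) (ρ := ρ + ‖a‖ + ‖a‖) 1 (by norm_num)
    (fun h => by have := ((cφ.Q (h • a)).Q (h • a)).1; have := cφ.1; fun_prop)
    (Dd_ccs a hφ hc).1.neg (hθ.1.pow _) (fun δ hδ => sd2 a hφ hc hδ) (by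
      filter_upwards [Ioo_mem_nhdsGT (show (0:ℝ) < 1 by norm_num)] with h hh x hx
      have n0 := norm_nonneg a
      have nh : ‖h • a‖ ≤ ‖a‖ := by
        rw [norm_smul, Real.norm_eq_abs, abs_of_pos hh.1]; nlinarith [hh.2]
      rw [Q_supp (Q_supp hρ _ nh) _ nh x hx, hρ x (by linarith)]; simp)
  have L2 := lim_int (F := fun h x => (φ x - Tav (h • a) (h • b) (Tav (h • a) (h • b) φ) x) / h ^ 2)
    (F0 := fun x => -(Dd a φ x + Dd b φ x)) (θ := fun x => 1) (ρ := ρ + ‖a‖ + ‖b‖ + ‖a‖ + ‖b‖) (2*j+4) (by omega)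
    (fun h => by have := (cφ.Tn (h • a) (h • b) 2).1; have := cφ.1
                 simp only [Function.iterate_succ_apply, Function.iterate_zero, id] at *
                 fun_prop)
    ((Dd_ccs a hφ hc).1.add (Dd_ccs b hφ hc).1).neg continuous_const (fun δ hδ => sd3 a b hφ hc hδ) (by
      filter_upwards [Ioo_mem_nhdsGT (show (0:ℝ) < 1 by norm_num)] with h hh x hx
      have n0 := norm_nonneg a
      have n1 := norm_nonneg b
      have nh : ‖h • a‖ ≤ ‖a‖ := by
        rw [norm_smul, Real.norm_eq_abs, abs_of_pos hh.1]; nlinarith [hh.2]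
      have nh2 : ‖h • b‖ ≤ ‖b‖ := by
        rw [norm_smul, Real.norm_eq_abs, abs_of_pos hh.1]; nlinarith [hh.2]
      unfold Tav
      rw [Q_supp (Q_supp (Q_supp (Q_supp hρ _ nh) _ nh2) _ nh) _ nh2 x hx, hρ x (by linarith)]; simp)
  simp only [pow_one, mul_one, ev.neg_pow] at L1 L2
  refine le_of_tendsto_of_tendsto L1 ((L2.const_mul K).add_const (2 * ∫ x, θ x ^ (2*j+4))) ?_
  filter_upwards [self_mem_nhdsWithin] with h hh
  have hh : 0 < h := hh
  have := H (fun x => φ x / h ^ 2) θ (by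
    have := cφ.const_mul (1/h^2)
    convert this using 1; ext x; ring) hθ (h • a) (h • b)
  have e1 : ∀ (c : Euc 2) (g : Euc 2 → ℝ), Qav c (fun x => g x / h ^ 2) = fun x => Qav c g x / h ^ 2 := by
    intro c g; ext x; simp only [Qav]; ring
  have e2 : ∀ (g : Euc 2 → ℝ), Tav (h • a) (h • b) (fun x => g x / h ^ 2) =
      fun x => Tav (h • a) (h • b) g x / h ^ 2 := by
    intro g; unfold Tav; rw [e1, e1]
  rw [e1, e1, e2, e2] at this
  simp only [← sub_div] at this
  have cT : CCs (fun x => (φ x - Tav (h • a) (h • b) (Tav (h • a) (h • b) φ) x) / h ^ 2) := by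
    have := (cφ.sub (cφ.Tn (h • a) (h • b) 2)).const_mul (1/h^2)
    convert this using 1; ext x
    simp only [Function.iterate_succ_apply, Function.iterate_zero, id]; ring
  rw [integral_add ((cT.pow _ (by omega)).const_mul K).integrable ((hθ.pow _ (by omega)).const_mul 2).integrable,
    integral_const_mul, integral_const_mul] at this
  exact this

lemma cz1 (j : ℕ) : ∃ C : ℝ, 0 < C ∧ ∀ (φ : Euc 2 → ℝ), ContDiff ℝ 2 φ → HasCompactSupport φ →
    ∀ (a b : Euc 2), ∫ x, Dd a φ x ^ (2*j+4) ≤ C * ∫ x, (Dd a φ x + Dd b φ x) ^ (2*j+4) := by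
  obtain ⟨K, hK, H⟩ := key_cont j
  refine ⟨K / ((1/4) ^ (2*j+3) / 2), by positivity, fun φ hφ hc a b => ?_⟩
  have h := H φ (fun x => -(1/4) * Dd a φ x) hφ hc ((Dd_ccs a hφ hc).const_mul _) a b
  have ev : Even (2 * j + 4) := ⟨j + 2, by ring⟩
  have od : Odd (2 * j + 3) := ⟨j + 1, by ring⟩
  have e1 : ∫ x, (-Dd a φ x) * (-(1/4) * Dd a φ x) ^ (2*j+3) = (1/4)^(2*j+3) * ∫ x, Dd a φ x ^ (2*j+4) := by
    rw [← integral_const_mul]; congr 1; ext x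
    rw [mul_pow, od.neg_pow]; ring
  have e2 : ∫ x, (-(1/4) * Dd a φ x) ^ (2*j+4) = (1/4)^(2*j+4) * ∫ x, Dd a φ x ^ (2*j+4) := by
    rw [← integral_const_mul]; congr 1; ext x
    rw [mul_pow, ev.neg_pow]
  rw [e1, e2] at h
  rw [div_mul_eq_mul_div, le_div_iff₀ (by positivity)]
  have : ((1:ℝ)/4)^(2*j+4) = (1/4)^(2*j+3) * (1/4) := by ring
  rw [this] at h
  linarith

lemma pd2_eq_Dd (i : Fin 2) (φ : Euc 2 → ℝ) : pd2 i i φ = Dd (EuclideanSpace.single i 1) φ := rfl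

lemma pd2_fd (i j : Fin 2) {φ : Euc 2 → ℝ} {x : Euc 2} (hφ : ContDiffAt ℝ 2 φ x) :
    pd2 i j φ x = fderiv ℝ (fderiv ℝ φ) x (EuclideanSpace.single j 1) (EuclideanSpace.single i 1) := by
  have h1 : DifferentiableAt ℝ (fderiv ℝ φ) x :=
    (hφ.fderiv_right (m := 1) (by norm_num)).differentiableAt (by norm_num)
  have := (h1.hasFDerivAt.clm_apply (hasFDerivAt_const (EuclideanSpace.single i (1:ℝ)) x)).fderiv
  unfold pd2
  change fderiv ℝ (fun y => fderiv ℝ φ y (EuclideanSpace.single i 1)) x _ = _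
  rw [this]; simp

lemma Dd_fd (a : Euc 2) {φ : Euc 2 → ℝ} {x : Euc 2} (hφ : ContDiffAt ℝ 2 φ x) :
    Dd a φ x = fderiv ℝ (fderiv ℝ φ) x a a := by
  have h1 : DifferentiableAt ℝ (fderiv ℝ φ) x :=
    (hφ.fderiv_right (m := 1) (by norm_num)).differentiableAt (by norm_num)
  have := (h1.hasFDerivAt.clm_apply (hasFDerivAt_const a x)).fderiv
  unfold Dd
  rw [this]; simp

lemma pd2_symm (i j : Fin 2) {φ : Euc 2 → ℝ} {x : Euc 2} (hφ : ContDiffAt ℝ 2 φ x) :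
    pd2 i j φ x = pd2 j i φ x := by
  rw [pd2_fd i j hφ, pd2_fd j i hφ]
  exact (hφ.isSymmSndFDerivAt (by simp)).eq _ _

lemma cz (j : ℕ) : ∃ C : ℝ, 0 < C ∧ ∀ (φ : Euc 2 → ℝ), ContDiff ℝ 2 φ → HasCompactSupport φ →
    ∀ (m n : Fin 2), ∫ x, pd2 m n φ x ^ (2*j+4) ≤ C * ∫ x, (pd2 0 0 φ x + pd2 1 1 φ x) ^ (2*j+4) := by
  obtain ⟨K, hK, H⟩ := cz1 j
  have ev : Even (2 * j + 4) := ⟨j + 2, by ring⟩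
  have h16 : (1:ℝ) ≤ 2 ^ (2*j+4) := one_le_pow₀ (by norm_num)
  refine ⟨K * 2 ^ (2*j+4), by positivity, fun φ hφ hc m n => ?_⟩
  set I := ∫ x, (pd2 0 0 φ x + pd2 1 1 φ x) ^ (2*j+4) with hI
  have hI0 : 0 ≤ I := integral_nonneg fun x => ev.pow_nonneg _
  have hd (i : Fin 2) : ∫ x, pd2 i i φ x ^ (2*j+4) ≤ K * I := by
    have h0 := H φ hφ hc (EuclideanSpace.single 0 1) (EuclideanSpace.single 1 1)
    have h1 := H φ hφ hc (EuclideanSpace.single 1 1) (EuclideanSpace.single 0 1)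
    simp only [← pd2_eq_Dd] at h0 h1
    simp only [add_comm (pd2 1 1 φ _)] at h1
    fin_cases i
    · exact h0
    · exact h1
  have hd' (i : Fin 2) : ∫ x, pd2 i i φ x ^ (2*j+4) ≤ K * 2 ^ (2*j+4) * I :=
    (hd i).trans (by have := mul_nonneg hK.le hI0; nlinarith)
  set e0 : Euc 2 := EuclideanSpace.single 0 1
  set e1 : Euc 2 := EuclideanSpace.single 1 1
  have off : ∫ x, pd2 0 1 φ x ^ (2*j+4) ≤ K * 2 ^ (2*j+4) * I := by
    have h0 := H φ hφ hc (e0 + e1) (e0 - e1)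
    have h1 := H φ hφ hc (e0 - e1) (e0 + e1)
    have c1 := Dd_ccs (e0 + e1) hφ hc
    have c2 := Dd_ccs (e0 - e1) hφ hc
    have ep (x) : Dd (e0 + e1) φ x = pd2 0 0 φ x + 2 * pd2 0 1 φ x + pd2 1 1 φ x := by
      have hx := hφ.contDiffAt (x := x)
      have s := pd2_symm 0 1 hx
      rw [Dd_fd _ hx, pd2_fd 0 0 hx, pd2_fd 1 1 hx]
      rw [two_mul]; nth_rw 2 [s]
      rw [pd2_fd 0 1 hx, pd2_fd 1 0 hx]
      simp only [map_add, _root_.add_apply]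
      ring
    have em (x) : Dd (e0 - e1) φ x = pd2 0 0 φ x - 2 * pd2 0 1 φ x + pd2 1 1 φ x := by
      have hx := hφ.contDiffAt (x := x)
      have s := pd2_symm 0 1 hx
      rw [Dd_fd _ hx, pd2_fd 0 0 hx, pd2_fd 1 1 hx]
      rw [two_mul]; nth_rw 2 [s]
      rw [pd2_fd 0 1 hx, pd2_fd 1 0 hx]
      simp only [map_sub, _root_.sub_apply]
      ring
    have es : ∀ x, Dd (e0 + e1) φ x + Dd (e0 - e1) φ x = 2 * (pd2 0 0 φ x + pd2 1 1 φ x) := by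
      intro x; rw [ep, em]; ring
    simp only [add_comm (Dd (e0 - e1) φ _)] at h1
    simp only [es, mul_pow] at h0 h1
    rw [integral_const_mul, ← hI] at h0 h1
    have hp : ∀ x, pd2 0 1 φ x ^ (2*j+4) ≤ 1/2 * Dd (e0 + e1) φ x ^ (2*j+4) + 1/2 * Dd (e0 - e1) φ x ^ (2*j+4) := by
      intro x
      have e : 2 * pd2 0 1 φ x = 1/2 * Dd (e0+e1) φ x + 1/2 * (-Dd (e0-e1) φ x) := by rw [ep, em]; ring
      have c : ConvexOn ℝ univ fun x : ℝ => x ^ (2 * j + 4) := ev.convexOn_pow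
      have := c.2 (mem_univ (Dd (e0+e1) φ x)) (mem_univ (-Dd (e0-e1) φ x)) (by norm_num : (0:ℝ) ≤ 1/2)
        (by norm_num : (0:ℝ) ≤ 1/2) (by norm_num)
      simp only [smul_eq_mul, ev.neg_pow] at this
      rw [← e, mul_pow] at this
      have := ev.pow_nonneg (pd2 0 1 φ x)
      nlinarith
    have c3 : CCs (fun x => 1/2 * Dd (e0 + e1) φ x ^ (2*j+4) + 1/2 * Dd (e0 - e1) φ x ^ (2*j+4)) :=
      ((c1.pow _ (by omega)).const_mul _).add ((c2.pow _ (by omega)).const_mul _)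
    have := integral_mono_of_nonneg (.of_forall fun x => ev.pow_nonneg _) c3.integrable (.of_forall hp)
    rw [integral_add ((c1.pow _ (by omega)).const_mul _).integrable ((c2.pow _ (by omega)).const_mul _).integrable,
      integral_const_mul, integral_const_mul] at this
    linarith
  have off' : ∫ x, pd2 1 0 φ x ^ (2*j+4) ≤ K * 2 ^ (2*j+4) * I := by
    simp only [fun x => pd2_symm 1 0 (hφ.contDiffAt (x := x))]; exact off
  fin_cases m <;> fin_cases n
  · exact hd' 0
  · exact off
  · exact off'
  · exact hd' 1


lemma grad_coord (u : Euc 2 → ℝ) (x : Euc 2) (i : Fin 2) : gradient u x i = pd i u x := by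
  have h : ⟪EuclideanSpace.single i (1:ℝ), gradient u x⟫ = gradient u x i := by
    rw [EuclideanSpace.inner_single_left]; simp
  rw [← h, real_inner_comm]
  unfold gradient pd
  rw [InnerProductSpace.toDual_symm_apply]

lemma grad_sq (u : Euc 2 → ℝ) (x : Euc 2) : ‖gradient u x‖ ^ 2 = pd 0 u x ^ 2 + pd 1 u x ^ 2 := by
  rw [EuclideanSpace.norm_sq_eq, Fin.sum_univ_two, grad_coord, grad_coord]
  simp

lemma pd_mul (i : Fin 2) {u v : Euc 2 → ℝ} {x : Euc 2} (hu : DifferentiableAt ℝ u x) (hv : DifferentiableAt ℝ v x) :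
    pd i (fun y => u y * v y) x = pd i u x * v x + u x * pd i v x := by
  unfold pd; rw [fderiv_fun_mul hu hv]
  simp [smul_eq_mul]; ring

lemma pd_add (i : Fin 2) {u v : Euc 2 → ℝ} {x : Euc 2} (hu : DifferentiableAt ℝ u x) (hv : DifferentiableAt ℝ v x) :
    pd i (fun y => u y + v y) x = pd i u x + pd i v x := by
  unfold pd; rw [fderiv_fun_add hu hv]; simp

lemma pd_sub (i : Fin 2) {u v : Euc 2 → ℝ} {x : Euc 2} (hu : DifferentiableAt ℝ u x) (hv : DifferentiableAt ℝ v x) :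
    pd i (fun y => u y - v y) x = pd i u x - pd i v x := by
  unfold pd; rw [fderiv_fun_sub hu hv]; simp

lemma pd_const (i : Fin 2) (c : ℝ) (x : Euc 2) : pd i (fun _ => c) x = 0 := by
  unfold pd; simp

lemma pd_comp (i : Fin 2) {u : Euc 2 → ℝ} {g : ℝ → ℝ} {g' : ℝ} {x : Euc 2} (hu : DifferentiableAt ℝ u x)
    (hg : HasDerivAt g g' (u x)) : pd i (fun y => g (u y)) x = g' * pd i u x := by
  unfold pd
  have := (hg.comp_hasFDerivAt x hu.hasFDerivAt).fderiv
  change fderiv ℝ (g ∘ u) x _ = _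
  rw [this]; simp

lemma pd_pow (i : Fin 2) (n : ℕ) {u : Euc 2 → ℝ} {x : Euc 2} (hu : DifferentiableAt ℝ u x) :
    pd i (fun y => u y ^ n) x = (n * u x ^ (n - 1)) * pd i u x :=
  pd_comp i hu (hasDerivAt_pow n _)

lemma pd_rpow (i : Fin 2) (c : ℝ) {u : Euc 2 → ℝ} {x : Euc 2} (hu : DifferentiableAt ℝ u x) (h0 : 0 < u x) :
    pd i (fun y => u y ^ c) x = (c * u x ^ (c - 1)) * pd i u x :=
  pd_comp i hu (Real.hasDerivAt_rpow_const (Or.inl h0.ne'))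

lemma pd_const_mul (i : Fin 2) (c : ℝ) {u : Euc 2 → ℝ} {x : Euc 2} (hu : DifferentiableAt ℝ u x) :
    pd i (fun y => c * u y) x = c * pd i u x := by
  rw [pd_mul i (by fun_prop) hu, pd_const]; ring

lemma pd_congr (i : Fin 2) {u v : Euc 2 → ℝ} {x : Euc 2} (h : u =ᶠ[𝓝 x] v) : pd i u x = pd i v x := by
  unfold pd; rw [h.fderiv_eq]

lemma pd_congr' (i : Fin 2) {u v : Euc 2 → ℝ} {x : Euc 2} (h : u =ᶠ[𝓝 x] v) : pd i u =ᶠ[𝓝 x] pd i v := by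
  filter_upwards [h.eventually_nhds] with y hy
  exact pd_congr i hy

lemma pd_pd (i j : Fin 2) (u : Euc 2 → ℝ) : pd j (pd i u) = pd2 i j u := rfl

lemma pd2_congr (i j : Fin 2) {u v : Euc 2 → ℝ} {x : Euc 2} (h : u =ᶠ[𝓝 x] v) : pd2 i j u x = pd2 i j v x := by
  rw [← pd_pd, ← pd_pd]; exact pd_congr j (pd_congr' i h)

lemma pd_contDiffAt (i : Fin 2) {u : Euc 2 → ℝ} {x : Euc 2} {m n : ℕ} (hu : ContDiffAt ℝ m u x) (h : n + 1 ≤ m) :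
    ContDiffAt ℝ n (pd i u) x :=
  (hu.fderiv_right (m := n) (by exact_mod_cast h)).clm_apply contDiffAt_const

lemma pd_contDiff (i : Fin 2) {u : Euc 2 → ℝ} {m n : ℕ} (hu : ContDiff ℝ m u) (h : n + 1 ≤ m) :
    ContDiff ℝ n (pd i u) :=
  (hu.fderiv_right (m := n) (by exact_mod_cast h)).clm_apply contDiff_const

lemma pd_cs (i : Fin 2) {u : Euc 2 → ℝ} (hu : HasCompactSupport u) : HasCompactSupport (pd i u) :=
  hu.fderiv_apply (𝕜 := ℝ) _

lemma pd_ccs (i : Fin 2) {u : Euc 2 → ℝ} (hu : ContDiff ℝ 1 u) (hc : HasCompactSupport u) : CCs (pd i u) :=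
  ⟨(pd_contDiff (m := 1) (n := 0) i (by exact_mod_cast hu) (by norm_num)).continuous, pd_cs i hc⟩

lemma pd_supp (i : Fin 2) (u : Euc 2 → ℝ) : tsupport (pd i u) ⊆ tsupport u :=
  tsupport_fderiv_apply_subset ℝ _

/-- `ε + |∇u|²`. -/
def Wf (ε : ℝ) (u : Euc 2 → ℝ) (x : Euc 2) : ℝ := ε + (pd 0 u x ^ 2 + pd 1 u x ^ 2)

lemma Wf_eq (ε : ℝ) (u : Euc 2 → ℝ) (x : Euc 2) : ε + ‖gradient u x‖ ^ 2 = Wf ε u x := by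
  rw [grad_sq]; rfl

lemma Wf_pos {ε : ℝ} (hε : 0 < ε) (u : Euc 2 → ℝ) (x : Euc 2) : 0 < Wf ε u x := by
  unfold Wf; positivity

lemma Wf_diffAt (ε : ℝ) {u : Euc 2 → ℝ} {x : Euc 2} (hu : ContDiffAt ℝ 2 u x) : DifferentiableAt ℝ (Wf ε u) x := by
  have h0 := (pd_contDiffAt 0 (n := 1) (m := 2) hu le_rfl).differentiableAt (by norm_num)
  have h1 := (pd_contDiffAt 1 (n := 1) (m := 2) hu le_rfl).differentiableAt (by norm_num)
  unfold Wf; fun_prop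

lemma pd_Wf (ε : ℝ) (i : Fin 2) {u : Euc 2 → ℝ} {x : Euc 2} (hu : ContDiffAt ℝ 2 u x) :
    pd i (Wf ε u) x = 2 * (pd 0 u x * pd2 0 i u x + pd 1 u x * pd2 1 i u x) := by
  have h0 := (pd_contDiffAt 0 (n := 1) (m := 2) hu le_rfl).differentiableAt (by norm_num)
  have h1 := (pd_contDiffAt 1 (n := 1) (m := 2) hu le_rfl).differentiableAt (by norm_num)
  unfold Wf
  rw [pd_add i (by fun_prop) (by fun_prop), pd_add i (by fun_prop) (by fun_prop), pd_const,
    pd_pow i 2 h0, pd_pow i 2 h1, pd_pd, pd_pd]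
  norm_num; ring

lemma Wf_contDiff (ε : ℝ) {u : Euc 2 → ℝ} {m n : ℕ} (hu : ContDiff ℝ m u) (h : n + 1 ≤ m) : ContDiff ℝ n (Wf ε u) := by
  have h0 := pd_contDiff 0 hu h
  have h1 := pd_contDiff 1 hu h
  unfold Wf; fun_prop

lemma Wf_rpow_contDiff {ε : ℝ} (hε : 0 < ε) (c : ℝ) {u : Euc 2 → ℝ} {m n : ℕ} (hu : ContDiff ℝ m u) (h : n + 1 ≤ m) :
    ContDiff ℝ n (fun x => Wf ε u x ^ c) :=
  (Wf_contDiff ε hu h).rpow_const_of_ne fun x => (Wf_pos hε u x).ne'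

/-- Expanded regularized operator. -/
def Lreg (p ε : ℝ) (u : Euc 2 → ℝ) (x : Euc 2) : ℝ :=
  Wf ε u x ^ ((p-2)/2) * (pd2 0 0 u x + pd2 1 1 u x) +
    (p - 2) * Wf ε u x ^ ((p-2)/2 - 1) * (pd 0 u x ^ 2 * pd2 0 0 u x +
      2 * (pd 0 u x * pd 1 u x * pd2 0 1 u x) + pd 1 u x ^ 2 * pd2 1 1 u x)

lemma Lreg_div {p ε : ℝ} (hε : 0 < ε) {u : Euc 2 → ℝ} {x : Euc 2} (hu : ContDiffAt ℝ 2 u x) :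
    ∑ i : Fin 2, pd i (fun y => Wf ε u y ^ ((p-2)/2) * pd i u y) x = Lreg p ε u x := by
  have h0 := (pd_contDiffAt 0 (n := 1) (m := 2) hu le_rfl).differentiableAt (by norm_num)
  have h1 := (pd_contDiffAt 1 (n := 1) (m := 2) hu le_rfl).differentiableAt (by norm_num)
  have hW := Wf_diffAt ε hu
  have hWp := Wf_pos hε u x
  have hWr : DifferentiableAt ℝ (fun y => Wf ε u y ^ ((p-2)/2)) x :=
    hW.rpow_const (Or.inl hWp.ne')
  rw [Fin.sum_univ_two, pd_mul 0 hWr h0, pd_mul 1 hWr h1, pd_rpow 0 _ hW hWp, pd_rpow 1 _ hW hWp,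
    pd_Wf ε 0 hu, pd_Wf ε 1 hu, pd_pd, pd_pd, pd2_symm 1 0 hu]
  unfold Lreg
  ring

lemma solves_Lreg {p ε : ℝ} (hε : 0 < ε) {f u : Euc 2 → ℝ} {B : Set (Euc 2)} (hs : SolvesReg p ε f u B)
    {x : Euc 2} (hx : x ∈ B) (hu : ContDiffAt ℝ 2 u x) : Lreg p ε u x = - f x := by
  rw [← hs x hx, neg_neg, ← Lreg_div hε hu]
  refine Finset.sum_congr rfl fun i _ => ?_
  unfold pd
  congr 2
  ext y
  rw [Wf_eq]
  change _ = Wf ε u y ^ ((p-2)/2) * gradient u y i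
  rw [grad_coord]; rfl

lemma gfun_eq (k ε : ℝ) (i j : Fin 2) (u : Euc 2 → ℝ) (x : Euc 2) :
    gfun k ε i j u x = Wf ε u x ^ (k/2) * |pd2 i j u x| := by
  unfold gfun; rw [Wf_eq]

lemma Wf_congr (ε : ℝ) {u v : Euc 2 → ℝ} {x : Euc 2} (h : u =ᶠ[𝓝 x] v) : Wf ε u x = Wf ε v x := by
  unfold Wf; rw [pd_congr 0 h, pd_congr 1 h]

lemma Lreg_congr (p ε : ℝ) {u v : Euc 2 → ℝ} {x : Euc 2} (h : u =ᶠ[𝓝 x] v) : Lreg p ε u x = Lreg p ε v x := by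
  unfold Lreg
  rw [Wf_congr ε h, pd_congr 0 h, pd_congr 1 h, pd2_congr 0 0 h, pd2_congr 1 1 h, pd2_congr 0 1 h]

/-- integration of a derivative -/
lemma int_pd (i : Fin 2) {g : Euc 2 → ℝ} (hg : ContDiff ℝ 1 g) (hc : HasCompactSupport g) :
    ∫ x, pd i g x = 0 := by
  have h := integral_mul_fderiv_eq_neg_fderiv_mul_of_integrable (𝕜 := ℝ) (μ := (volume : Measure (Euc 2)))
    (f := fun _ => (1:ℝ)) (g := g) (v := EuclideanSpace.single i 1)
    (by simp) (by simp only [one_mul]; exact (pd_ccs i hg hc).integrable)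
    (by simpa using (CCs.integrable ⟨hg.continuous, hc⟩)) (by fun_prop)
    (fun x _ => hg.differentiable (by norm_num) x)
  simp only [one_mul, fderiv_fun_const, Pi.zero_apply, _root_.zero_apply, zero_mul, integral_zero, neg_zero] at h
  exact h

lemma ibp (i : Fin 2) {u v : Euc 2 → ℝ} (hu : ContDiff ℝ 1 u) (hv : ContDiff ℝ 1 v) (hc : HasCompactSupport v) :
    ∫ x, u x * pd i v x = - ∫ x, pd i u x * v x := by
  have h := int_pd i (hu.mul hv) hc.mul_left
  have e : ∀ x, pd i (fun y => u y * v y) x = pd i u x * v x + u x * pd i v x := fun x =>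
    pd_mul i (hu.differentiable (by norm_num) x) (hv.differentiable (by norm_num) x)
  have hu1 : Continuous (pd i u) := (pd_contDiff (m := 1) (n := 0) i (by exact_mod_cast hu) (by norm_num)).continuous
  have e' : ∫ x, pd i (fun y => u y * v y) x = ∫ x, (pd i u x * v x + u x * pd i v x) := by
    congr 1; ext x; exact e x
  have cv : CCs v := ⟨hv.continuous, hc⟩
  have i1 : Integrable (fun x => pd i u x * v x) := by
    have := (cv.mul_cont hu1).integrable; simpa only [mul_comm] using this
  have i2 : Integrable (fun x => u x * pd i v x) := by
    have := ((pd_ccs i hv hc).mul_cont hu.continuous).integrable; simpa only [mul_comm] using this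
  rw [integral_add i1 i2] at e'
  change ∫ x, pd i (fun y => u y * v y) x = 0 at h
  linarith


lemma line_derivAt {φ : Euc 2 → ℝ} {x a : Euc 2} {t : ℝ} (hφ : DifferentiableAt ℝ φ (x + t • a)) :
    HasDerivAt (fun t : ℝ => φ (x + t • a)) (fderiv ℝ φ (x + t • a) a) t := by
  have h1 : HasDerivAt (fun t : ℝ => x + t • a) a t := by
    simpa using ((hasDerivAt_id t).smul_const a).const_add x
  exact hφ.hasFDerivAt.comp_hasDerivAt t h1

lemma maxcond {u : Euc 2 → ℝ} {x z : Euc 2} {A : ℝ} (hu : ContDiffAt ℝ 2 u x)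
    (hm : IsLocalMax (fun y => u y + A / 2 * ‖y - z‖ ^ 2) x) (a : Euc 2) :
    fderiv ℝ u x a = - A * ⟪x - z, a⟫ ∧ Dd a u x ≤ - A * ‖a‖ ^ 2 := by
  set g : ℝ → ℝ := fun t => u (x + t • a) + A / 2 * ‖x + t • a - z‖ ^ 2 with hg
  have hline : Filter.Tendsto (fun t : ℝ => x + t • a) (𝓝 0) (𝓝 x) := by
    have : Continuous (fun t : ℝ => x + t • a) := by fun_prop
    simpa using this.tendsto 0
  have gm : IsLocalMax g 0 := by
    have := hline.eventually hm
    filter_upwards [this] with t ht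
    simpa [hg] using ht
  have hq : ∀ t : ℝ, ‖x + t • a - z‖ ^ 2 = ‖x - z‖ ^ 2 + 2 * t * ⟪x - z, a⟫ + t ^ 2 * ‖a‖ ^ 2 := by
    intro t
    rw [show x + t • a - z = (x - z) + t • a by abel, norm_add_sq_real, norm_smul, inner_smul_right,
      mul_pow, Real.norm_eq_abs, sq_abs]; ring
  have hd : ∀ᶠ t in 𝓝 (0:ℝ), HasDerivAt g (fderiv ℝ u (x + t • a) a + A * (⟪x - z, a⟫ + t * ‖a‖ ^ 2)) t := by
    have e : ∀ᶠ y in 𝓝 x, ContDiffAt ℝ 2 u y := hu.eventually (by simp)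
    filter_upwards [hline.eventually e] with t ht
    have d1 := line_derivAt (ht.differentiableAt (by norm_num))
    have d2 : HasDerivAt (fun t : ℝ => A / 2 * ‖x + t • a - z‖ ^ 2) (A * (⟪x - z, a⟫ + t * ‖a‖ ^ 2)) t := by
      simp only [hq]
      have := (((((hasDerivAt_id t).const_mul 2).mul_const ⟪x - z, a⟫).const_add (‖x - z‖ ^ 2)).add
        ((hasDerivAt_pow 2 t).mul_const (‖a‖ ^ 2))).const_mul (A / 2)
      refine this.congr_deriv ?_
      norm_num; ring
    exact d1.add d2
  have h0 := hd.self_of_nhds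
  have z0 := gm.hasDerivAt_eq_zero h0
  simp only [zero_smul, add_zero, zero_mul] at z0
  refine ⟨by linarith, ?_⟩
  have hdd : HasDerivAt (deriv g) (Dd a u x + A * ‖a‖ ^ 2) 0 := by
    have e : deriv g =ᶠ[𝓝 0] fun t => fderiv ℝ u (x + t • a) a + A * (⟪x - z, a⟫ + t * ‖a‖ ^ 2) := by
      filter_upwards [hd] with t ht using ht.deriv
    refine HasDerivAt.congr_of_eventuallyEq ?_ e
    have hf : DifferentiableAt ℝ (fun y => fderiv ℝ u y a) x :=
      ((hu.fderiv_right (m := 1) (by norm_num)).clm_apply contDiffAt_const).differentiableAt (by norm_num)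
    have d1 := line_derivAt (φ := fun y => fderiv ℝ u y a) (x := x) (a := a) (t := 0) (by simpa using hf)
    simp only [zero_smul, add_zero] at d1
    have d2 : HasDerivAt (fun t : ℝ => A * (⟪x - z, a⟫ + t * ‖a‖ ^ 2)) (A * ‖a‖ ^ 2) 0 := by
      have := (((hasDerivAt_id (0:ℝ)).mul_const (‖a‖ ^ 2)).const_add ⟪x - z, a⟫).const_mul A
      simpa using this
    exact d1.add d2
  by_contra hc
  push Not at hc
  have hmin := isLocalMin_of_deriv_deriv_pos (f := g) (x₀ := 0) (by rw [hdd.deriv]; linarith)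
    gm.deriv_eq_zero h0.continuousAt
  have heq : g =ᶠ[𝓝 0] fun _ => g 0 := by
    filter_upwards [gm, hmin] with t h1 h2 using le_antisymm h1 h2
  have : deriv (deriv g) 0 = 0 := by
    rw [heq.deriv.deriv_eq]; simp
  rw [hdd.deriv] at this
  linarith

lemma Dd_expand {u : Euc 2 → ℝ} {x : Euc 2} (hu : ContDiffAt ℝ 2 u x) (s t : ℝ) :
    Dd (s • EuclideanSpace.single 0 1 + t • EuclideanSpace.single 1 1) u x =
      s ^ 2 * pd2 0 0 u x + 2 * (s * t * pd2 0 1 u x) + t ^ 2 * pd2 1 1 u x := by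
  have h := pd2_symm 0 1 hu
  rw [pd2_fd 0 1 hu, pd2_fd 1 0 hu] at h
  rw [Dd_fd _ hu, pd2_fd 0 0 hu, pd2_fd 1 1 hu, pd2_fd 0 1 hu]
  simp only [map_add, map_smul, _root_.add_apply, _root_.smul_apply, smul_eq_mul, ← h]
  ring

lemma norm_st (s t : ℝ) : ‖(s • EuclideanSpace.single 0 1 + t • EuclideanSpace.single 1 1 : Euc 2)‖ ^ 2 = s ^ 2 + t ^ 2 := by
  rw [EuclideanSpace.norm_sq_eq, Fin.sum_univ_two]
  simp

lemma barrier {p ε A : ℝ} (hp : 1 < p) (hε : 0 < ε) (hA : 0 < A) {u : Euc 2 → ℝ} {x z : Euc 2}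
    (hu : ContDiffAt ℝ 2 u x) (hm : IsLocalMax (fun y => u y + A / 2 * ‖y - z‖ ^ 2) x) :
    Wf ε u x = ε + A ^ 2 * ‖x - z‖ ^ 2 ∧ Lreg p ε u x ≤ - A * Wf ε u x ^ ((p-2)/2) := by
  have hpd : ∀ i, pd i u x = - A * (x - z) i := by
    intro i
    have := (maxcond hu hm (EuclideanSpace.single i 1)).1
    rw [EuclideanSpace.inner_single_right] at this
    simpa [pd] using this
  have hW : Wf ε u x = ε + A ^ 2 * ‖x - z‖ ^ 2 := by
    unfold Wf; rw [hpd, hpd, EuclideanSpace.norm_sq_eq, Fin.sum_univ_two]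
    simp; ring
  refine ⟨hW, ?_⟩
  have hWp := Wf_pos hε u x
  set a := pd 0 u x with ha
  set b := pd 1 u x with hb
  have hWab : Wf ε u x = ε + (a ^ 2 + b ^ 2) := rfl
  have D : ∀ s t : ℝ, s ^ 2 * pd2 0 0 u x + 2 * (s * t * pd2 0 1 u x) + t ^ 2 * pd2 1 1 u x ≤ - A * (s ^ 2 + t ^ 2) := by
    intro s t
    rw [← Dd_expand hu, ← norm_st]
    exact (maxcond hu hm _).2
  have d1 := D 1 0
  have d2 := D 0 1
  have d3 := D a b
  have d4 := D (-b) a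
  have e : Wf ε u x ^ ((p-2)/2) = Wf ε u x * Wf ε u x ^ ((p-2)/2 - 1) := by
    rw [Real.rpow_sub_one hWp.ne']; field_simp
  unfold Lreg
  rw [← ha, ← hb, e]
  have hP : 0 < Wf ε u x ^ ((p-2)/2 - 1) := Real.rpow_pos_of_pos hWp _
  generalize Wf ε u x ^ ((p-2)/2 - 1) = P at *
  rw [hWab]
  have key : (ε + (a ^ 2 + b ^ 2)) * (pd2 0 0 u x + pd2 1 1 u x) + (p - 2) * (a ^ 2 * pd2 0 0 u x +
      2 * (a * b * pd2 0 1 u x) + b ^ 2 * pd2 1 1 u x) ≤ - A * (ε + (a ^ 2 + b ^ 2)) := by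
    have k1 := mul_le_mul_of_nonneg_left (add_le_add d1 d2) hε.le
    have k2 := mul_le_mul_of_nonneg_left d3 (by linarith : 0 ≤ p - 1)
    have k3 : 0 ≤ (p - 1) * (A * (a ^ 2 + b ^ 2)) := mul_nonneg (by linarith) (by positivity)
    have k4 : 0 < ε * A := by positivity
    nlinarith
  have := mul_le_mul_of_nonneg_left key hP.le
  linarith

lemma sup_bound {p R Mf Mu : ℝ} (hp : 1 < p) (hR : 0 < R) (x₀ : Euc 2) :
    ∃ M : ℝ, ∀ ε ∈ Ioo (0:ℝ) 1, ∀ u : Euc 2 → ℝ, (∀ x ∈ ball x₀ (2*R), ContDiffAt ℝ 2 u x) →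
      ContinuousOn u (closedBall x₀ (2*R)) → (∀ x ∈ ball x₀ (2*R), -Mf ≤ Lreg p ε u x) →
      (∀ x ∈ sphere x₀ (2*R), u x ≤ Mu) → ∀ x ∈ closedBall x₀ (2*R), u x ≤ M := by
  set κ : ℝ := min 1 ((26:ℝ) ^ ((p-2)/2)) * (R ^ 2) ^ ((p-2)/2) with hκ
  have hκ0 : 0 < κ := by positivity
  obtain ⟨A, hA1, hA2⟩ : ∃ A : ℝ, 1 / R ≤ A ∧ Mf / κ < A ^ (p - 1) :=
    ((Filter.eventually_ge_atTop _).and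
      ((tendsto_rpow_atTop (by linarith : 0 < p - 1)).eventually_gt_atTop _)).exists
  have hA0 : 0 < A := lt_of_lt_of_le (by positivity) hA1
  have hAR : 1 ≤ A * R := by rwa [div_le_iff₀ hR] at hA1
  set z : Euc 2 := x₀ + (3 * R) • EuclideanSpace.single 0 1 with hz
  have nz : ‖z - x₀‖ = 3 * R := by
    rw [hz, add_sub_cancel_left, norm_smul]; simp [abs_of_pos hR]
  have hdist : ∀ x ∈ closedBall x₀ (2*R), R ≤ ‖x - z‖ ∧ ‖x - z‖ ≤ 5 * R := by
    intro x hx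
    rw [mem_closedBall, dist_eq_norm] at hx
    have h1 := norm_sub_le (x - x₀) (z - x₀)
    have h2 := norm_sub_norm_le (z - x₀) (x - x₀)
    rw [show x - x₀ - (z - x₀) = x - z by abel] at h1
    rw [show z - x₀ - (x - x₀) = -(x - z) by abel, norm_neg] at h2
    constructor <;> linarith
  refine ⟨Mu + A / 2 * (5 * R) ^ 2, fun ε hε u hu hc hL hs x hx => ?_⟩
  have hc2 : ContinuousOn (fun y => u y + A / 2 * ‖y - z‖ ^ 2) (closedBall x₀ (2*R)) :=
    hc.add (by fun_prop)
  obtain ⟨y, hy, hmax⟩ := (isCompact_closedBall x₀ (2*R)).exists_isMaxOn ⟨x, hx⟩ hc2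
  have h1 : u x + A / 2 * ‖x - z‖ ^ 2 ≤ u y + A / 2 * ‖y - z‖ ^ 2 := hmax hx
  have h2 : 0 ≤ A / 2 * ‖x - z‖ ^ 2 := by positivity
  have h3 : A / 2 * ‖y - z‖ ^ 2 ≤ A / 2 * (5 * R) ^ 2 := by
    have := (hdist y hy).2
    gcongr
  by_cases hyb : y ∈ ball x₀ (2*R)
  · exfalso
    have hloc : IsLocalMax (fun y => u y + A / 2 * ‖y - z‖ ^ 2) y := by
      filter_upwards [isOpen_ball.mem_nhds hyb] with w hw using hmax (ball_subset_closedBall hw)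
    obtain ⟨hW, hLr⟩ := barrier hp hε.1 hA0 (hu y hyb) hloc
    have hl := hL y hyb
    obtain ⟨d1, d2⟩ := hdist y hy
    have hAR2 : 0 < A ^ 2 * R ^ 2 := by positivity
    have w1 : A ^ 2 * R ^ 2 ≤ Wf ε u y := by
      rw [hW]; have : A ^ 2 * R ^ 2 ≤ A ^ 2 * ‖y - z‖ ^ 2 := by gcongr
      linarith [hε.1]
    have w2 : Wf ε u y ≤ 26 * (A ^ 2 * R ^ 2) := by
      rw [hW]
      have : A ^ 2 * ‖y - z‖ ^ 2 ≤ A ^ 2 * (5 * R) ^ 2 := by gcongr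
      nlinarith [hε.2]
    have low : min 1 ((26:ℝ) ^ ((p-2)/2)) * (A ^ 2 * R ^ 2) ^ ((p-2)/2) ≤ Wf ε u y ^ ((p-2)/2) := by
      rcases le_total 0 ((p-2)/2) with hb | hb
      · calc _ ≤ 1 * (A ^ 2 * R ^ 2) ^ ((p-2)/2) := by gcongr; exact min_le_left _ _
          _ ≤ _ := by rw [one_mul]; exact Real.rpow_le_rpow hAR2.le w1 hb
      · calc _ ≤ (26:ℝ) ^ ((p-2)/2) * (A ^ 2 * R ^ 2) ^ ((p-2)/2) := by gcongr; exact min_le_right _ _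
          _ = (26 * (A ^ 2 * R ^ 2)) ^ ((p-2)/2) := by rw [Real.mul_rpow (by norm_num) hAR2.le]
          _ ≤ _ := Real.rpow_le_rpow_of_nonpos (lt_of_lt_of_le hAR2 w1) w2 hb
    have e : A * (A ^ 2 * R ^ 2) ^ ((p-2)/2) = A ^ (p-1) * (R ^ 2) ^ ((p-2)/2) := by
      rw [Real.mul_rpow (by positivity) (by positivity), ← Real.rpow_natCast, ← Real.rpow_mul hA0.le,
        show ((2:ℕ):ℝ) * ((p-2)/2) = (p - 1) - 1 by push_cast; ring, Real.rpow_sub_one hA0.ne']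
      field_simp
    have := mul_le_mul_of_nonneg_left low hA0.le
    have e2 : A * (min 1 ((26:ℝ) ^ ((p-2)/2)) * (A ^ 2 * R ^ 2) ^ ((p-2)/2)) = A ^ (p-1) * κ := by
      rw [hκ]
      calc _ = min 1 ((26:ℝ) ^ ((p-2)/2)) * (A * (A ^ 2 * R ^ 2) ^ ((p-2)/2)) := by ring
        _ = _ := by rw [e]; ring
    rw [e2] at this
    rw [div_lt_iff₀ hκ0] at hA2
    linarith
  · have : y ∈ sphere x₀ (2*R) := by
      rw [mem_sphere]
      rw [mem_closedBall] at hy; rw [mem_ball, not_lt] at hyb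
      exact le_antisymm hy hyb
    linarith [hs y this]

lemma pd_neg (i : Fin 2) (u : Euc 2 → ℝ) : pd i (fun y => - u y) = fun y => - pd i u y := by
  ext y; unfold pd; rw [fderiv_fun_neg]; simp

lemma pd2_neg (i j : Fin 2) (u : Euc 2 → ℝ) (x : Euc 2) : pd2 i j (fun y => - u y) x = - pd2 i j u x := by
  rw [← pd_pd, pd_neg, pd_neg, ← pd_pd]

lemma Lreg_neg (p ε : ℝ) (u : Euc 2 → ℝ) (x : Euc 2) : Lreg p ε (fun y => - u y) x = - Lreg p ε u x := by
  have : Wf ε (fun y => - u y) x = Wf ε u x := by unfold Wf; rw [pd_neg, pd_neg]; ring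
  unfold Lreg; rw [this, pd2_neg, pd2_neg, pd2_neg, pd_neg, pd_neg]; ring

lemma sup_bound_abs {p R Mf Mu : ℝ} (hp : 1 < p) (hR : 0 < R) (x₀ : Euc 2) :
    ∃ M : ℝ, ∀ ε ∈ Ioo (0:ℝ) 1, ∀ u : Euc 2 → ℝ, (∀ x ∈ ball x₀ (2*R), ContDiffAt ℝ 2 u x) →
      ContinuousOn u (closedBall x₀ (2*R)) → (∀ x ∈ ball x₀ (2*R), |Lreg p ε u x| ≤ Mf) →
      (∀ x ∈ sphere x₀ (2*R), |u x| ≤ Mu) → ∀ x ∈ closedBall x₀ (2*R), |u x| ≤ M := by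
  obtain ⟨M, hM⟩ := sup_bound (Mf := Mf) (Mu := Mu) hp hR x₀
  refine ⟨M, fun ε hε u hu hc hL hs x hx => abs_le.2 ⟨?_, ?_⟩⟩
  · have := hM ε hε (fun y => - u y) (fun x hx => (hu x hx).neg) hc.neg
      (fun x hx => by rw [Lreg_neg]; linarith [(abs_le.1 (hL x hx)).2])
      (fun x hx => by linarith [(abs_le.1 (hs x hx)).1]) x hx
    linarith
  · exact hM ε hε u hu hc (fun x hx => (abs_le.1 (hL x hx)).1) (fun x hx => (abs_le.1 (hs x hx)).2) x hx


/-- Data of a globalized regularized solution. -/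
structure Sol (p ε R M : ℝ) (x₀ : Euc 2) (f U : Euc 2 → ℝ) : Prop where
  he0 : 0 < ε
  he1 : ε < 1
  hU : ContDiff ℝ 3 U
  csU : HasCompactSupport U
  hf : ContDiff ℝ 2 f
  eq : ∀ x ∈ ball x₀ (3/2*R), Lreg p ε U x = - f x
  bU : ∀ x ∈ ball x₀ (3/2*R), |U x| ≤ M
  bf : ∀ x, |f x| ≤ M
  bf1 : ∀ i x, |pd i f x| ≤ M
  bf2 : ∀ i j x, |pd2 i j f x| ≤ M
  hM : 1 ≤ M

/-- Cutoff functions. -/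
structure Cut (x₀ : Euc 2) (R Z : ℝ) (ζ : Euc 2 → ℝ) : Prop where
  sm : ContDiff ℝ 3 ζ
  cs : HasCompactSupport ζ
  ts : tsupport ζ ⊆ ball x₀ (3/2*R)
  n0 : ∀ x, 0 ≤ ζ x
  n1 : ∀ x, ζ x ≤ 1
  one : ∀ x ∈ ball x₀ R, ζ x = 1
  d1 : ∀ i x, |pd i ζ x| ≤ Z
  d2 : ∀ i j x, |pd2 i j ζ x| ≤ Z
  hZ : 1 ≤ Z

lemma ccs_bdd {g : Euc 2 → ℝ} (hg : CCs g) : ∃ C, ∀ x, |g x| ≤ C := by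
  obtain ⟨C, hC⟩ := hg.2.exists_bound_of_continuous hg.1
  exact ⟨C, hC⟩

lemma exists_cut (x₀ : Euc 2) {R : ℝ} (hR : 0 < R) : ∃ Z ζ, Cut x₀ R Z ζ := by
  let b : ContDiffBump x₀ := ⟨R, 5/4*R, hR, by linarith⟩
  have sm : ContDiff ℝ 3 b := b.contDiff
  have cs : HasCompactSupport b := b.hasCompactSupport
  have c1 (i) := ccs_bdd (pd_ccs i (sm.of_le (by norm_num)) cs)
  have c2 (i j) := ccs_bdd (pd_ccs j (pd_contDiff (m := 3) (n := 1) i sm (by norm_num)) (pd_cs i cs))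
  choose C1 hC1 using c1
  choose C2 hC2 using c2
  refine ⟨1 + ∑ i, |C1 i| + ∑ i, ∑ j, |C2 i j|, b, sm, cs, ?_, fun x => b.nonneg, fun x => b.le_one, ?_, ?_, ?_, ?_⟩
  · rw [b.tsupport_eq]; exact closedBall_subset_ball (by change 5/4*R < _; linarith)
  · intro x hx; exact b.one_of_mem_closedBall (ball_subset_closedBall hx)
  · intro i x
    have h1 := Finset.single_le_sum (f := fun i => |C1 i|) (fun i _ => abs_nonneg _) (Finset.mem_univ i)
    have h2 : 0 ≤ ∑ i, ∑ j, |C2 i j| := Finset.sum_nonneg fun i _ => Finset.sum_nonneg fun j _ => abs_nonneg _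
    have := hC1 i x
    have := le_abs_self (C1 i)
    linarith
  · intro i j x
    have h1 := Finset.single_le_sum (f := fun j => |C2 i j|) (fun i _ => abs_nonneg _) (Finset.mem_univ j)
    have h3 := Finset.single_le_sum (f := fun i => ∑ j, |C2 i j|)
      (fun i _ => Finset.sum_nonneg fun j _ => abs_nonneg _) (Finset.mem_univ i)
    have h2 : 0 ≤ ∑ i, |C1 i| := Finset.sum_nonneg fun i _ => abs_nonneg _
    have hc := hC2 i j x
    rw [pd_pd] at hc
    have := le_abs_self (C2 i j)
    linarith
  · have h2 : 0 ≤ ∑ i, |C1 i| := Finset.sum_nonneg fun i _ => abs_nonneg _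
    have h3 : 0 ≤ ∑ i, ∑ j, |C2 i j| := Finset.sum_nonneg fun i _ => Finset.sum_nonneg fun j _ => abs_nonneg _
    linarith

lemma pow_add_le' {a b : ℝ} (n : ℕ) (ha : 0 ≤ a) (hb : 0 ≤ b) : (a + b) ^ n ≤ 2 ^ n * (a ^ n + b ^ n) := by
  rcases le_total a b with h | h
  · calc (a + b) ^ n ≤ (2 * b) ^ n := pow_le_pow_left₀ (by linarith) (by linarith) n
      _ = 2 ^ n * b ^ n := mul_pow _ _ _
      _ ≤ _ := by have := pow_nonneg ha n; gcongr; linarith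
  · calc (a + b) ^ n ≤ (2 * a) ^ n := pow_le_pow_left₀ (by linarith) (by linarith) n
      _ = 2 ^ n * a ^ n := mul_pow _ _ _
      _ ≤ _ := by have := pow_nonneg hb n; gcongr; linarith

/-- S at a point. -/
def Sh (U : Euc 2 → ℝ) (x : Euc 2) : ℝ := |pd2 0 0 U x| + |pd2 0 1 U x| + |pd2 1 0 U x| + |pd2 1 1 U x|

lemma Sh_nonneg (U : Euc 2 → ℝ) (x : Euc 2) : 0 ≤ Sh U x := by unfold Sh; positivity

lemma pd_sq_le_Wf {ε : ℝ} (he : 0 < ε) (U : Euc 2 → ℝ) (i : Fin 2) (x : Euc 2) : pd i U x ^ 2 ≤ Wf ε U x := by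
  unfold Wf
  fin_cases i <;> simp <;> nlinarith [sq_nonneg (pd 0 U x), sq_nonneg (pd 1 U x)]

lemma Lap_bound {p ε R M : ℝ} {x₀ : Euc 2} {f U : Euc 2 → ℝ} (h : Sol p ε R M x₀ f U) {x : Euc 2}
    (hx : x ∈ ball x₀ (3/2*R)) :
    |pd2 0 0 U x + pd2 1 1 U x| ≤ |f x| * Wf ε U x ^ (-((p-2)/2)) + |p - 2| * Sh U x := by
  have e := h.eq x hx
  have hW := Wf_pos h.he0 U x
  unfold Lreg at e
  have h0 := pd_sq_le_Wf h.he0 U 0 x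
  have h1 := pd_sq_le_Wf h.he0 U 1 x
  set W := Wf ε U x with hWd
  rw [Real.rpow_sub_one hW.ne'] at e
  rw [Real.rpow_neg hW.le]
  have hP : 0 < W ^ ((p-2)/2) := Real.rpow_pos_of_pos hW _
  generalize W ^ ((p-2)/2) = P at *
  set a := pd 0 U x
  set b := pd 1 U x
  set Qf := a ^ 2 * pd2 0 0 U x + 2 * (a * b * pd2 0 1 U x) + b ^ 2 * pd2 1 1 U x with hQ
  have e2 : pd2 0 0 U x + pd2 1 1 U x = - (f x * P⁻¹) - (p - 2) * (Qf / W) := by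
    field_simp
    field_simp at e
    linarith
  have hQW : |Qf / W| ≤ Sh U x := by
    rw [abs_div, abs_of_pos hW, div_le_iff₀ hW]
    have s := pd2_symm 0 1 (h.hU.contDiffAt.of_le (by norm_num) : ContDiffAt ℝ 2 U x)
    have hab : |a * b| ≤ W := by
      rw [abs_le]; constructor <;> nlinarith [sq_nonneg (a + b), sq_nonneg (a - b)]
    have q1 : |Qf| ≤ a ^ 2 * |pd2 0 0 U x| + |a * b| * |pd2 0 1 U x| + |a * b| * |pd2 1 0 U x| + b ^ 2 * |pd2 1 1 U x| := by
      rw [← s]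
      have : Qf = a ^ 2 * pd2 0 0 U x + (a * b) * pd2 0 1 U x + (a * b) * pd2 0 1 U x + b ^ 2 * pd2 1 1 U x := by
        rw [hQ]; ring
      rw [this]
      refine (abs_add_le _ _).trans (add_le_add ((abs_add_le _ _).trans (add_le_add ((abs_add_le _ _).trans
        (add_le_add ?_ ?_)) ?_)) ?_)
      all_goals rw [abs_mul]
      all_goals simp
    refine q1.trans ?_
    unfold Sh
    have := mul_le_mul_of_nonneg_right h0 (abs_nonneg (pd2 0 0 U x))
    have := mul_le_mul_of_nonneg_right h1 (abs_nonneg (pd2 1 1 U x))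
    have := mul_le_mul_of_nonneg_right hab (abs_nonneg (pd2 0 1 U x))
    have := mul_le_mul_of_nonneg_right hab (abs_nonneg (pd2 1 0 U x))
    linarith
  rw [e2]
  refine (abs_sub _ _).trans ?_
  rw [abs_neg, abs_mul, abs_mul, abs_of_pos (inv_pos.2 hP)]
  gcongr

lemma pd2_mul (i j : Fin 2) {u v : Euc 2 → ℝ} (hu : ContDiff ℝ 2 u) (hv : ContDiff ℝ 2 v) (x : Euc 2) :
    pd2 i j (fun y => u y * v y) x = pd2 i j u x * v x + pd i u x * pd j v x + pd j u x * pd i v x + u x * pd2 i j v x := by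
  have du := hu.differentiable (by norm_num)
  have dv := hv.differentiable (by norm_num)
  have du1 := (pd_contDiff (m := 2) (n := 1) i hu le_rfl).differentiable (by norm_num)
  have dv1 := (pd_contDiff (m := 2) (n := 1) i hv le_rfl).differentiable (by norm_num)
  have e : pd i (fun y => u y * v y) = fun y => pd i u y * v y + u y * pd i v y := by
    ext y; exact pd_mul i (du y) (dv y)
  rw [← pd_pd, e, pd_add j (by fun_prop) (by fun_prop), pd_mul j (du1 x) (dv x), pd_mul j (du x) (dv1 x), pd_pd, pd_pd]
  ring

/-- integrands -/
def Jp (s : ℕ) (ζ U : Euc 2 → ℝ) (x : Euc 2) : ℝ :=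
  (ζ x ^ 2 * pd2 0 0 U x) ^ s + (ζ x ^ 2 * pd2 0 1 U x) ^ s + (ζ x ^ 2 * pd2 1 0 U x) ^ s + (ζ x ^ 2 * pd2 1 1 U x) ^ s
/-- integrands -/
def Tp (s : ℕ) (ζ U : Euc 2 → ℝ) (x : Euc 2) : ℝ := (ζ x * pd 0 U x) ^ s + (ζ x * pd 1 U x) ^ s
/-- integrands -/
def Fp (s : ℕ) (p ε : ℝ) (ζ f U : Euc 2 → ℝ) (x : Euc 2) : ℝ := (ζ x ^ 2 * f x * Wf ε U x ^ (-((p-2)/2))) ^ s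

lemma Jp_ge {s : ℕ} (hs : Even s) (ζ U : Euc 2 → ℝ) (x : Euc 2) (i j : Fin 2) :
    (ζ x ^ 2 * pd2 i j U x) ^ s ≤ Jp s ζ U x := by
  have a := hs.pow_nonneg (ζ x ^ 2 * pd2 0 0 U x)
  have b := hs.pow_nonneg (ζ x ^ 2 * pd2 0 1 U x)
  have c := hs.pow_nonneg (ζ x ^ 2 * pd2 1 0 U x)
  have d := hs.pow_nonneg (ζ x ^ 2 * pd2 1 1 U x)
  unfold Jp
  fin_cases i <;> fin_cases j <;> simp <;> linarith

lemma Tp_ge {s : ℕ} (hs : Even s) (ζ U : Euc 2 → ℝ) (x : Euc 2) (i : Fin 2) :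
    (ζ x * pd i U x) ^ s ≤ Tp s ζ U x := by
  have a := hs.pow_nonneg (ζ x * pd 0 U x)
  have b := hs.pow_nonneg (ζ x * pd 1 U x)
  unfold Tp
  fin_cases i <;> simp <;> linarith

lemma Jp_nonneg {s : ℕ} (hs : Even s) (ζ U : Euc 2 → ℝ) (x : Euc 2) : 0 ≤ Jp s ζ U x :=
  (hs.pow_nonneg _).trans (Jp_ge hs ζ U x 0 0)
lemma Tp_nonneg {s : ℕ} (hs : Even s) (ζ U : Euc 2 → ℝ) (x : Euc 2) : 0 ≤ Tp s ζ U x :=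
  (hs.pow_nonneg _).trans (Tp_ge hs ζ U x 0)
lemma Fp_nonneg {s : ℕ} (hs : Even s) (p ε : ℝ) (ζ f U : Euc 2 → ℝ) (x : Euc 2) : 0 ≤ Fp s p ε ζ f U x :=
  hs.pow_nonneg _

lemma Sz_pow {s : ℕ} (hs : Even s) (ζ U : Euc 2 → ℝ) (x : Euc 2) :
    (ζ x ^ 2 * Sh U x) ^ s ≤ 4 ^ s * Jp s ζ U x := by
  have e : ζ x ^ 2 * Sh U x = |ζ x ^ 2 * pd2 0 0 U x| + |ζ x ^ 2 * pd2 0 1 U x| +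
      (|ζ x ^ 2 * pd2 1 0 U x| + |ζ x ^ 2 * pd2 1 1 U x|) := by
    unfold Sh; simp only [abs_mul, abs_of_nonneg (sq_nonneg (ζ x))]; ring
  rw [e]
  unfold Jp
  rw [← hs.pow_abs (ζ x ^ 2 * pd2 0 0 U x), ← hs.pow_abs (ζ x ^ 2 * pd2 0 1 U x),
    ← hs.pow_abs (ζ x ^ 2 * pd2 1 0 U x), ← hs.pow_abs (ζ x ^ 2 * pd2 1 1 U x)]
  refine (pow_add_le' s (by positivity) (by positivity)).trans ?_
  have h1 := pow_add_le' s (abs_nonneg (ζ x ^ 2 * pd2 0 0 U x)) (abs_nonneg (ζ x ^ 2 * pd2 0 1 U x))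
  have h2 := pow_add_le' s (abs_nonneg (ζ x ^ 2 * pd2 1 0 U x)) (abs_nonneg (ζ x ^ 2 * pd2 1 1 U x))
  have h3 := mul_le_mul_of_nonneg_left (add_le_add h1 h2) (by positivity : (0:ℝ) ≤ 2 ^ s)
  refine h3.trans (le_of_eq ?_)
  rw [show (4:ℝ) = 2 * 2 by norm_num, mul_pow]; ring

lemma err_bd {p ε R M Z : ℝ} {x₀ : Euc 2} {f U ζ : Euc 2 → ℝ} (h : Sol p ε R M x₀ f U) (c : Cut x₀ R Z ζ) {x : Euc 2}
    (hx : x ∈ ball x₀ (3/2*R)) (i j : Fin 2) :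
    |pd2 i j (fun y => ζ y ^ 2 * U y) x - ζ x ^ 2 * pd2 i j U x| ≤
      2 * Z * (|ζ x * pd 0 U x| + |ζ x * pd 1 U x|) + 2 * Z * (|ζ x * pd 0 U x| + |ζ x * pd 1 U x|) + 4 * Z ^ 2 * M := by
  have sm2 : ContDiff ℝ 2 ζ := c.sm.of_le (by norm_num)
  have e1 : ∀ i, pd i (fun y => ζ y ^ 2) x = 2 * ζ x * pd i ζ x := by
    intro i; rw [pd_pow i 2 (sm2.differentiable (by norm_num) x)]; norm_num
  have e2 : pd2 i j (fun y => ζ y ^ 2) x = 2 * (pd i ζ x * pd j ζ x) + 2 * ζ x * pd2 i j ζ x := by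
    have := pd2_mul i j sm2 sm2 x
    simp only [← pow_two] at this
    rw [this]; ring
  rw [pd2_mul i j (sm2.pow 2) (h.hU.of_le (by norm_num)) x, e1, e1, e2]
  have hm : ∀ i, |ζ x * pd i U x| ≤ |ζ x * pd 0 U x| + |ζ x * pd 1 U x| := by
    intro i; fin_cases i
    · exact le_add_of_nonneg_right (abs_nonneg _)
    · exact le_add_of_nonneg_left (abs_nonneg _)
  have hm1 := hm i
  have hm2 := hm j
  generalize |ζ x * pd 0 U x| + |ζ x * pd 1 U x| = m at *
  have hZ0 : 0 ≤ Z := zero_le_one.trans c.hZ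
  have t1 : |2 * ζ x * pd i ζ x * pd j U x| ≤ 2 * Z * m := by
    rw [show 2 * ζ x * pd i ζ x * pd j U x = 2 * pd i ζ x * (ζ x * pd j U x) by ring, abs_mul, abs_mul, abs_two]
    have := c.d1 i x
    gcongr
  have t2 : |2 * ζ x * pd j ζ x * pd i U x| ≤ 2 * Z * m := by
    rw [show 2 * ζ x * pd j ζ x * pd i U x = 2 * pd j ζ x * (ζ x * pd i U x) by ring, abs_mul, abs_mul, abs_two]
    have := c.d1 j x
    gcongr
  have t3 : |(2 * (pd i ζ x * pd j ζ x) + 2 * ζ x * pd2 i j ζ x) * U x| ≤ 4 * Z ^ 2 * M := by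
    rw [abs_mul]
    have a1 : |2 * (pd i ζ x * pd j ζ x)| ≤ 2 * (Z * Z) := by
      rw [abs_mul, abs_mul, abs_two]
      have := c.d1 i x
      have := c.d1 j x
      gcongr
    have a2 : |2 * ζ x * pd2 i j ζ x| ≤ 2 * 1 * Z := by
      rw [abs_mul, abs_mul, abs_two, abs_of_nonneg (c.n0 x)]
      have := c.d2 i j x
      have := c.n1 x
      gcongr
    have a3 := (abs_add_le (2 * (pd i ζ x * pd j ζ x)) (2 * ζ x * pd2 i j ζ x)).trans (add_le_add a1 a2)
    have a4 : 2 * (Z * Z) + 2 * 1 * Z ≤ 4 * Z ^ 2 := by nlinarith [c.hZ]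
    have := h.bU x hx
    have := a3.trans a4
    gcongr
  rw [abs_le] at *
  constructor <;> linarith [t1.1, t1.2, t2.1, t2.2, t3.1, t3.2]

lemma err_pow {s : ℕ} (hs : Even s) {Z M m0 m1 : ℝ} (hZ : 0 ≤ Z) (hM : 0 ≤ M) :
   (2 * Z * (|m0| + |m1|) + 2 * Z * (|m0| + |m1|) + 4 * Z ^ 2 * M) ^ s ≤
     (2 ^ s * (2 ^ s * (4 * Z) ^ s + (4 * Z ^ 2 * M) ^ s)) * (m0 ^ s + m1 ^ s + 1) := by
  have h1 := pow_add_le' s (abs_nonneg m0) (abs_nonneg m1)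
  rw [hs.pow_abs, hs.pow_abs] at h1
  have e : 2 * Z * (|m0| + |m1|) + 2 * Z * (|m0| + |m1|) = (4 * Z) * (|m0| + |m1|) := by ring
  rw [e]
  refine (pow_add_le' s (by positivity) (by positivity)).trans ?_
  rw [mul_pow (4 * Z) (|m0| + |m1|)]
  have h2 := mul_le_mul_of_nonneg_left h1 (by positivity : (0:ℝ) ≤ (4 * Z) ^ s)
  have a := hs.pow_nonneg m0
  have b := hs.pow_nonneg m1
  rw [mul_assoc ((2:ℝ)^s) (2 ^ s * (4 * Z) ^ s + (4 * Z ^ 2 * M) ^ s)]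
  refine mul_le_mul_of_nonneg_left (a := (2:ℝ) ^ s) ?_ (by positivity)
  have c1 : 0 ≤ (4 * Z ^ 2 * M) ^ s := by positivity
  have c2 : 0 ≤ (2:ℝ) ^ s * (4 * Z) ^ s := by positivity
  nlinarith [mul_nonneg c1 a, mul_nonneg c1 b]


lemma cint {g : Euc 2 → ℝ} (hg : Continuous g) (x₀ : Euc 2) (r : ℝ) : IntegrableOn g (ball x₀ r) :=
  (hg.continuousOn.integrableOn_compact (isCompact_closedBall x₀ r)).mono_set ball_subset_closedBall

lemma int_const_ball (c : ℝ) (x₀ : Euc 2) (r : ℝ) : ∫ _ in ball x₀ r, c = volume.real (ball x₀ r) * c := by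
  simp

lemma int_mono_ball {g h : Euc 2 → ℝ} (hg : Continuous g) (hh : Continuous h) (x₀ : Euc 2) (r : ℝ)
    (H : ∀ x ∈ ball x₀ r, g x ≤ h x) : ∫ x in ball x₀ r, g x ≤ ∫ x in ball x₀ r, h x :=
  setIntegral_mono_on (cint hg x₀ r) (cint hh x₀ r) measurableSet_ball H

lemma int_ball_eq {g : Euc 2 → ℝ} {x₀ : Euc 2} {r : ℝ} (H : tsupport g ⊆ ball x₀ r) :
    ∫ x in ball x₀ r, g x = ∫ x, g x :=
  setIntegral_eq_integral_of_forall_compl_eq_zero fun x hx => by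
    by_contra h
    exact hx (H (subset_tsupport g h))

lemma tsupp_mono {g h : Euc 2 → ℝ} (H : ∀ x, h x = 0 → g x = 0) : tsupport g ⊆ tsupport h :=
  closure_mono fun x hx hh => hx (H x hh)

lemma c_pd {u : Euc 2 → ℝ} (i : Fin 2) (hu : ContDiff ℝ 3 u) : Continuous (pd i u) :=
  (pd_contDiff (m := 3) (n := 0) i hu (by norm_num)).continuous
lemma c_pd2 {u : Euc 2 → ℝ} (i j : Fin 2) (hu : ContDiff ℝ 3 u) : Continuous (pd2 i j u) :=
  (pd_contDiff (m := 1) (n := 0) j (pd_contDiff (m := 3) (n := 1) i hu (by norm_num)) (by norm_num)).continuous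

lemma c_Jp {u ζ : Euc 2 → ℝ} (s : ℕ) (hu : ContDiff ℝ 3 u) (hz : ContDiff ℝ 3 ζ) : Continuous (Jp s ζ u) := by
  have := c_pd2 0 0 hu
  have := c_pd2 0 1 hu
  have := c_pd2 1 0 hu
  have := c_pd2 1 1 hu
  have := hz.continuous
  unfold Jp; fun_prop
lemma c_Tp {u ζ : Euc 2 → ℝ} (s : ℕ) (hu : ContDiff ℝ 3 u) (hz : ContDiff ℝ 3 ζ) : Continuous (Tp s ζ u) := by
  have := c_pd 0 hu
  have := c_pd 1 hu
  have := hz.continuous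
  unfold Tp; fun_prop
lemma c_Fp {u ζ f : Euc 2 → ℝ} {ε : ℝ} (p : ℝ) (s : ℕ) (he : 0 < ε) (hu : ContDiff ℝ 3 u) (hz : ContDiff ℝ 3 ζ) (hf : ContDiff ℝ 2 f) :
    Continuous (Fp s p ε ζ f u) := by
  have := (Wf_rpow_contDiff he (-((p-2)/2)) (m := 3) (n := 0) hu (by norm_num)).continuous
  have := hz.continuous
  have := hf.continuous
  unfold Fp; fun_prop

lemma D1est (j : ℕ) : ∃ A > 0, ∀ Z M : ℝ, ∃ K > 0, ∀ p ε R x₀ f U ζ, Sol p ε R M x₀ f U → Cut x₀ R Z ζ →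
    ∫ x in ball x₀ (3/2*R), Jp (2*j+4) ζ U x ≤ A * ((∫ x in ball x₀ (3/2*R), Fp (2*j+4) p ε ζ f U x) +
      |p - 2| ^ (2*j+4) * ∫ x in ball x₀ (3/2*R), Jp (2*j+4) ζ U x) +
      K * ((∫ x in ball x₀ (3/2*R), Tp (2*j+4) ζ U x) + volume.real (ball x₀ (3/2*R))) := by
  obtain ⟨C, hC, hcz⟩ := cz j
  have hs : Even (2*j+4) := ⟨j+2, by ring⟩
  set s := 2*j+4 with hsd
  refine ⟨4 * (2^s * (C * (2^s * (2^s * 4^s)))), by positivity, fun Z M => ?_⟩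
  set K₀ : ℝ := 2 ^ s * (2 ^ s * (4 * |Z|) ^ s + (4 * |Z| ^ 2 * |M|) ^ s) with hK₀
  have hK₀0 : 0 ≤ K₀ := by positivity
  refine ⟨4 * (2^s * (C * (2^s * (2^s * K₀)) + K₀)) + 1, by positivity, ?_⟩
  intro p ε R x₀ f U ζ h c
  set B := ball x₀ (3/2*R) with hB
  set V := volume.real B with hV
  have hV0 : 0 ≤ V := measureReal_nonneg
  have hZ : |Z| = Z := abs_of_nonneg (zero_le_one.trans c.hZ)
  have hM : |M| = M := abs_of_nonneg (zero_le_one.trans h.hM)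
  rw [hZ, hM] at hK₀
  have cJ := c_Jp s h.hU c.sm
  have cT := c_Tp s h.hU c.sm
  have cF := c_Fp p s h.he0 h.hU c.sm h.hf
  set φ : Euc 2 → ℝ := fun y => ζ y ^ 2 * U y with hφ
  have sφ : ContDiff ℝ 3 φ := (c.sm.pow 2).mul h.hU
  have tφ : tsupport φ ⊆ tsupport ζ := tsupp_mono fun x hx => by simp [hφ, hx]
  have csφ : HasCompactSupport φ := c.cs.mono' ((subset_tsupport _).trans tφ)
  have eb : ∀ x ∈ B, ∀ a b, |pd2 a b φ x - ζ x ^ 2 * pd2 a b U x| ^ s ≤ K₀ * (Tp s ζ U x + 1) := by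
    intro x hx a b
    refine (pow_le_pow_left₀ (abs_nonneg _) (err_bd h c hx a b) s).trans ?_
    rw [hK₀]; unfold Tp; exact err_pow hs (zero_le_one.trans c.hZ) (zero_le_one.trans h.hM)
  set J := ∫ x in B, Jp s ζ U x with hJ
  set T := ∫ x in B, Tp s ζ U x with hT
  set F := ∫ x in B, Fp s p ε ζ f U x with hF
  have cI : ∀ x, Tp s ζ U x + 1 = Tp s ζ U x + (fun _ : Euc 2 => (1:ℝ)) x := fun x => rfl
  have eT1 : ∫ x in B, (Tp s ζ U x + 1) = T + V := by
    rw [integral_add (cint cT x₀ _) (cint continuous_const x₀ _), hT, int_const_ball]; simp [hV, hB]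
  have cφ (a b) := c_pd2 a b sφ
  have cU (a b) := c_pd2 a b h.hU
  have cζ := c.sm.continuous
  -- Laplacian
  have lap : ∫ x in B, (pd2 0 0 φ x + pd2 1 1 φ x) ^ s ≤
      2^s * (2^s * (F + |p-2|^s * (4^s * J)) + 2^s * (K₀ * (T + V))) := by
    have c00 := cφ 0 0
    have c11 := cφ 1 1
    have : ∫ x in B, (pd2 0 0 φ x + pd2 1 1 φ x) ^ s ≤ ∫ x in B,
        2^s * (2^s * (Fp s p ε ζ f U x + |p-2|^s * (4^s * Jp s ζ U x)) + 2^s * (K₀ * (Tp s ζ U x + 1))) := by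
      apply int_mono_ball (by fun_prop) (by fun_prop)
      intro x hx
      have e0 := eb x hx 0 0
      have e1 := eb x hx 1 1
      have L := Lap_bound h hx
      have hz := sq_nonneg (ζ x)
      set E0 := |pd2 0 0 φ x - ζ x ^ 2 * pd2 0 0 U x|
      set E1 := |pd2 1 1 φ x - ζ x ^ 2 * pd2 1 1 U x|
      have hW := Real.rpow_pos_of_pos (Wf_pos h.he0 U x) (-((p-2)/2))
      have k1 : |pd2 0 0 φ x + pd2 1 1 φ x| ≤ (ζ x ^ 2 * (|f x| * Wf ε U x ^ (-((p-2)/2))) + |p - 2| * (ζ x ^ 2 * Sh U x)) + max E0 E1 * 2 := by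
        have : pd2 0 0 φ x + pd2 1 1 φ x = ζ x ^ 2 * (pd2 0 0 U x + pd2 1 1 U x) +
          (pd2 0 0 φ x - ζ x ^ 2 * pd2 0 0 U x) + (pd2 1 1 φ x - ζ x ^ 2 * pd2 1 1 U x) := by ring
        rw [this]
        refine (abs_add_three _ _ _).trans ?_
        rw [abs_mul, abs_of_nonneg hz]
        have := mul_le_mul_of_nonneg_left L hz
        have := le_max_left E0 E1
        have := le_max_right E0 E1
        linarith
      rw [← hs.pow_abs]
      have Sn := Sh_nonneg U x
      refine (pow_le_pow_left₀ (abs_nonneg _) k1 s).trans ((pow_add_le' s (by positivity) (by positivity)).trans ?_)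
      refine mul_le_mul_of_nonneg_left (a := (2:ℝ) ^ s) (add_le_add ((pow_add_le' s (by positivity) (by positivity)).trans ?_) ?_) (by positivity)
      · refine mul_le_mul_of_nonneg_left (a := (2:ℝ) ^ s) (add_le_add (le_of_eq ?_) ?_) (by positivity)
        · unfold Fp; rw [← hs.pow_abs (ζ x ^ 2 * f x * _), abs_mul, abs_mul, abs_of_nonneg hz, abs_of_pos hW]; ring
        · rw [mul_pow]; exact mul_le_mul_of_nonneg_left (Sz_pow hs ζ U x) (by positivity)
      · rw [mul_pow, mul_comm]
        refine mul_le_mul_of_nonneg_left (a := (2:ℝ) ^ s) ?_ (by positivity)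
        rcases max_choice E0 E1 with hh | hh <;> rw [hh]
        exacts [e0, e1]
    refine this.trans (le_of_eq ?_)
    rw [integral_const_mul, integral_add, integral_const_mul, integral_const_mul, integral_const_mul, eT1, integral_add,
      integral_const_mul, integral_const_mul]
    exacts [cint cF _ _, cint (by fun_prop) _ _, cint (by fun_prop) _ _, cint (by fun_prop) _ _]
  have each : ∀ a b, ∫ x in B, (ζ x ^ 2 * pd2 a b U x) ^ s ≤
      2^s * (C * (2^s * (2^s * (F + |p-2|^s * (4^s * J)) + 2^s * (K₀ * (T + V)))) + K₀ * (T + V)) := by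
    intro a b
    have cab := cφ a b
    have cabU := cU a b
    have s1 : ∫ x in B, (ζ x ^ 2 * pd2 a b U x) ^ s ≤ ∫ x in B, 2^s * (pd2 a b φ x ^ s + K₀ * (Tp s ζ U x + 1)) := by
      apply int_mono_ball (by fun_prop) (by fun_prop)
      intro x hx
      have : |ζ x ^ 2 * pd2 a b U x| ≤ |pd2 a b φ x| + |pd2 a b φ x - ζ x ^ 2 * pd2 a b U x| := by
        have := abs_sub (pd2 a b φ x) (pd2 a b φ x - ζ x ^ 2 * pd2 a b U x)
        simpa using this
      rw [← hs.pow_abs]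
      refine (pow_le_pow_left₀ (abs_nonneg _) this s).trans ((pow_add_le' s (abs_nonneg _) (abs_nonneg _)).trans ?_)
      rw [hs.pow_abs]
      refine mul_le_mul_of_nonneg_left (a := (2:ℝ) ^ s) (add_le_add le_rfl (eb x hx a b)) (by positivity)
    have s2 : ∫ x in B, pd2 a b φ x ^ s ≤ C * ∫ x in B, (pd2 0 0 φ x + pd2 1 1 φ x) ^ s := by
      have tt : ∀ a b x, x ∉ tsupport φ → pd2 a b φ x = 0 := fun a b x hx => by
        by_contra hne
        exact hx (pd_supp a φ (pd_supp b (pd a φ) (subset_tsupport _ hne)))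
      have hsub : tsupport φ ⊆ B := tφ.trans c.ts
      have r1 : ∫ x in B, pd2 a b φ x ^ s = ∫ x, pd2 a b φ x ^ s :=
        setIntegral_eq_integral_of_forall_compl_eq_zero fun x hx => by
          rw [tt a b x (fun h => hx (hsub h))]; simp [hsd]
      have r2 : ∫ x in B, (pd2 0 0 φ x + pd2 1 1 φ x) ^ s = ∫ x, (pd2 0 0 φ x + pd2 1 1 φ x) ^ s :=
        setIntegral_eq_integral_of_forall_compl_eq_zero fun x hx => by
          rw [tt 0 0 x (fun h => hx (hsub h)), tt 1 1 x (fun h => hx (hsub h))]; simp [hsd]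
      rw [r1, r2]
      exact hcz φ (sφ.of_le (by norm_num)) csφ a b
    refine s1.trans ?_
    rw [integral_const_mul, integral_add (cint (by fun_prop) _ _) (cint (by fun_prop) _ _), integral_const_mul, eT1]
    refine mul_le_mul_of_nonneg_left (a := (2:ℝ) ^ s) ?_ (by positivity)
    have := mul_le_mul_of_nonneg_left lap hC.le
    linarith
  have eJ : J = (∫ x in B, (ζ x ^ 2 * pd2 0 0 U x) ^ s) + (∫ x in B, (ζ x ^ 2 * pd2 0 1 U x) ^ s) +
     (∫ x in B, (ζ x ^ 2 * pd2 1 0 U x) ^ s) + ∫ x in B, (ζ x ^ 2 * pd2 1 1 U x) ^ s := by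
    have := cU 0 0
    have := cU 0 1
    have := cU 1 0
    have := cU 1 1
    rw [hJ]; unfold Jp
    rw [integral_add, integral_add, integral_add]
    all_goals exact cint (by fun_prop) _ _
  have nT : 0 ≤ T := setIntegral_nonneg measurableSet_ball fun x _ => Tp_nonneg hs ζ U x
  have nF : 0 ≤ F := setIntegral_nonneg measurableSet_ball fun x _ => Fp_nonneg hs p ε ζ f U x
  have nJ : 0 ≤ J := setIntegral_nonneg measurableSet_ball fun x _ => Jp_nonneg hs ζ U x
  have tot : J ≤ 4 * (2^s * (C * (2^s * (2^s * (F + |p-2|^s * (4^s * J)) + 2^s * (K₀ * (T + V)))) + K₀ * (T + V))) := by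
    linarith [each 0 0, each 0 1, each 1 0, each 1 1]
  have h4 : F + |p-2|^s * (4^s * J) ≤ 4^s * (F + |p-2|^s * J) := by
    have : (1:ℝ) ≤ 4^s := one_le_pow₀ (by norm_num)
    nlinarith
  have h5 := mul_le_mul_of_nonneg_left h4 (by positivity : (0:ℝ) ≤ 4 * (2^s * (C * (2^s * (2^s)))))
  have h6 : 0 ≤ T + V := by positivity
  nlinarith


lemma young_top {K δ m : ℝ} (n : ℕ) (hK : 0 ≤ K) (hδ : 0 < δ) (hm : 0 ≤ m) :
    K * m ^ n ≤ δ * m ^ (n+1) + K * (K/δ) ^ n := by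
  rcases le_total (K/δ) m with h | h
  · have : K ≤ δ * m := by rw [div_le_iff₀ hδ] at h; linarith
    have h2 : 0 ≤ K * (K/δ)^n := by positivity
    have := mul_le_mul_of_nonneg_right this (pow_nonneg hm n)
    rw [pow_succ]; nlinarith
  · have h2 : 0 ≤ δ * m ^ (n+1) := by positivity
    have := mul_le_mul_of_nonneg_left (pow_le_pow_left₀ hm h n) hK
    linarith

lemma mix_pow {m n : ℝ} (s a b : ℕ) (hab : a + b = s) (hm : 0 ≤ m) (hn : 0 ≤ n) : m ^ a * n ^ b ≤ (max m n) ^ s := by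
  rw [← hab, pow_add]
  gcongr
  · exact le_max_left _ _
  · exact le_max_right _ _

lemma max_pow_le {m n : ℝ} (s : ℕ) (hm : 0 ≤ m) (hn : 0 ≤ n) : (max m n) ^ s ≤ m ^ s + n ^ s := by
  have := pow_nonneg hm s
  have := pow_nonneg hn s
  rcases max_choice m n with h | h <;> rw [h] <;> linarith

lemma D2est (j : ℕ) (δ : ℝ) (hδ : 0 < δ) (Z M : ℝ) : ∃ K ≥ 0, ∀ p ε R x₀ f U ζ, Sol p ε R M x₀ f U → Cut x₀ R Z ζ →
    ∫ x in ball x₀ (3/2*R), Tp (2*j+4) ζ U x ≤ δ * ((∫ x in ball x₀ (3/2*R), Tp (2*j+4) ζ U x) +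
      ∫ x in ball x₀ (3/2*R), Jp (2*j+4) ζ U x) + K * volume.real (ball x₀ (3/2*R)) := by
  have hs : Even (2*j+4) := ⟨j+2, by ring⟩
  set s := 2*j+4 with hsd
  set G : ℝ := |M| * s * |Z| with hG
  set d := δ / 4 with hd
  have hd0 : 0 < d := by positivity
  refine ⟨4 * (G * (G/d)^(s-1)), by positivity, ?_⟩
  intro p ε R x₀ f U ζ h c
  set B := ball x₀ (3/2*R) with hB
  set V := volume.real B with hV
  have hM0 : 0 ≤ M := zero_le_one.trans h.hM
  have hZ0 : 0 ≤ Z := zero_le_one.trans c.hZ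
  rw [abs_of_nonneg hM0, abs_of_nonneg hZ0] at hG
  have cJ := c_Jp s h.hU c.sm
  have cT := c_Tp s h.hU c.sm
  have cζ := c.sm.continuous
  have cU := h.hU.continuous
  have key : ∀ i, ∫ x in B, (ζ x * pd i U x)^s ≤ ∫ x in B, (2 * (d * (Tp s ζ U x + Jp s ζ U x)) + 2 * (G * (G/d)^(s-1))) := by
    intro i
    have dU : ContDiff ℝ 1 (pd i U) := pd_contDiff (m := 3) (n := 1) i h.hU (by norm_num)
    have dζ : ContDiff ℝ 1 ζ := c.sm.of_le (by norm_num)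
    have cpi := c_pd i h.hU
    have cpii := c_pd2 i i h.hU
    have cpζ := c_pd i c.sm
    set v : Euc 2 → ℝ := fun y => pd i U y ^ (s-1) * ζ y ^ s with hv
    have dv : ContDiff ℝ 1 v := (dU.pow _).mul (dζ.pow _)
    have tv : tsupport v ⊆ tsupport ζ := tsupp_mono fun x hx => by simp [hv, hx, hsd]
    have csv : HasCompactSupport v := c.cs.mono' ((subset_tsupport _).trans tv)
    have I := ibp i (h.hU.of_le (by norm_num)) dv csv
    have e1 : ∀ x, (ζ x * pd i U x)^s = pd i U x * v x := fun x => by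
      rw [hv, hsd]; simp only [show 2*j+4-1 = 2*j+3 by omega]; ring
    have s1 : ∫ x in B, (ζ x * pd i U x)^s = ∫ x in B, -(U x * pd i v x) := by
      simp only [e1]
      rw [integral_neg, int_ball_eq, int_ball_eq, I, neg_neg]
      · exact (tsupport_mul_subset_right).trans ((pd_supp i v).trans (tv.trans c.ts))
      · exact (tsupport_mul_subset_right).trans (tv.trans c.ts)
    rw [s1]
    have cpv := (pd_contDiff (m := 1) (n := 0) i dv (by norm_num)).continuous
    apply int_mono_ball (by fun_prop) (by fun_prop)
    intro x hx
    have pv : pd i v x = ((s-1:ℕ) * pd i U x ^ (s-1-1)) * pd2 i i U x * ζ x ^ s + pd i U x ^ (s-1) * ((s * ζ x ^ (s-1)) * pd i ζ x) := by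
      have d1 := dU.differentiable (by norm_num) x
      have d2 := dζ.differentiable (by norm_num) x
      rw [hv, pd_mul i (d1.fun_pow _) (d2.fun_pow _)]
      rw [pd_pow i _ d1, pd_pow i _ d2, pd_pd]
    set m := |ζ x * pd i U x| with hm
    set n := |ζ x ^ 2 * pd2 i i U x| with hn
    have hm0 : 0 ≤ m := abs_nonneg _
    have hn0 : 0 ≤ n := abs_nonneg _
    have a1 : |((s-1:ℕ) * pd i U x ^ (s-1-1)) * pd2 i i U x * ζ x ^ s| ≤ s * (max m n)^(s-1) := by
      have : ((s-1:ℕ) * pd i U x ^ (s-1-1)) * pd2 i i U x * ζ x ^ s = (s-1:ℕ) * ((ζ x * pd i U x)^(s-2) * (ζ x ^ 2 * pd2 i i U x)^1) := by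
        rw [hsd]; simp only [show 2*j+4-1-1 = 2*j+2 by omega, show 2*j+4-2 = 2*j+2 by omega]; ring
      rw [this, abs_mul, abs_mul, abs_pow, abs_pow, ← hm, ← hn, Nat.abs_cast]
      have := mix_pow (s-1) (s-2) 1 (by omega) hm0 hn0
      gcongr
      omega
    have a2 : |pd i U x ^ (s-1) * ((s * ζ x ^ (s-1)) * pd i ζ x)| ≤ s * Z * (max m n)^(s-1) := by
      have : pd i U x ^ (s-1) * ((s * ζ x ^ (s-1)) * pd i ζ x) = s * pd i ζ x * (ζ x * pd i U x)^(s-1) := by rw [mul_pow]; ring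
      rw [this, abs_mul, abs_mul, abs_pow, ← hm, Nat.abs_cast]
      have := c.d1 i x
      have := le_max_left m n
      gcongr
    set Y := (max m n)^(s-1) with hY
    have hY0 : 0 ≤ Y := by positivity
    have a3 : -(U x * pd i v x) ≤ 2 * (G * Y) := by
      refine (neg_le_abs _).trans ?_
      rw [abs_mul]
      have b1 : |pd i v x| ≤ 2 * (s * Z * Y) := by
        rw [pv]
        refine (abs_add_le _ _).trans ?_
        have : (s:ℝ) * Y ≤ s * Z * Y := by
          have := mul_le_mul_of_nonneg_left c.hZ (by positivity : (0:ℝ) ≤ s * Y)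
          linarith
        linarith
      calc |U x| * |pd i v x| ≤ M * (2 * (s * Z * Y)) := by have := h.bU x hx; gcongr
        _ = _ := by rw [hG]; ring
    have a4 := young_top (s-1) (by positivity : 0 ≤ G) hd0 (by positivity : 0 ≤ max m n)
    rw [show s - 1 + 1 = s by omega] at a4
    have a5 := max_pow_le s hm0 hn0
    rw [hm, hn, hs.pow_abs, hs.pow_abs, ← hm, ← hn] at a5
    have a6 := Tp_ge hs ζ U x i
    have a7 := Jp_ge hs ζ U x i i
    have a8 := mul_le_mul_of_nonneg_left (a5.trans (add_le_add a6 a7)) hd0.le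
    linarith
  have eT : ∫ x in B, Tp s ζ U x = (∫ x in B, (ζ x * pd 0 U x)^s) + ∫ x in B, (ζ x * pd 1 U x)^s := by
    have := c_pd 0 h.hU
    have := c_pd 1 h.hU
    unfold Tp
    rw [integral_add]
    all_goals exact cint (by fun_prop) _ _
  have eR : ∫ x in B, (2 * (d * (Tp s ζ U x + Jp s ζ U x)) + 2 * (G * (G/d)^(s-1))) =
    2 * (d * ((∫ x in B, Tp s ζ U x) + ∫ x in B, Jp s ζ U x)) + V * (2 * (G * (G/d)^(s-1))) := by
    rw [integral_add, integral_const_mul, integral_const_mul, integral_add, int_const_ball]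
    all_goals exact cint (by fun_prop) _ _
  have k0 := key 0
  have k1 := key 1
  rw [eR] at k0 k1
  have : δ = 4 * d := by rw [hd]; ring
  rw [this]
  linarith


lemma Wpow_le {ε θ : ℝ} (he : 0 < ε) (he1 : ε < 1) (h0 : 0 ≤ θ) (h1 : θ ≤ 1/2) (U : Euc 2 → ℝ) (x : Euc 2) :
    Wf ε U x ^ θ ≤ 2 + |pd 0 U x| + |pd 1 U x| := by
  have hW := Wf_pos he U x
  have a := abs_nonneg (pd 0 U x)
  have b := abs_nonneg (pd 1 U x)
  calc Wf ε U x ^ θ ≤ (1 + Wf ε U x) ^ θ := Real.rpow_le_rpow hW.le (by linarith) h0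
    _ ≤ (1 + Wf ε U x) ^ (1/2:ℝ) := Real.rpow_le_rpow_of_exponent_le (by linarith) h1
    _ = √(1 + Wf ε U x) := (Real.sqrt_eq_rpow _).symm
    _ ≤ _ := by
      apply Real.sqrt_le_iff.2 ⟨by positivity, ?_⟩
      unfold Wf
      rw [← sq_abs (pd 0 U x), ← sq_abs (pd 1 U x)]
      nlinarith [mul_nonneg a b]

lemma UWpow_le {ε θ : ℝ} (he : 0 < ε) (he1 : ε < 1) (h0 : 0 ≤ θ) (h1 : θ ≤ 1/2) (U : Euc 2 → ℝ) (x : Euc 2) (m : Fin 2) :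
    |pd m U x| * Wf ε U x ^ (-θ) ≤ 2 + |pd 0 U x| + |pd 1 U x| := by
  have hW := Wf_pos he U x
  have h2 := pd_sq_le_Wf he U m x
  have h3 : |pd m U x| ≤ Wf ε U x ^ (1/2:ℝ) := by
    rw [← Real.sqrt_eq_rpow]; exact Real.abs_le_sqrt h2
  calc |pd m U x| * Wf ε U x ^ (-θ) ≤ Wf ε U x ^ (1/2:ℝ) * Wf ε U x ^ (-θ) := by gcongr
    _ = Wf ε U x ^ (1/2 - θ) := by rw [← Real.rpow_add hW]; ring_nf
    _ ≤ _ := Wpow_le he he1 (by linarith) (by linarith) U x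

lemma le_one_add_pow {t : ℝ} (s : ℕ) (hs : s ≠ 0) (ht : 0 ≤ t) : t ≤ 1 + t ^ s := by
  rcases le_total t 1 with h | h
  · have := pow_nonneg ht s; linarith
  · have := le_self_pow₀ h hs; linarith

lemma zN_le {s : ℕ} (hs : Even s) (hs0 : s ≠ 0) {ζ U : Euc 2 → ℝ} {x : Euc 2} (h0 : 0 ≤ ζ x) (h1 : ζ x ≤ 1) (n : ℕ) :
    ζ x ^ (n+1) * (2 + |pd 0 U x| + |pd 1 U x|) ≤ 4 + Tp s ζ U x := by
  have a := abs_nonneg (pd 0 U x)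
  have b := abs_nonneg (pd 1 U x)
  have e : ζ x ^ (n+1) ≤ ζ x := by
    have := pow_le_pow_of_le_one h0 h1 (show 1 ≤ n+1 by omega)
    simpa using this
  calc ζ x ^ (n+1) * (2 + |pd 0 U x| + |pd 1 U x|) ≤ ζ x * (2 + |pd 0 U x| + |pd 1 U x|) := by gcongr
    _ ≤ 2 + |ζ x * pd 0 U x| + |ζ x * pd 1 U x| := by
      rw [abs_mul, abs_mul, abs_of_nonneg h0]; nlinarith
    _ ≤ _ := by
      have c1 := le_one_add_pow s hs0 (abs_nonneg (ζ x * pd 0 U x))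
      have c2 := le_one_add_pow s hs0 (abs_nonneg (ζ x * pd 1 U x))
      rw [hs.pow_abs] at c1 c2
      unfold Tp; linarith

lemma hess_quad {ε : ℝ} (he : 0 < ε) {U : Euc 2 → ℝ} (hU : ContDiff ℝ 3 U) (x : Euc 2) :
    |pd 0 U x * pd 0 (Wf ε U) x + pd 1 U x * pd 1 (Wf ε U) x| ≤ 2 * (Wf ε U x * Sh U x) := by
  have h2 : ContDiffAt ℝ 2 U x := hU.contDiffAt.of_le (by norm_num)
  rw [pd_Wf ε 0 h2, pd_Wf ε 1 h2]
  have h0 := pd_sq_le_Wf he U 0 x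
  have h1 := pd_sq_le_Wf he U 1 x
  set a := pd 0 U x
  set b := pd 1 U x
  set W := Wf ε U x
  have hab : |a * b| ≤ W := by
    rw [abs_le]; constructor <;> nlinarith [sq_nonneg (a + b), sq_nonneg (a - b)]
  have t : ∀ c d : ℝ, |c| ≤ W → |c * d| ≤ W * |d| := fun c d h => by rw [abs_mul]; gcongr
  have t1 := t (a^2) (pd2 0 0 U x) (by rwa [abs_of_nonneg (sq_nonneg a)])
  have t2 := t (a*b) (pd2 1 0 U x) hab
  have t3 := t (a*b) (pd2 0 1 U x) hab
  have t4 := t (b^2) (pd2 1 1 U x) (by rwa [abs_of_nonneg (sq_nonneg b)])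
  unfold Sh
  rw [abs_le] at *
  constructor <;> linarith [t1.1, t1.2, t2.1, t2.2, t3.1, t3.2, t4.1, t4.2]

lemma D3est (j : ℕ) (Z M : ℝ) : ∃ K ≥ 0, ∀ (p ε R : ℝ) x₀ f U ζ, 1 < p → ((2*j+3:ℕ):ℝ) * |p-2| ≤ 1 → Sol p ε R M x₀ f U → Cut x₀ R Z ζ →
    ∫ x in ball x₀ (3/2*R), Fp (2*j+4) p ε ζ f U x ≤ K * ((∫ x in ball x₀ (3/2*R), Tp (2*j+4) ζ U x) + 4 * volume.real (ball x₀ (3/2*R))) +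
      ((2*j+4:ℕ):ℝ) * |p-2| * ((∫ x in ball x₀ (3/2*R), Fp (2*j+4) p ε ζ f U x) + 4^(2*j+4) * ∫ x in ball x₀ (3/2*R), Jp (2*j+4) ζ U x) := by
  have hs : Even (2*j+4) := ⟨j+2, by ring⟩
  set s := 2*j+4 with hsd
  set K1 : ℝ := |M|^s * (2^s * (2^s * 2^s)) with hK1
  set K2 : ℝ := 2 * (s * |M|^(s-1)) + 2 * ((2 * s) * (|M|^(s-1) * |Z|)) with hK2
  refine ⟨max K1 K2, le_max_of_le_left (by positivity), ?_⟩
  intro p ε R x₀ f U ζ hp hc h c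
  have hW (x) := Wf_pos h.he0 U x
  have hM0 : 0 ≤ M := zero_le_one.trans h.hM
  have hZ0 : 0 ≤ Z := zero_le_one.trans c.hZ
  rw [abs_of_nonneg hM0] at hK1 hK2
  rw [abs_of_nonneg hZ0] at hK2
  have hK2n : 0 ≤ max K1 K2 := le_max_of_le_left (by rw [hK1]; positivity)
  set B := ball x₀ (3/2*R) with hB
  set V := volume.real B with hV
  have cJ := c_Jp s h.hU c.sm
  have cT := c_Tp s h.hU c.sm
  have cF := c_Fp p s h.he0 h.hU c.sm h.hf
  have nT (x) := Tp_nonneg hs ζ U x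
  have nJ (x) := Jp_nonneg hs ζ U x
  have nF (x) := Fp_nonneg hs p ε ζ f U x
  -- it suffices to have a pointwise bound for a representative
  suffices H : ∃ g : Euc 2 → ℝ, Continuous g ∧ ∫ x in B, Fp s p ε ζ f U x = ∫ x in B, g x ∧
      ∀ x ∈ B, g x ≤ max K1 K2 * (Tp s ζ U x + 4) + s * |p-2| * (Fp s p ε ζ f U x + 4^s * Jp s ζ U x) by
    obtain ⟨g, cg, eg, hg⟩ := H
    have e : ∫ x in B, (max K1 K2 * (Tp s ζ U x + 4) + s * |p-2| * (Fp s p ε ζ f U x + 4^s * Jp s ζ U x)) =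
      max K1 K2 * ((∫ x in B, Tp s ζ U x) + 4 * V) +
      s * |p-2| * ((∫ x in B, Fp s p ε ζ f U x) + 4^s * ∫ x in B, Jp s ζ U x) := by
      rw [integral_add, integral_const_mul, integral_const_mul, integral_add, integral_add, int_const_ball, integral_const_mul]
      · ring
      all_goals exact cint (by fun_prop) _ _
    rw [← e]
    calc _ = _ := eg
      _ ≤ _ := int_mono_ball cg (by fun_prop) _ _ hg
  rcases le_total p 2 with hp2 | hp2
  · refine ⟨_, cF, rfl, fun x hx => ?_⟩
    have n1 : 0 ≤ s * |p-2| * (Fp s p ε ζ f U x + 4^s * Jp s ζ U x) := by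
      have := nF x
      have := nJ x
      positivity
    have n2 : Fp s p ε ζ f U x ≤ K1 * (Tp s ζ U x + 4) := by
      unfold Fp
      rw [← hs.pow_abs]
      have g0 := Real.rpow_pos_of_pos (hW x) (-((p-2)/2))
      have b1 : |ζ x ^ 2 * f x * Wf ε U x ^ (-((p-2)/2))| ≤ M * (2 + (|ζ x * pd 0 U x| + |ζ x * pd 1 U x|)) := by
        rw [abs_mul, abs_mul, abs_of_pos g0, abs_of_nonneg (sq_nonneg (ζ x))]
        have w := Wpow_le h.he0 h.he1 (θ := -((p-2)/2)) (by linarith) (by linarith) U x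
        have z0 := c.n0 x
        have z1 := c.n1 x
        have a0 := abs_nonneg (pd 0 U x)
        have a1 := abs_nonneg (pd 1 U x)
        have : ζ x ^ 2 ≤ ζ x := by nlinarith
        calc ζ x ^ 2 * |f x| * Wf ε U x ^ (-((p-2)/2)) ≤ ζ x * M * (2 + |pd 0 U x| + |pd 1 U x|) := by
              have := h.bf x
              gcongr
          _ ≤ _ := by
            rw [abs_mul, abs_mul, abs_of_nonneg z0]
            nlinarith [mul_le_mul_of_nonneg_left z1 hM0]
      refine (pow_le_pow_left₀ (abs_nonneg _) b1 s).trans ?_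
      rw [mul_pow, hK1, mul_assoc]
      refine mul_le_mul_of_nonneg_left (a := M ^ s) ?_ (by positivity)
      refine (pow_add_le' s (by positivity) (by positivity)).trans ?_
      rw [mul_assoc]
      refine mul_le_mul_of_nonneg_left (a := (2:ℝ) ^ s) ?_ (by positivity)
      have := pow_add_le' s (abs_nonneg (ζ x * pd 0 U x)) (abs_nonneg (ζ x * pd 1 U x))
      rw [hs.pow_abs, hs.pow_abs] at this
      have o : (1:ℝ) ≤ 2^s := one_le_pow₀ (by norm_num)
      have nn := nT x
      change _ ≤ 2^s * Tp s ζ U x at this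
      nlinarith [mul_nonneg (sub_nonneg.2 o) nn, mul_nonneg (sub_nonneg.2 o) (mul_nonneg (zero_le_one.trans o) nn), mul_nonneg (sub_nonneg.2 o) (zero_le_one.trans o)]
    have := mul_le_mul_of_nonneg_right (le_max_left K1 K2) (by linarith [nT x] : 0 ≤ Tp s ζ U x + 4)
    linarith
  · set β := (p-2)/2 with hβ
    have hβ0 : 0 ≤ β := by rw [hβ]; linarith
    rw [abs_of_nonneg (by linarith : 0 ≤ p - 2)] at hc ⊢
    set g : Euc 2 → ℝ := fun x => Wf ε U x ^ (-β) with hg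
    have gpos (x) : 0 < g x := Real.rpow_pos_of_pos (hW x) _
    have sg : ContDiff ℝ 1 g := Wf_rpow_contDiff h.he0 (-β) (m := 3) (n := 1) h.hU (by norm_num)
    have sf : ContDiff ℝ 1 f := h.hf.of_le (by norm_num)
    have sζ : ContDiff ℝ 1 ζ := c.sm.of_le (by norm_num)
    set ξ : Euc 2 → ℝ := fun y => (f y ^ (s-1) * g y ^ s) * ζ y ^ (2*s) with hξ
    have sξ : ContDiff ℝ 1 ξ := ((sf.pow _).mul (sg.pow _)).mul (sζ.pow _)
    have tξ : tsupport ξ ⊆ tsupport ζ := tsupp_mono fun x hx => by simp [hξ, hx, hsd]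
    have csξ : HasCompactSupport ξ := c.cs.mono' ((subset_tsupport _).trans tξ)
    have tB := tξ.trans c.ts
    set X : Fin 2 → Euc 2 → ℝ := fun m y => Wf ε U y ^ β * pd m U y with hX
    have sX (m) : ContDiff ℝ 1 (X m) := (Wf_rpow_contDiff h.he0 β (m := 3) (n := 1) h.hU (by norm_num)).mul
      (pd_contDiff (m := 3) (n := 1) m h.hU (by norm_num))
    have cX (m) := (sX m).continuous
    have cpξ (m) := (pd_contDiff (m := 1) (n := 0) m sξ (by norm_num)).continuous
    have cpX (m) := (pd_contDiff (m := 1) (n := 0) m (sX m) (by norm_num)).continuous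
    have cξ := sξ.continuous
    have c0 := cX 0
    have c1 := cX 1
    have d0 := cpξ 0
    have d1 := cpξ 1
    have e0 := cpX 0
    have e1 := cpX 1
    refine ⟨fun x => X 0 x * pd 0 ξ x + X 1 x * pd 1 ξ x, by fun_prop, ?_, ?_⟩
    · have I0 := ibp 0 (sX 0) sξ csξ
      have I1 := ibp 1 (sX 1) sξ csξ
      have t0 : ∀ m, ∫ x in B, X m x * pd m ξ x = - ∫ x in B, pd m (X m) x * ξ x := by
        intro m
        rw [int_ball_eq, int_ball_eq, ibp m (sX m) sξ csξ]
        · exact (tsupport_mul_subset_right).trans tB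
        · exact (tsupport_mul_subset_right).trans ((pd_supp m ξ).trans tB)
      rw [integral_add (cint (by fun_prop) _ _) (cint (by fun_prop) _ _), t0, t0, ← neg_add,
        ← integral_add (cint (by fun_prop) _ _) (cint (by fun_prop) _ _), ← integral_neg]
      apply setIntegral_congr_fun measurableSet_ball
      intro x hx
      have L := Lreg_div (p := p) h.he0 (h.hU.contDiffAt.of_le (by norm_num) : ContDiffAt ℝ 2 U x)
      rw [Fin.sum_univ_two, h.eq x hx] at L
      change pd 0 (X 0) x + pd 1 (X 1) x = _ at L
      have : pd 0 (X 0) x * ξ x + pd 1 (X 1) x * ξ x = - f x * ξ x := by rw [← L]; ring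
      simp only [this]
      change (ζ x ^ 2 * f x * g x) ^ s = _
      rw [hξ, hsd]; simp only [show 2*j+4-1 = 2*j+3 by omega]; ring
    · intro x hx
      have hxW := hW x
      have dg := sg.differentiable (by norm_num) x
      have df := sf.differentiable (by norm_num) x
      have dζ := sζ.differentiable (by norm_num) x
      have h2 : ContDiffAt ℝ 2 U x := h.hU.contDiffAt.of_le (by norm_num)
      have pg : ∀ m, pd m g x = -β * (g x / Wf ε U x) * pd m (Wf ε U) x := by
        intro m
        rw [hg, pd_rpow m (-β) (Wf_diffAt ε h2) hxW, Real.rpow_sub_one hxW.ne']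
      have pξ : ∀ m, X m x * pd m ξ x = pd m U x * (((s-1:ℕ) * f x ^ (s-1-1) * pd m f x) * g x ^ (s-1) * ζ x ^ (2*s) -
          (s * β) * f x ^ (s-1) * g x ^ (s-1) * (pd m (Wf ε U) x / Wf ε U x) * ζ x ^ (2*s) +
          f x ^ (s-1) * g x ^ (s-1) * ((2*s:ℕ) * ζ x ^ (2*s-1) * pd m ζ x)) := by
        intro m
        have a1 : pd m ξ x = (((s-1:ℕ) * f x ^ (s-1-1) * pd m f x) * g x ^ s + f x ^ (s-1) * ((s * g x ^ (s-1)) *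
          (-β * (g x / Wf ε U x) * pd m (Wf ε U) x))) * ζ x ^ (2*s) + (f x ^ (s-1) * g x ^ s) * ((2*s:ℕ) * ζ x ^ (2*s-1) * pd m ζ x) := by
          rw [hξ, pd_mul m ((df.fun_pow _).fun_mul (dg.fun_pow _)) (dζ.fun_pow _), pd_mul m (df.fun_pow _) (dg.fun_pow _),
            pd_pow m _ df, pd_pow m _ dg, pd_pow m _ dζ, pg]
        have a2 : X m x = (g x)⁻¹ * pd m U x := by
          simp only [hX, hg]; rw [Real.rpow_neg hxW.le, inv_inv]
        have a3 : g x ^ s = g x ^ (s-1) * g x := by rw [← pow_succ]; congr 1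
        rw [a1, a2, a3]
        have := (gpos x).ne'
        field_simp
        ring
      have Gx : g x ^ (s-1) = Wf ε U x ^ (-((s-1:ℕ) * β)) := by
        simp only [hg]; rw [← Real.rpow_natCast, ← Real.rpow_mul hxW.le]; ring_nf
      have hsβ : ((s-1:ℕ):ℝ) * β ≤ 1/2 := by
        rw [hβ]; rw [show 2*j+3 = s - 1 by omega] at hc; linarith
      have UG : ∀ m, |pd m U x| * g x ^ (s-1) ≤ 2 + |pd 0 U x| + |pd 1 U x| := by
        intro m; rw [Gx]; exact UWpow_le h.he0 h.he1 (by positivity) hsβ U x m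
      have z0 := c.n0 x
      have z1 := c.n1 x
      have zN1 := zN_le hs (by omega) (U := U) z0 z1 (2*s-1)
      have zN2 := zN_le hs (by omega) (U := U) z0 z1 (2*s-2)
      rw [show 2*s-1+1 = 2*s by omega] at zN1
      rw [show 2*s-2+1 = 2*s-1 by omega] at zN2
      set N := 2 + |pd 0 U x| + |pd 1 U x| with hN
      have N0 : 0 ≤ N := by positivity
      have gp := gpos x
      set G := g x ^ (s-1) with hG
      have G0 : 0 < G := by positivity
      have fb := h.bf x
      have q1 : ∀ m, pd m U x * (((s-1:ℕ) * f x ^ (s-1-1) * pd m f x) * G * ζ x ^ (2*s)) ≤ s * M^(s-1) * (Tp s ζ U x + 4) := by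
        intro m
        refine (le_abs_self _).trans ?_
        simp only [abs_mul, abs_pow, Nat.abs_cast, abs_of_pos G0, abs_of_nonneg z0]
        calc |pd m U x| * ((s-1:ℕ) * |f x| ^ (s-1-1) * |pd m f x| * G * ζ x ^ (2*s)) =
            (s-1:ℕ) * (|f x| ^ (s-1-1) * |pd m f x|) * (ζ x ^ (2*s) * (|pd m U x| * G)) := by ring
          _ ≤ s * (M ^ (s-1-1) * M) * (ζ x ^ (2*s) * N) := by
            have := h.bf1 m x
            have := UG m
            gcongr
            omega
          _ ≤ s * (M ^ (s-1-1) * M) * (4 + Tp s ζ U x) := by gcongr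
          _ = _ := by rw [← pow_succ, show s-1-1+1 = s-1 by omega]; ring
      have q3 : ∀ m, pd m U x * (f x ^ (s-1) * G * ((2*s:ℕ) * ζ x ^ (2*s-1) * pd m ζ x)) ≤ (2*s) * (M^(s-1) * Z) * (Tp s ζ U x + 4) := by
        intro m
        refine (le_abs_self _).trans ?_
        simp only [abs_mul, abs_pow, Nat.abs_cast, abs_of_pos G0, abs_of_nonneg z0]
        calc |pd m U x| * (|f x| ^ (s-1) * G * ((2*s:ℕ) * ζ x ^ (2*s-1) * |pd m ζ x|)) =
            (2*s:ℕ) * (|f x| ^ (s-1) * |pd m ζ x|) * (ζ x ^ (2*s-1) * (|pd m U x| * G)) := by ring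
          _ ≤ (2*s:ℕ) * (M ^ (s-1) * Z) * (ζ x ^ (2*s-1) * N) := by
            have := c.d1 m x
            have := UG m
            gcongr
          _ ≤ (2*s:ℕ) * (M ^ (s-1) * Z) * (4 + Tp s ζ U x) := by gcongr
          _ = _ := by push_cast; ring
      have q2 : -((s * β) * f x ^ (s-1) * G * ((pd 0 U x * pd 0 (Wf ε U) x + pd 1 U x * pd 1 (Wf ε U) x) / Wf ε U x) * ζ x ^ (2*s)) ≤
          s * (p-2) * (Fp s p ε ζ f U x + 4^s * Jp s ζ U x) := by
        refine (neg_le_abs _).trans ?_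
        have hq := hess_quad h.he0 h.hU x
        have hq' : |(pd 0 U x * pd 0 (Wf ε U) x + pd 1 U x * pd 1 (Wf ε U) x) / Wf ε U x| ≤ 2 * Sh U x := by
          rw [abs_div, abs_of_pos hxW, div_le_iff₀ hxW]; linarith
        have Sn := Sh_nonneg U x
        simp only [abs_mul, abs_pow, Nat.abs_cast, abs_of_pos G0, abs_of_nonneg z0, abs_of_nonneg hβ0]
        calc s * β * |f x| ^ (s-1) * G * |(pd 0 U x * pd 0 (Wf ε U) x + pd 1 U x * pd 1 (Wf ε U) x) / Wf ε U x| * ζ x ^ (2*s)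
            ≤ s * β * |f x| ^ (s-1) * G * (2 * Sh U x) * ζ x ^ (2*s) := by gcongr
          _ = s * (p-2) * (|ζ x ^ 2 * f x * g x| ^ (s-1) * (ζ x ^ 2 * Sh U x) ^ 1) := by
            rw [abs_mul, abs_mul, abs_of_pos gp, abs_of_nonneg (sq_nonneg (ζ x)), hG, hβ, hsd]
            simp only [show 2*j+4-1 = 2*j+3 by omega]; ring
          _ ≤ s * (p-2) * (Fp s p ε ζ f U x + 4^s * Jp s ζ U x) := by
            have p0 : 0 ≤ p - 2 := by linarith
            have n0 : 0 ≤ ζ x ^ 2 * Sh U x := by positivity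
            refine mul_le_mul_of_nonneg_left ?_ (by positivity)
            refine (mix_pow s (s-1) 1 (by omega) (abs_nonneg _) n0).trans ((max_pow_le s (abs_nonneg _) n0).trans ?_)
            rw [hs.pow_abs]
            exact add_le_add le_rfl (Sz_pow hs ζ U x)
      have fin : X 0 x * pd 0 ξ x + X 1 x * pd 1 ξ x ≤ K2 * (Tp s ζ U x + 4) + s * (p-2) * (Fp s p ε ζ f U x + 4^s * Jp s ζ U x) := by
        rw [pξ 0, pξ 1, hK2]
        have := q1 0
        have := q1 1
        have := q3 0
        have := q3 1
        have e : (s * β) * f x ^ (s-1) * G * ((pd 0 U x * pd 0 (Wf ε U) x + pd 1 U x * pd 1 (Wf ε U) x) / Wf ε U x) * ζ x ^ (2*s)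
          = pd 0 U x * ((s * β) * f x ^ (s-1) * G * (pd 0 (Wf ε U) x / Wf ε U x) * ζ x ^ (2*s)) +
           pd 1 U x * ((s * β) * f x ^ (s-1) * G * (pd 1 (Wf ε U) x / Wf ε U x) * ζ x ^ (2*s)) := by ring
        rw [e] at q2
        linarith
      have := mul_le_mul_of_nonneg_right (le_max_right K1 K2) (by linarith [nT x] : 0 ≤ Tp s ζ U x + 4)
      linarith


/-- Majorant. -/
def Th (U : Euc 2 → ℝ) (x : Euc 2) : ℝ := 2 + |pd 0 U x| + |pd 1 U x| + Sh U x

lemma c_Th {U : Euc 2 → ℝ} (hU : ContDiff ℝ 3 U) : Continuous (Th U) := by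
  have := c_pd 0 hU
  have := c_pd 1 hU
  have := c_pd2 0 0 hU
  have := c_pd2 0 1 hU
  have := c_pd2 1 0 hU
  have := c_pd2 1 1 hU
  unfold Th Sh; fun_prop

lemma Dfinal (j : ℕ) : ∃ c > 0, ∀ (R M : ℝ) (x₀ : Euc 2), 0 < R → ∃ C, ∀ p ε f U, 1 < p → |p - 2| < c →
    Sol p ε R M x₀ f U → ∫ x in ball x₀ R, Th U x ^ (2*j+4) ≤ C := by
  obtain ⟨A, hA, H1⟩ := D1est j
  have hs : Even (2*j+4) := ⟨j+2, by ring⟩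
  set s := 2*j+4 with hsd
  have s0 : (1:ℝ) ≤ s := by exact_mod_cast (by omega : 1 ≤ s)
  set Q : ℝ := A * (2 * s * 4^s + 1) with hQ
  have hQ0 : 0 < Q := by positivity
  refine ⟨min (1/(2*s)) (min (1/(2*Q)) 1), by positivity, ?_⟩
  intro R M x₀ hR
  obtain ⟨Z, ζ, c⟩ := exists_cut x₀ hR
  obtain ⟨K1, hK1, H1⟩ := H1 Z M
  obtain ⟨K3, hK3, H3⟩ := D3est j Z M
  set L := 2 * (2 * A * K3 + K1) with hL
  have hL0 : 0 ≤ L := by positivity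
  obtain ⟨K2, hK2, H2⟩ := D2est j (1/(2*(1+L))) (by positivity) Z M
  set B := ball x₀ (3/2*R) with hB
  set V := volume.real B with hV
  have hV0 : 0 ≤ V := measureReal_nonneg
  set C1 := 2 * (8 * A * K3 + K1) with hC1
  set CT := 2 * (1/(2*(1+L)) * (C1 * V) + K2 * V) with hCT
  set CJ := L * CT + C1 * V with hCJ
  refine ⟨2^s * (2^s * (2^s * V + 2^s * CT) + 4^s * CJ), ?_⟩
  intro p ε f U hp hpc h
  have H1 := H1 p ε R x₀ f U ζ h c
  have d1 : |p-2| ≤ 1/(2*s) := hpc.le.trans (min_le_left _ _)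
  have d2 : |p-2| ≤ 1/(2*Q) := hpc.le.trans ((min_le_right _ _).trans (min_le_left _ _))
  have d3 : |p-2| ≤ 1 := hpc.le.trans ((min_le_right _ _).trans (min_le_right _ _))
  set d := |p-2| with hd
  have d0 : 0 ≤ d := abs_nonneg _
  have e1 : s * d ≤ 1/2 := by
    rw [le_div_iff₀ (by positivity)] at d1; linarith
  have e2 : Q * d ≤ 1/2 := by
    rw [le_div_iff₀ (by positivity)] at d2; linarith
  have H3 := H3 p ε R x₀ f U ζ hp (by
    have : ((2*j+3:ℕ):ℝ) ≤ s := by exact_mod_cast (by omega)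
    have := mul_le_mul_of_nonneg_right this d0
    linarith) h c
  have H2 := H2 p ε R x₀ f U ζ h c
  simp only [← hsd, ← hB, ← hV] at H1 H2 H3
  have nT : 0 ≤ ∫ x in B, Tp s ζ U x := setIntegral_nonneg measurableSet_ball fun x _ => Tp_nonneg hs ζ U x
  have nF : 0 ≤ ∫ x in B, Fp s p ε ζ f U x := setIntegral_nonneg measurableSet_ball fun x _ => Fp_nonneg hs p ε ζ f U x
  have nJ : 0 ≤ ∫ x in B, Jp s ζ U x := setIntegral_nonneg measurableSet_ball fun x _ => Jp_nonneg hs ζ U x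
  have hJT : (∫ x in B, Tp s ζ U x) ≤ CT ∧ (∫ x in B, Jp s ζ U x) ≤ CJ := by
    generalize (∫ x in B, Tp s ζ U x) = T at *
    generalize (∫ x in B, Jp s ζ U x) = J at *
    generalize (∫ x in B, Fp s p ε ζ f U x) = F at *
    have hF : F ≤ 2 * K3 * (T + 4*V) + 2 * (s * d) * (4^s * J) := by
      have := mul_le_mul_of_nonneg_right e1 nF
      linarith
    have ds : d^s ≤ d := by
      have := pow_le_pow_of_le_one d0 d3 (show 1 ≤ s by omega)
      simpa using this
    have hJ : J ≤ L * T + C1 * V := by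
      have a1 : A * (F + d^s * J) ≤ A * (2 * K3 * (T + 4*V)) + Q * d * J := by
        have := mul_le_mul_of_nonneg_right ds nJ
        have := mul_le_mul_of_nonneg_left (add_le_add hF this) hA.le
        rw [hQ]; linarith
      have := mul_le_mul_of_nonneg_right e2 nJ
      rw [hL, hC1]
      linarith
    have hT : T ≤ CT := by
      have b1 : 1/(2*(1+L)) * (T + J) ≤ 1/(2*(1+L)) * ((1+L) * T + C1 * V) := by
        apply mul_le_mul_of_nonneg_left _ (by positivity); linarith
      have b2 : 1/(2*(1+L)) * ((1+L) * T + C1 * V) = T/2 + 1/(2*(1+L)) * (C1 * V) := by field_simp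
      rw [hCT]
      linarith
    refine ⟨hT, hJ.trans ?_⟩
    rw [hCJ]
    have := mul_le_mul_of_nonneg_left hT hL0
    linarith
  have cJ := c_Jp s h.hU c.sm
  have cT := c_Tp s h.hU c.sm
  have cth := c_Th h.hU
  set g : Euc 2 → ℝ := fun x => 2^s * (2^s * (2^s * 1 + 2^s * Tp s ζ U x) + 4^s * Jp s ζ U x) with hg
  have cg : Continuous g := by fun_prop
  have p1 : ∫ x in ball x₀ R, Th U x ^ s ≤ ∫ x in ball x₀ R, g x := by
    apply int_mono_ball (by fun_prop) cg
    intro x hx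
    have z := c.one x hx
    have q1 := Sz_pow hs ζ U x
    rw [z] at q1
    simp only [one_pow, one_mul] at q1
    have q2 := pow_add_le' s (abs_nonneg (ζ x * pd 0 U x)) (abs_nonneg (ζ x * pd 1 U x))
    rw [hs.pow_abs, hs.pow_abs] at q2
    change _ ≤ 2^s * Tp s ζ U x at q2
    simp only [z, one_mul] at q2
    have q3 := pow_add_le' s (show (0:ℝ) ≤ 2 by norm_num) (by positivity : 0 ≤ |pd 0 U x| + |pd 1 U x|)
    have q4 := pow_add_le' s (by positivity : 0 ≤ 2 + (|pd 0 U x| + |pd 1 U x|)) (Sh_nonneg U x)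
    unfold Th
    rw [add_assoc 2 |pd 0 U x|]
    refine q4.trans ?_
    simp only [hg]
    refine mul_le_mul_of_nonneg_left (a := (2:ℝ)^s) (add_le_add (q3.trans ?_) q1) (by positivity)
    refine mul_le_mul_of_nonneg_left (a := (2:ℝ)^s) (by linarith) (by positivity)
  have p2 : ∫ x in ball x₀ R, g x ≤ ∫ x in B, g x := by
    apply setIntegral_mono_set (cint cg _ _)
    · refine Filter.Eventually.of_forall fun x => ?_
      have := Tp_nonneg hs ζ U x
      have := Jp_nonneg hs ζ U x
      simp only [hg, Pi.zero_apply]; positivity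
    · exact (ball_subset_ball (by linarith)).eventuallyLE
  have p3 : ∫ x in B, g x = 2^s * (2^s * (2^s * V + 2^s * ∫ x in B, Tp s ζ U x) + 4^s * ∫ x in B, Jp s ζ U x) := by
    simp only [hg]
    rw [integral_const_mul, integral_add, integral_const_mul, integral_add, int_const_ball, integral_const_mul, integral_const_mul]
    · simp only [← hB, ← hV]; ring
    all_goals exact cint (by fun_prop) _ _
  refine p1.trans (p2.trans (p3.le.trans ?_))
  have := hJT.1
  have := hJT.2
  gcongr


lemma trans_deriv (j : Fin 2) {Y χ : Euc 2 → ℝ} (hY : ContDiff ℝ 1 Y) (hYc : HasCompactSupport Y) (hχ : CCs χ) :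
    HasDerivAt (fun t : ℝ => ∫ x, Y (x + t • EuclideanSpace.single j 1) * χ x) (∫ x, pd j Y x * χ x) 0 := by
  set e : Euc 2 := EuclideanSpace.single j 1 with he
  obtain ⟨C, hC⟩ := ccs_bdd (pd_ccs j hY hYc)
  have cY := hY.continuous
  have cχ := hχ.1
  have cp := (pd_ccs j hY hYc).1
  have D : ∀ x (t : ℝ), HasDerivAt (fun t : ℝ => Y (x + t • e) * χ x) (pd j Y (x + t • e) * χ x) t := by
    intro x t
    have h1 : HasDerivAt (fun t : ℝ => x + t • e) e t := by
      have := ((hasDerivAt_id t).smul_const e).const_add x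
      simpa using this
    exact ((hY.differentiable (by norm_num) _).hasFDerivAt.comp_hasDerivAt t h1).mul_const _
  have key := hasDerivAt_integral_of_dominated_loc_of_deriv_le (𝕜 := ℝ) (μ := (volume : Measure (Euc 2)))
    (F := fun t x => Y (x + t • e) * χ x) (F' := fun t x => pd j Y (x + t • e) * χ x) (x₀ := (0:ℝ)) (s := Set.univ)
    (bound := fun x => C * |χ x|) Filter.univ_mem ?_ ?_ ?_ ?_ ?_ ?_
  · have := key.2
    simpa using this
  · refine Filter.Eventually.of_forall fun t => Continuous.aestronglyMeasurable (by fun_prop)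
  · have := (hχ.mul_cont (h := fun x => Y (x + (0:ℝ) • e)) (by fun_prop)).integrable
    simpa [mul_comm] using this
  · exact Continuous.aestronglyMeasurable (by fun_prop)
  · refine Filter.Eventually.of_forall fun x t _ => ?_
    rw [Real.norm_eq_abs, abs_mul]
    exact mul_le_mul_of_nonneg_right (hC _) (abs_nonneg _)
  · exact hχ.integrable.abs.const_mul C
  · exact Filter.Eventually.of_forall fun x t _ => D x t

lemma pd_shift (m : Fin 2) (Y : Euc 2 → ℝ) (a x : Euc 2) : pd m (fun y => Y (y + a)) x = pd m Y (x + a) := by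
  unfold pd; rw [fderiv_comp_add_right]

lemma curl (j m : Fin 2) {Y ζ : Euc 2 → ℝ} (hY : ContDiff ℝ 1 Y) (hYc : HasCompactSupport Y) (hζ : ContDiff ℝ 1 ζ)
    (hζc : HasCompactSupport ζ) : ∫ x, pd j Y x * pd m ζ x = ∫ x, pd m Y x * pd j ζ x := by
  set e : Euc 2 := EuclideanSpace.single j 1 with he
  have h1 := trans_deriv j hY hYc (pd_ccs m hζ hζc)
  have h2 := trans_deriv j hζ hζc (pd_ccs m hY hYc)
  have h3 : HasDerivAt (fun t : ℝ => -∫ x, ζ (x + (-t) • e) * pd m Y x) (∫ x, pd j ζ x * pd m Y x) 0 := by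
    have := (HasDerivAt.scomp (0:ℝ) (by rw [neg_zero]; exact h2) (hasDerivAt_neg (0:ℝ))).neg
    simp only [smul_eq_mul, neg_mul, one_mul, neg_neg] at this
    exact this
  have eq : (fun t : ℝ => ∫ x, Y (x + t • e) * pd m ζ x) = (fun t : ℝ => -∫ x, ζ (x + (-t) • e) * pd m Y x) := by
    ext t
    have hYt : ContDiff ℝ 1 (fun x => Y (x + t • e)) := hY.comp (by fun_prop)
    rw [ibp m hYt hζ hζc]
    congr 1
    simp only [pd_shift]
    rw [← integral_add_right_eq_self (fun x => ζ (x + (-t) • e) * pd m Y x) (t • e)]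
    congr 1; ext x
    rw [mul_comm, add_assoc, ← add_smul]; simp
  rw [← eq] at h3
  have := h1.unique h3
  rw [this]; congr 1; ext x; ring

/-- The flux. -/
def Xf (p ε : ℝ) (U : Euc 2 → ℝ) (m : Fin 2) (y : Euc 2) : ℝ := Wf ε U y ^ ((p-2)/2) * pd m U y

lemma Xf_contDiff {p ε : ℝ} (he : 0 < ε) {U : Euc 2 → ℝ} (hU : ContDiff ℝ 3 U) (m : Fin 2) : ContDiff ℝ 2 (Xf p ε U m) :=
  (Wf_rpow_contDiff he _ (m := 3) (n := 2) hU (by norm_num)).mul (pd_contDiff (m := 3) (n := 2) m hU (by norm_num))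

lemma weak2 {p ε R M : ℝ} {x₀ : Euc 2} {f U ζ : Euc 2 → ℝ} (h : Sol p ε R M x₀ f U) (hζ : ContDiff ℝ 1 ζ)
    (hζc : HasCompactSupport ζ) (ht : tsupport ζ ⊆ ball x₀ (3/2*R)) (i j : Fin 2) :
    ∫ x, (pd2 i j (Xf p ε U 0) x * pd 0 ζ x + pd2 i j (Xf p ε U 1) x * pd 1 ζ x) = ∫ x, pd2 i j f x * ζ x := by
  have sX (m) : ContDiff ℝ 2 (Xf p ε U m) := Xf_contDiff h.he0 h.hU m
  have sY (m) : ContDiff ℝ 1 (pd i (Xf p ε U m)) := pd_contDiff (m := 2) (n := 1) i (sX m) (by norm_num)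
  have cX (m) : HasCompactSupport (Xf p ε U m) := (pd_cs m h.csU).mul_left
  have cY (m) := pd_cs i (cX m)
  have cc (m n) : CCs (pd n (pd i (Xf p ε U m))) := pd_ccs n (sY m) (cY m)
  have cζ (m) := (pd_ccs m hζ hζc)
  have e1 (m) := curl j m (sY m) (cY m) hζ hζc
  simp only [← pd_pd]
  rw [integral_add ((cc 0 j).mul (cζ 0)).integrable ((cc 1 j).mul (cζ 1)).integrable, e1, e1,
    ← integral_add ((cc 0 0).mul (cζ j)).integrable ((cc 1 1).mul (cζ j)).integrable]
  have sf : ContDiff ℝ 1 (pd i f) := pd_contDiff (m := 2) (n := 1) i h.hf (by norm_num)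
  have e2 := ibp j sf hζ hζc
  have e3 : ∫ x, pd j (pd i f) x * ζ x = ∫ x, - (pd i f x * pd j ζ x) := by rw [integral_neg, e2, neg_neg]
  rw [e3]
  congr 1; ext x
  by_cases hx : x ∈ tsupport ζ
  · have hB := ht hx
    have ev : (fun y => pd 0 (Xf p ε U 0) y + pd 1 (Xf p ε U 1) y) =ᶠ[𝓝 x] fun y => (-1) * f y := by
      filter_upwards [isOpen_ball.mem_nhds hB] with y hy
      have L := Lreg_div (p := p) h.he0 (h.hU.contDiffAt.of_le (by norm_num) : ContDiffAt ℝ 2 U y)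
      rw [Fin.sum_univ_two, h.eq y hy] at L
      simp only [neg_mul, one_mul]
      exact L
    have d (m n) : DifferentiableAt ℝ (pd m (Xf p ε U n)) x :=
      (pd_contDiff (m := 2) (n := 1) m (sX n) (by norm_num)).differentiable (by norm_num) x
    have := pd_congr i ev
    rw [pd_add i (d 0 0) (d 1 1), pd_const_mul i (-1) (h.hf.differentiable (by norm_num) x), pd_pd, pd_pd,
      pd2_symm 0 i (sX 0).contDiffAt, pd2_symm 1 i (sX 1).contDiffAt] at this
    rw [pd_pd, pd_pd, ← add_mul, this]; ring
  · have : pd j ζ x = 0 := by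
      by_contra hne; exact hx (pd_supp j ζ (subset_tsupport _ hne))
    rw [this]; ring


lemma abs_pd2_le_Sh (U : Euc 2 → ℝ) (x : Euc 2) (i j : Fin 2) : |pd2 i j U x| ≤ Sh U x := by
  have a := abs_nonneg (pd2 0 0 U x)
  have b := abs_nonneg (pd2 0 1 U x)
  have c := abs_nonneg (pd2 1 0 U x)
  have d := abs_nonneg (pd2 1 1 U x)
  unfold Sh
  fin_cases i <;> fin_cases j <;> simp <;> linarith

lemma abs_pd2_add_le_Sh (U : Euc 2 → ℝ) (x : Euc 2) (i : Fin 2) : |pd2 0 i U x| + |pd2 1 i U x| ≤ Sh U x := by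
  have a := abs_nonneg (pd2 0 0 U x)
  have b := abs_nonneg (pd2 0 1 U x)
  have c := abs_nonneg (pd2 1 0 U x)
  have d := abs_nonneg (pd2 1 1 U x)
  unfold Sh
  fin_cases i <;> simp <;> linarith

lemma pd_Wf_le {ε : ℝ} (he : 0 < ε) {U : Euc 2 → ℝ} (hU : ContDiff ℝ 3 U) (i : Fin 2) (x : Euc 2) :
    |pd i (Wf ε U) x| ≤ 2 * √(Wf ε U x) * Sh U x := by
  have h2 : ContDiffAt ℝ 2 U x := hU.contDiffAt.of_le (by norm_num)
  rw [pd_Wf ε i h2]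
  have a (m) : |pd m U x| ≤ √(Wf ε U x) := Real.abs_le_sqrt (pd_sq_le_Wf he U m x)
  have s0 := Real.sqrt_nonneg (Wf ε U x)
  set s := √(Wf ε U x)
  calc |2 * (pd 0 U x * pd2 0 i U x + pd 1 U x * pd2 1 i U x)|
      = 2 * |pd 0 U x * pd2 0 i U x + pd 1 U x * pd2 1 i U x| := by rw [abs_mul]; norm_num
    _ ≤ 2 * (|pd 0 U x| * |pd2 0 i U x| + |pd 1 U x| * |pd2 1 i U x|) := by
      rw [← abs_mul, ← abs_mul]; gcongr; exact abs_add_le _ _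
    _ ≤ 2 * (s * |pd2 0 i U x| + s * |pd2 1 i U x|) := by gcongr <;> apply a
    _ ≤ _ := by
      have := mul_le_mul_of_nonneg_left (abs_pd2_add_le_Sh U x i) s0
      linarith

lemma pd3_symm {U : Euc 2 → ℝ} (hU : ContDiff ℝ 3 U) (n i j : Fin 2) (x : Euc 2) :
    pd j (pd2 n i U) x = pd n (pd2 i j U) x := by
  have e : pd2 n i U = pd2 i n U := by
    ext y; exact pd2_symm n i (hU.contDiffAt.of_le (by norm_num))
  rw [e, ← pd_pd i n, ← pd_pd i j, pd_pd, pd_pd]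
  exact pd2_symm n j (pd_contDiff (m := 3) (n := 2) i hU (by norm_num)).contDiffAt

lemma rho_bound {s S β Um A B Wi Wj Q : ℝ} (hs : 0 < s) (hS : 0 ≤ S) (hβ : |β| ≤ 1/4) (hU : |Um| ≤ s) (hA : |A| ≤ S)
    (hB : |B| ≤ S) (hi : |Wi| ≤ 2 * s * S) (hj : |Wj| ≤ 2 * s * S) (hQ : |Q| ≤ S ^ 2) :
    s^2 * (β * (s^2)⁻¹ * (Wj * A + Wi * B) + 2 * β * (s^2)⁻¹ * (Um * Q) + β * (β - 1) * (s^2)⁻¹ * (s^2)⁻¹ * (Wi * Wj * Um)) ^ 2 ≤ 36 * S ^ 4 := by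
  have h1 : |Wj * A| ≤ 2 * s * S * S := by rw [abs_mul]; gcongr
  have h2 : |Wi * B| ≤ 2 * s * S * S := by rw [abs_mul]; gcongr
  have h3 : |Um * Q| ≤ s * S ^ 2 := by rw [abs_mul]; gcongr
  have h4 : |Wi * Wj * Um| ≤ 2 * s * S * (2 * s * S) * s := by rw [abs_mul, abs_mul]; gcongr
  have hb1 : |β - 1| ≤ 5/4 := by
    rw [abs_le] at *; constructor <;> linarith [hβ.1, hβ.2]
  have key : |s * (β * (s^2)⁻¹ * (Wj * A + Wi * B) + 2 * β * (s^2)⁻¹ * (Um * Q) + β * (β - 1) * (s^2)⁻¹ * (s^2)⁻¹ * (Wi * Wj * Um))| ≤ 6 * S ^ 2 := by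
    have e : s * (β * (s^2)⁻¹ * (Wj * A + Wi * B) + 2 * β * (s^2)⁻¹ * (Um * Q) + β * (β - 1) * (s^2)⁻¹ * (s^2)⁻¹ * (Wi * Wj * Um))
      = β * (Wj * A / s) + β * (Wi * B / s) + 2 * β * (Um * Q / s) + β * (β - 1) * (Wi * Wj * Um / s^3) := by
      field_simp
    rw [e]
    have g1 : |Wj * A / s| ≤ 2 * S ^ 2 := by rw [abs_div, abs_of_pos hs, div_le_iff₀ hs]; linarith
    have g2 : |Wi * B / s| ≤ 2 * S ^ 2 := by rw [abs_div, abs_of_pos hs, div_le_iff₀ hs]; linarith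
    have g3 : |Um * Q / s| ≤ S ^ 2 := by rw [abs_div, abs_of_pos hs, div_le_iff₀ hs]; linarith
    have g4 : |Wi * Wj * Um / s^3| ≤ 4 * S ^ 2 := by
      rw [abs_div, abs_of_pos (pow_pos hs 3), div_le_iff₀ (pow_pos hs 3)]; linarith
    calc _ ≤ |β * (Wj * A / s)| + |β * (Wi * B / s)| + |2 * β * (Um * Q / s)| + |β * (β - 1) * (Wi * Wj * Um / s^3)| := by
          refine (abs_add_le _ _).trans ?_
          gcongr
          refine (abs_add_le _ _).trans ?_
          gcongr
          exact abs_add_le _ _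
      _ = |β| * |Wj * A / s| + |β| * |Wi * B / s| + 2 * |β| * |Um * Q / s| + |β| * |β - 1| * |Wi * Wj * Um / s^3| := by
          simp only [abs_mul, abs_two]
      _ ≤ 1/4 * (2 * S^2) + 1/4 * (2 * S^2) + 2 * (1/4) * S^2 + 1/4 * (5/4) * (4 * S^2) := by gcongr
      _ ≤ _ := by nlinarith [sq_nonneg S]
  have := pow_le_pow_left₀ (abs_nonneg _) key 2
  rw [sq_abs] at this
  calc _ = _ := (mul_pow _ _ 2).symm
    _ ≤ _ := this
    _ = _ := by ring

lemma Xstruct {p ε : ℝ} (he : 0 < ε) (hp : |p - 2| ≤ 1/2) {U : Euc 2 → ℝ} (hU : ContDiff ℝ 3 U) (i j : Fin 2) (x : Euc 2) :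
    ∃ ρ : Fin 2 → ℝ, (∀ m, pd2 i j (Xf p ε U m) x = Wf ε U x ^ ((p-2)/2) * (pd m (pd2 i j U) x +
      (p - 2) / Wf ε U x * ((pd 0 U x * pd 0 (pd2 i j U) x + pd 1 U x * pd 1 (pd2 i j U) x) * pd m U x) + ρ m)) ∧
      ∀ m, Wf ε U x * ρ m ^ 2 ≤ 36 * Sh U x ^ 4 := by
  have h2 (y) : ContDiffAt ℝ 2 U y := hU.contDiffAt.of_le (by norm_num)
  have hW := Wf_pos he U x
  have hW' (y) := Wf_pos he U y
  set β := (p-2)/2 with hβ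
  have sW : ContDiff ℝ 2 (Wf ε U) := Wf_contDiff ε (m := 3) (n := 2) hU (by norm_num)
  have dW (y) : DifferentiableAt ℝ (Wf ε U) y := sW.differentiable (by norm_num) y
  have dWi : DifferentiableAt ℝ (pd i (Wf ε U)) x := (pd_contDiff (m := 2) (n := 1) i sW le_rfl).differentiable (by norm_num) x
  have dU (m) : DifferentiableAt ℝ (pd m U) x := (pd_contDiff (m := 3) (n := 2) m hU le_rfl).differentiable (by norm_num) x
  have dU2 (m n) : DifferentiableAt ℝ (pd2 m n U) x :=
    (pd_contDiff (m := 2) (n := 1) n (pd_contDiff (m := 3) (n := 2) m hU le_rfl) le_rfl).differentiable (by norm_num) x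
  have dr (c : ℝ) (y) : DifferentiableAt ℝ (fun y => Wf ε U y ^ c) y :=
    (Wf_rpow_contDiff he c (m := 3) (n := 2) hU le_rfl).differentiable (by norm_num) y
  have p1 (n) (y) : pd n (fun y => Wf ε U y ^ β) y = (β * Wf ε U y ^ (β - 1)) * pd n (Wf ε U) y := pd_rpow n β (dW y) (hW' y)
  have p1f : pd i (fun y => Wf ε U y ^ β) = fun y => β * (Wf ε U y ^ (β - 1) * pd i (Wf ε U) y) := by
    ext y; rw [p1, mul_assoc]
  have p2W : pd2 i j (Wf ε U) x = 2 * ((pd2 0 j U x * pd2 0 i U x + pd2 1 j U x * pd2 1 i U x) +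
      (pd 0 U x * pd 0 (pd2 i j U) x + pd 1 U x * pd 1 (pd2 i j U) x)) := by
    have : pd i (Wf ε U) = fun y => 2 * (pd 0 U y * pd2 0 i U y + pd 1 U y * pd2 1 i U y) := by
      ext y; exact pd_Wf ε i (h2 y)
    rw [← pd_pd, this, pd_const_mul j 2 (((dU 0).fun_mul (dU2 0 i)).fun_add ((dU 1).fun_mul (dU2 1 i))),
      pd_add j ((dU 0).fun_mul (dU2 0 i)) ((dU 1).fun_mul (dU2 1 i)), pd_mul j (dU 0) (dU2 0 i), pd_mul j (dU 1) (dU2 1 i),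
      pd3_symm hU 0 i j, pd3_symm hU 1 i j, pd_pd, pd_pd]
    ring
  have p2 : pd2 i j (fun y => Wf ε U y ^ β) x = β * ((β - 1) * Wf ε U x ^ (β - 2) * (pd i (Wf ε U) x * pd j (Wf ε U) x)
      + Wf ε U x ^ (β - 1) * pd2 i j (Wf ε U) x) := by
    rw [← pd_pd, p1f, pd_const_mul j β ((dr _ x).fun_mul dWi), pd_mul j (dr _ x) dWi, pd_rpow j _ (dW x) hW, pd_pd,
      show β - 1 - 1 = β - 2 by ring]
    ring
  refine ⟨fun m => β * (Wf ε U x)⁻¹ * (pd j (Wf ε U) x * pd2 m i U x + pd i (Wf ε U) x * pd2 m j U x)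
    + 2 * β * (Wf ε U x)⁻¹ * (pd m U x * (pd2 0 j U x * pd2 0 i U x + pd2 1 j U x * pd2 1 i U x))
    + β * (β - 1) * (Wf ε U x)⁻¹ * (Wf ε U x)⁻¹ * (pd i (Wf ε U) x * pd j (Wf ε U) x * pd m U x), ?_, ?_⟩
  · intro m
    unfold Xf
    rw [pd2_mul i j (Wf_rpow_contDiff he _ (m := 3) (n := 2) hU le_rfl) (pd_contDiff (m := 3) (n := 2) m hU le_rfl), ← hβ,
      p2, p1, p1, p2W]
    have e3 : pd2 i j (pd m U) x = pd m (pd2 i j U) x := by rw [← pd_pd, pd_pd m i, pd3_symm hU m i j]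
    rw [e3, pd_pd, pd_pd, show p - 2 = 2 * β by rw [hβ]; ring,
      Real.rpow_sub_one hW.ne', show β - 2 = β - 1 - 1 by ring, Real.rpow_sub_one hW.ne', Real.rpow_sub_one hW.ne']
    field_simp
    ring
  · intro m
    have hs : 0 < √(Wf ε U x) := Real.sqrt_pos.2 hW
    have e := Real.sq_sqrt hW.le
    have hb : |β| ≤ 1/4 := by rw [hβ, abs_div, abs_two]; linarith
    have S0 := Sh_nonneg U x
    have hQ : |pd2 0 j U x * pd2 0 i U x + pd2 1 j U x * pd2 1 i U x| ≤ Sh U x ^ 2 := by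
      have a := abs_pd2_add_le_Sh U x j
      have b := abs_pd2_le_Sh U x 0 i
      have c := abs_pd2_le_Sh U x 1 i
      calc _ ≤ |pd2 0 j U x| * |pd2 0 i U x| + |pd2 1 j U x| * |pd2 1 i U x| := by
            rw [← abs_mul, ← abs_mul]; exact abs_add_le _ _
        _ ≤ |pd2 0 j U x| * Sh U x + |pd2 1 j U x| * Sh U x := by gcongr
        _ ≤ _ := by nlinarith
    have := rho_bound (Um := pd m U x) hs S0 hb (Real.abs_le_sqrt (pd_sq_le_Wf he U m x)) (abs_pd2_le_Sh U x m i) (abs_pd2_le_Sh U x m j)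
      (pd_Wf_le he hU i x) (pd_Wf_le he hU j x) hQ
    rw [e] at this
    exact this


lemma w_bounds {a0 a1 U0 U1 c : ℝ} (hc : |c| * (U0^2+U1^2) ≤ 1/2) :
    (a0^2+a1^2)/2 ≤ (a0 + c * ((U0*a0+U1*a1)*U0)) * a0 + (a1 + c * ((U0*a0+U1*a1)*U1)) * a1 ∧
    (a0 + c * ((U0*a0+U1*a1)*U0))^2 ≤ 4 * (a0^2+a1^2) ∧ (a1 + c * ((U0*a0+U1*a1)*U1))^2 ≤ 4 * (a0^2+a1^2) := by
  have cs : (U0*a0+U1*a1)^2 ≤ (U0^2+U1^2)*(a0^2+a1^2) := by nlinarith [sq_nonneg (U0*a1-U1*a0)]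
  have A : 0 ≤ a0^2+a1^2 := by positivity
  have N : 0 ≤ U0^2+U1^2 := by positivity
  have h1 : |c| * (U0*a0+U1*a1)^2 ≤ (a0^2+a1^2)/2 := by
    calc |c| * (U0*a0+U1*a1)^2 ≤ |c| * ((U0^2+U1^2)*(a0^2+a1^2)) := by gcongr
      _ = |c| * (U0^2+U1^2) * (a0^2+a1^2) := by ring
      _ ≤ 1/2 * (a0^2+a1^2) := by gcongr
      _ = _ := by ring
  have h2 : (|c| * (U0^2+U1^2))^2 ≤ 1/4 := by
    have := pow_le_pow_left₀ (by positivity) hc 2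
    linarith
  have h3 : c^2 * ((U0*a0+U1*a1)^2 * (U0^2+U1^2)) ≤ (a0^2+a1^2)/4 := by
    calc c^2 * ((U0*a0+U1*a1)^2 * (U0^2+U1^2)) ≤ c^2 * ((U0^2+U1^2)*(a0^2+a1^2) * (U0^2+U1^2)) := by gcongr
      _ = (|c| * (U0^2+U1^2))^2 * (a0^2+a1^2) := by rw [mul_pow, sq_abs]; ring
      _ ≤ 1/4 * (a0^2+a1^2) := by gcongr
      _ = _ := by ring
  refine ⟨?_, ?_, ?_⟩
  · have := neg_abs_le c
    have := mul_le_mul_of_nonneg_right this (sq_nonneg (U0*a0+U1*a1))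
    nlinarith
  · have q : (c * ((U0*a0+U1*a1)*U0))^2 ≤ (a0^2+a1^2)/4 := by
      refine le_trans ?_ h3
      have : 0 ≤ c^2 * ((U0*a0+U1*a1)^2 * U1^2) := by positivity
      linarith [this]
    nlinarith [sq_nonneg (a0 - c * ((U0*a0+U1*a1)*U0)), sq_nonneg a1]
  · have q : (c * ((U0*a0+U1*a1)*U1))^2 ≤ (a0^2+a1^2)/4 := by
      refine le_trans ?_ h3
      have : 0 ≤ c^2 * ((U0*a0+U1*a1)^2 * U0^2) := by positivity
      linarith [this]
    nlinarith [sq_nonneg (a1 - c * ((U0*a0+U1*a1)*U1)), sq_nonneg a0]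

lemma yng (x y : ℝ) : 2*|x*y| ≤ (x)^2/128+144*y^2 := by
  rw [abs_mul, ← sq_abs x, ← sq_abs y]
  nlinarith [sq_nonneg (|x|/12-12*|y|), sq_nonneg (|x|)]

lemma yng1 (x y : ℝ) : 2*|x*y| ≤ (x)^2+y^2 := by
  rw [abs_mul, ← sq_abs x, ← sq_abs y]
  nlinarith [sq_nonneg (|x|-|y|)]

lemma coer1 {t V a w ρ η z ω κ q e A : ℝ} (hq : 1 ≤ q) (ht : t^2 ≤ 1) (hκ : |κ| ≤ 2*q) (he0 : 1 ≤ e) (he : q * t^2 ≤ e)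
    (he2 : e ≤ 2*q) (hw : w^2 ≤ 4 * A) :
    η^2*e*(w*a) - η^2*e*(a^2/16) - η^2*e*(A/16) - 200*q*(η^2*ρ^2+η^2*(V^2*ω^2)+z^2*V^2) ≤
      (w+ρ)*(η^2*e*a+2*η*z*(t*V)+η^2*κ*(t*V)*ω) := by
  have q0 : 0 ≤ q := by linarith
  have A0 : 0 ≤ A := by nlinarith [sq_nonneg w]
  have y1 : -(η^2*e*(a^2/16+4*ρ^2)) ≤ η^2*e*(ρ*a) := by
    have : 0 ≤ η^2*e := by positivity
    nlinarith [mul_nonneg this (sq_nonneg (a/4+2*ρ))]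
  have y1' : η^2*e*(4*ρ^2) ≤ 8*q*(η^2*ρ^2) := by nlinarith [mul_le_mul_of_nonneg_right he2 (by positivity : 0 ≤ η^2*ρ^2)]
  have tV : (t*V)^2 ≤ V^2 := by rw [mul_pow]; nlinarith [sq_nonneg V]
  have y2 : -(η^2*w^2/128+144*(z^2*V^2)) ≤ 2*η*z*(t*V)*w := by
    have : z^2*(t*V)^2 ≤ z^2*V^2 := by gcongr
    have h := (abs_le.1 (le_of_eq_of_le (by rw [abs_mul, abs_two]) (yng (η*w) (z*(t*V))) : |2*((η*w)*(z*(t*V)))| ≤ _)).1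
    rw [mul_pow z] at h
    linarith
  have y2' : η^2*w^2/128 ≤ η^2*e*(A/32) := by
    have : η^2*w^2 ≤ η^2*(4*A) := by gcongr
    have : η^2*A*1 ≤ η^2*A*e := by gcongr
    nlinarith
  have y3 : -(z^2*V^2+η^2*ρ^2) ≤ 2*η*z*(t*V)*ρ := by
    have : z^2*(t*V)^2 ≤ z^2*V^2 := by gcongr
    nlinarith [sq_nonneg (z*(t*V)+η*ρ)]
  have y4 : |κ*((t*V)*ω*w)| ≤ q*(t^2*w^2/128+144*(V^2*ω^2)) := by
    rw [abs_mul]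
    calc |κ| * |(t*V)*ω*w| ≤ 2*q*|(t*V)*ω*w| := by gcongr
      _ ≤ q*(t^2*w^2/128+144*(V^2*ω^2)) := by
        have := yng (t*w) (V*ω)
        have e : t*w*(V*ω) = (t*V)*ω*w := by ring
        rw [e] at this
        have := mul_le_mul_of_nonneg_left this q0
        linarith
  have y4' : q*(t^2*w^2/128) ≤ e*(A/32) := by
    have : q*t^2*w^2 ≤ e*(4*A) := by gcongr
    nlinarith
  have y5 : |κ*((t*V)*ω*ρ)| ≤ q*(V^2*ω^2+ρ^2) := by
    rw [abs_mul]
    calc |κ| * |(t*V)*ω*ρ| ≤ 2*q*|(t*V)*ω*ρ| := by gcongr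
      _ ≤ q*(V^2*ω^2+ρ^2) := by
        have : (t*V)^2*ω^2 ≤ V^2*ω^2 := by gcongr
        have h := yng1 ((t*V)*ω) ρ
        have := mul_le_mul_of_nonneg_left h q0
        have r := mul_le_mul_of_nonneg_left ‹(t*V)^2*ω^2 ≤ V^2*ω^2› q0
        rw [mul_pow (t*V) ω] at this
        linarith
  have z4 := mul_le_mul_of_nonneg_left (neg_le_of_abs_le y4) (sq_nonneg η)
  have z4' := mul_le_mul_of_nonneg_left y4' (sq_nonneg η)
  have z5 := mul_le_mul_of_nonneg_left (neg_le_of_abs_le y5) (sq_nonneg η)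
  have r1 : 0 ≤ η^2*ρ^2 := by positivity
  have r2 : 0 ≤ η^2*(V^2*ω^2) := by positivity
  have r3 : 0 ≤ z^2*V^2 := by positivity
  have s1 := mul_le_mul_of_nonneg_right hq r1
  have s2 := mul_le_mul_of_nonneg_right hq r2
  have s3 := mul_le_mul_of_nonneg_right hq r3
  linarith

lemma coer {t V a0 a1 U0 U1 c ρ0 ρ1 η z0 z1 ω0 ω1 κ q e : ℝ} (hc : |c| * (U0^2+U1^2) ≤ 1/2) (hq : 1 ≤ q) (ht : t^2 ≤ 1) (hκ : |κ| ≤ 2*q)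
    (he : e = 1 + (2*q-2)*t^2) :
    η^2*e*(a0^2+a1^2)/4 - 200*q*(η^2*(ρ0^2+ρ1^2)+η^2*(V^2*(ω0^2+ω1^2))+(z0^2+z1^2)*V^2) ≤
      (a0 + c * ((U0*a0+U1*a1)*U0) + ρ0)*(η^2*e*a0+2*η*z0*(t*V)+η^2*κ*(t*V)*ω0) +
      (a1 + c * ((U0*a0+U1*a1)*U1) + ρ1)*(η^2*e*a1+2*η*z1*(t*V)+η^2*κ*(t*V)*ω1) := by
  obtain ⟨b1, b2, b3⟩ := w_bounds (a0 := a0) (a1 := a1) hc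
  have t0 := sq_nonneg t
  have e1 : 1 ≤ e := by rw [he]; nlinarith
  have e2 : q * t^2 ≤ e := by rw [he]; nlinarith
  have e3 : e ≤ 2*q := by rw [he]; nlinarith
  have c0 := coer1 (a := a0) (ρ := ρ0) (η := η) (z := z0) (ω := ω0) (V := V) hq ht hκ e1 e2 e3 b2
  have c1 := coer1 (a := a1) (ρ := ρ1) (η := η) (z := z1) (ω := ω1) (V := V) hq ht hκ e1 e2 e3 b3
  have : 0 ≤ η^2*e := by positivity
  have := mul_le_mul_of_nonneg_left b1 this
  have : 0 ≤ η^2*e*(a0^2+a1^2) := by positivity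
  linarith

lemma Gbounds {k q W T Θ S β : ℝ} (hk : 0 < k) (hk1 : k ≤ 1) (hW : 0 < W) (hT : 0 < T) (hΘ : 1 ≤ Θ) (hS : 0 ≤ S) (hSΘ : S ≤ Θ)
    (hWΘ : W ≤ Θ^2) (hTΘ : T ≤ Θ^2) (hβ : |β| ≤ 1/4) :
    W^(k*q)*T^(q-1)*T ≤ W^(k*q-1)*T^(q-1/k)*Θ^(2/k+2) ∧
    (∀ ρ, W*ρ^2 ≤ 36*S^4 → W^(k*q)*T^(q-1)*ρ^2 ≤ 36*(W^(k*q-1)*T^(q-1/k)*Θ^(2/k+2))) ∧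
    (∀ ω, W*ω^2 ≤ 4*S^2 → W^(k*q)*T^(q-1)*(T*ω^2) ≤ 4*(W^(k*q-1)*T^(q-1/k)*Θ^(2/k+2))) ∧
    W^(k*q-β)*T^(q-1)*√T ≤ W^(k*q-1)*T^(q-1/k)*Θ^(2/k+2) := by
  have Θ0 : 0 < Θ := by linarith
  have ik : 1 ≤ 1/k := by rw [le_div_iff₀ hk]; linarith
  set a := W^(k*q-1)*T^(q-1/k) with ha
  have a0 : 0 < a := by positivity
  have E0 : 0 < T^(1/k-1) := by positivity
  have hE : T^(1/k-1) ≤ Θ^(2/k-2) := by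
    calc T^(1/k-1) ≤ (Θ^2)^(1/k-1) := Real.rpow_le_rpow hT.le hTΘ (by linarith)
      _ = Θ^(2/k-2) := by rw [← Real.rpow_natCast, ← Real.rpow_mul Θ0.le]; congr 1; push_cast; ring
  have e1 : T^(q-1) = T^(q-1/k)*T^(1/k-1) := by rw [← Real.rpow_add hT]; congr 1; ring
  have e2 : W^(k*q) = W^(k*q-1)*W := by
    nth_rw 3 [← Real.rpow_one W]; rw [← Real.rpow_add hW]; congr 1; ring
  have e3 : Θ^(2/k+2) = Θ^(2/k-2)*Θ^4 := by
    rw [← Real.rpow_natCast, ← Real.rpow_add Θ0]; congr 1; push_cast; ring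
  have hα : W^(k*q)*T^(q-1) = a*T^(1/k-1)*W := by rw [e1, e2, ha]; ring
  have F0 : 0 < Θ^(2/k-2) := by positivity
  have main : ∀ y, y ≤ Θ^4 → a*T^(1/k-1)*y ≤ a*Θ^(2/k+2) := by
    intro y hy
    rw [e3, mul_assoc]
    refine mul_le_mul_of_nonneg_left ?_ a0.le
    calc T^(1/k-1)*y ≤ T^(1/k-1)*Θ^4 := by gcongr
      _ ≤ _ := by gcongr
  refine ⟨?_, ?_, ?_, ?_⟩
  · rw [hα, mul_assoc]
    apply main
    calc W*T ≤ Θ^2*Θ^2 := by gcongr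
      _ = _ := by ring
  · intro ρ hρ
    rw [hα, mul_assoc]
    have := main (W*ρ^2/36) (by
      have : S^4 ≤ Θ^4 := by gcongr
      linarith)
    linarith
  · intro ω hω
    rw [hα]
    have := main (T*(W*ω^2)/4) (by
      have : S^2 ≤ Θ^2 := by gcongr
      calc T*(W*ω^2)/4 ≤ Θ^2*(4*S^2)/4 := by gcongr
        _ = Θ^2*S^2 := by ring
        _ ≤ Θ^2*Θ^2 := by gcongr
        _ = _ := by ring)
    linarith
  · have e4 : W^(k*q-β) = W^(k*q-1)*W^(1-β) := by rw [← Real.rpow_add hW]; congr 1; ring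
    rw [e4, e1]
    have := main (W^(1-β)*√T) (by
      have b := abs_le.1 hβ
      have : √T ≤ Θ := Real.sqrt_le_iff.2 ⟨Θ0.le, hTΘ⟩
      have : W^(1-β) ≤ Θ^3 := by
        calc W^(1-β) ≤ (Θ^2)^(1-β) := Real.rpow_le_rpow hW.le hWΘ (by linarith [b.2])
          _ = Θ^(2*(1-β)) := by rw [← Real.rpow_natCast, ← Real.rpow_mul Θ0.le]; congr 1
          _ ≤ Θ^(3:ℝ) := Real.rpow_le_rpow_of_exponent_le hΘ (by linarith [b.1])
          _ = Θ^3 := by rw [← Real.rpow_natCast]; congr 1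
      calc W^(1-β)*√T ≤ Θ^3*Θ := by gcongr
        _ = _ := by ring)
    calc _ = a*T^(1/k-1)*(W^(1-β)*√T) := by rw [ha]; ring
      _ ≤ _ := this


/-- regularized square of the second derivative -/
def Tf (τ : ℝ) (i j : Fin 2) (U : Euc 2 → ℝ) (x : Euc 2) : ℝ := pd2 i j U x ^ 2 + τ

lemma Tf_pos {τ : ℝ} (h : 0 < τ) (i j : Fin 2) (U : Euc 2 → ℝ) (x : Euc 2) : 0 < Tf τ i j U x := by
  unfold Tf; positivity

lemma v_contDiff {U : Euc 2 → ℝ} (hU : ContDiff ℝ 3 U) (i j : Fin 2) : ContDiff ℝ 1 (pd2 i j U) :=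
  pd_contDiff (m := 2) (n := 1) j (pd_contDiff (m := 3) (n := 2) i hU le_rfl) le_rfl

lemma Tf_contDiff {U : Euc 2 → ℝ} (hU : ContDiff ℝ 3 U) (τ : ℝ) (i j : Fin 2) : ContDiff ℝ 1 (Tf τ i j U) := by
  have := v_contDiff hU i j
  unfold Tf; fun_prop

lemma Tr_contDiff {U : Euc 2 → ℝ} (hU : ContDiff ℝ 3 U) {τ : ℝ} (h : 0 < τ) (i j : Fin 2) (c : ℝ) :
    ContDiff ℝ 1 (fun x => Tf τ i j U x ^ c) :=
  (Tf_contDiff hU τ i j).rpow_const_of_ne fun x => (Tf_pos h i j U x).ne'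

lemma Wr_contDiff {U : Euc 2 → ℝ} (hU : ContDiff ℝ 3 U) {ε : ℝ} (h : 0 < ε) (c : ℝ) :
    ContDiff ℝ 1 (fun x => Wf ε U x ^ c) := (Wf_rpow_contDiff h c (m := 3) (n := 2) hU le_rfl).of_le (by norm_num)

lemma pd_Tf {U : Euc 2 → ℝ} (hU : ContDiff ℝ 3 U) (τ : ℝ) (i j m : Fin 2) (x : Euc 2) :
    pd m (Tf τ i j U) x = 2 * pd2 i j U x * pd m (pd2 i j U) x := by
  have d : DifferentiableAt ℝ (pd2 i j U) x := (v_contDiff hU i j).differentiable (by norm_num) x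
  unfold Tf
  rw [pd_add m (d.fun_pow 2) (by fun_prop), pd_pow m 2 d, pd_const]; simp

/-- the test function -/
def zt (κ q ε τ : ℝ) (i j : Fin 2) (η U : Euc 2 → ℝ) (x : Euc 2) : ℝ :=
  η x ^ 2 * (Wf ε U x ^ κ * (Tf τ i j U x ^ (q-1) * pd2 i j U x))

/-- the Sobolev function -/
def ph (k q ε τ : ℝ) (i j : Fin 2) (η U : Euc 2 → ℝ) (x : Euc 2) : ℝ :=
  η x * (Wf ε U x ^ (k*q/2) * Tf τ i j U x ^ (q/2))

/-- the square of the right side weight -/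
def af (k q ε τ : ℝ) (i j : Fin 2) (U : Euc 2 → ℝ) (x : Euc 2) : ℝ := Wf ε U x ^ (k*q-1) * Tf τ i j U x ^ (q-1/k)

lemma zt_contDiff {U η : Euc 2 → ℝ} (hU : ContDiff ℝ 3 U) (hη : ContDiff ℝ 1 η) {κ q ε τ : ℝ} (he : 0 < ε) (hτ : 0 < τ) (i j : Fin 2) :
    ContDiff ℝ 1 (zt κ q ε τ i j η U) :=
  (hη.pow 2).mul ((Wr_contDiff hU he κ).mul ((Tr_contDiff hU hτ i j _).mul (v_contDiff hU i j)))

lemma ph_contDiff {U η : Euc 2 → ℝ} (hU : ContDiff ℝ 3 U) (hη : ContDiff ℝ 1 η) {k q ε τ : ℝ} (he : 0 < ε) (hτ : 0 < τ) (i j : Fin 2) :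
    ContDiff ℝ 1 (ph k q ε τ i j η U) :=
  hη.mul ((Wr_contDiff hU he _).mul (Tr_contDiff hU hτ i j _))

lemma af_cont {U : Euc 2 → ℝ} (hU : ContDiff ℝ 3 U) {k q ε τ : ℝ} (he : 0 < ε) (hτ : 0 < τ) (i j : Fin 2) :
    Continuous (af k q ε τ i j U) :=
  (Wr_contDiff hU he _).continuous.mul (Tr_contDiff hU hτ i j _).continuous

lemma pd_zt {U η : Euc 2 → ℝ} (hU : ContDiff ℝ 3 U) (hη : ContDiff ℝ 1 η) {κ q ε τ : ℝ} (he : 0 < ε) (hτ : 0 < τ) (i j m : Fin 2) (x : Euc 2) :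
    pd m (zt κ q ε τ i j η U) x = Wf ε U x ^ κ * Tf τ i j U x ^ (q-1) *
      (η x^2 * (1 + (2*q-2)*(pd2 i j U x^2/Tf τ i j U x)) * pd m (pd2 i j U) x + 2 * η x * pd m η x * pd2 i j U x
        + η x^2 * κ * pd2 i j U x * (pd m (Wf ε U) x / Wf ε U x)) := by
  have dη : DifferentiableAt ℝ η x := hη.differentiable (by norm_num) x
  have dv : DifferentiableAt ℝ (pd2 i j U) x := (v_contDiff hU i j).differentiable (by norm_num) x
  have dW : DifferentiableAt ℝ (Wf ε U) x := Wf_diffAt ε (hU.contDiffAt.of_le (by norm_num))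
  have dT : DifferentiableAt ℝ (Tf τ i j U) x := (Tf_contDiff hU τ i j).differentiable (by norm_num) x
  have dr : DifferentiableAt ℝ (fun x => Wf ε U x ^ κ) x := (Wr_contDiff hU he κ).differentiable (by norm_num) x
  have ds : DifferentiableAt ℝ (fun x => Tf τ i j U x ^ (q-1)) x := (Tr_contDiff hU hτ i j _).differentiable (by norm_num) x
  have hW := Wf_pos he U x
  have hT := Tf_pos hτ i j U x
  unfold zt
  rw [pd_mul m (dη.fun_pow 2) (dr.fun_mul (ds.fun_mul dv)), pd_mul m dr (ds.fun_mul dv), pd_mul m ds dv, pd_pow m 2 dη,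
    pd_rpow m _ dW hW, pd_rpow m _ dT hT, pd_Tf hU, Real.rpow_sub_one hW.ne' κ, Real.rpow_sub_one hT.ne' (q-1)]
  field_simp
  push_cast
  ring

lemma pd_ph {U η : Euc 2 → ℝ} (hU : ContDiff ℝ 3 U) (hη : ContDiff ℝ 1 η) {k q ε τ : ℝ} (he : 0 < ε) (hτ : 0 < τ) (i j m : Fin 2) (x : Euc 2) :
    pd m (ph k q ε τ i j η U) x = Wf ε U x ^ (k*q/2) * Tf τ i j U x ^ (q/2) *
      (pd m η x + η x * (k*q/2) * (pd m (Wf ε U) x / Wf ε U x) + η x * q * (pd2 i j U x * pd m (pd2 i j U) x / Tf τ i j U x)) := by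
  have dη : DifferentiableAt ℝ η x := hη.differentiable (by norm_num) x
  have dW : DifferentiableAt ℝ (Wf ε U) x := Wf_diffAt ε (hU.contDiffAt.of_le (by norm_num))
  have dT : DifferentiableAt ℝ (Tf τ i j U) x := (Tf_contDiff hU τ i j).differentiable (by norm_num) x
  have dr : DifferentiableAt ℝ (fun x => Wf ε U x ^ (k*q/2)) x := (Wr_contDiff hU he _).differentiable (by norm_num) x
  have ds : DifferentiableAt ℝ (fun x => Tf τ i j U x ^ (q/2)) x := (Tr_contDiff hU hτ i j _).differentiable (by norm_num) x
  have hW := Wf_pos he U x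
  have hT := Tf_pos hτ i j U x
  unfold ph
  rw [pd_mul m dη (dr.fun_mul ds), pd_mul m dr ds,
    pd_rpow m _ dW hW, pd_rpow m _ dT hT, pd_Tf hU, Real.rpow_sub_one hW.ne', Real.rpow_sub_one hT.ne']
  field_simp
  ring

lemma Wf_le_Th {ε : ℝ} (he1 : ε < 1) (U : Euc 2 → ℝ) (x : Euc 2) : Wf ε U x ≤ Th U x ^ 2 := by
  have a := abs_nonneg (pd 0 U x)
  have b := abs_nonneg (pd 1 U x)
  have c := Sh_nonneg U x
  unfold Wf Th
  rw [← sq_abs (pd 0 U x), ← sq_abs (pd 1 U x)]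
  have := mul_nonneg a b
  have : (2 + |pd 0 U x| + |pd 1 U x|)^2 ≤ (2 + |pd 0 U x| + |pd 1 U x| + Sh U x)^2 := by apply pow_le_pow_left₀ <;> linarith
  nlinarith

lemma Tf_le_Th {τ : ℝ} (hτ : τ < 1) (i j : Fin 2) (U : Euc 2 → ℝ) (x : Euc 2) : Tf τ i j U x ≤ Th U x ^ 2 := by
  have a := abs_nonneg (pd 0 U x)
  have b := abs_nonneg (pd 1 U x)
  have c := abs_pd2_le_Sh U x i j
  have d := Sh_nonneg U x
  unfold Tf Th
  rw [← sq_abs (pd2 i j U x)]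
  have h1 : |pd2 i j U x|^2 ≤ Sh U x^2 := by gcongr
  have : (2 + Sh U x)^2 ≤ (2 + |pd 0 U x| + |pd 1 U x| + Sh U x)^2 := by gcongr; linarith
  nlinarith

lemma Th_ge (U : Euc 2 → ℝ) (x : Euc 2) : 1 ≤ Th U x := by
  have a := abs_nonneg (pd 0 U x)
  have b := abs_nonneg (pd 1 U x)
  have d := Sh_nonneg U x
  unfold Th; linarith

lemma Sh_le_Th (U : Euc 2 → ℝ) (x : Euc 2) : Sh U x ≤ Th U x := by
  have a := abs_nonneg (pd 0 U x)
  have b := abs_nonneg (pd 1 U x)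
  unfold Th; linarith

lemma om_bound {ε : ℝ} (he : 0 < ε) {U : Euc 2 → ℝ} (hU : ContDiff ℝ 3 U) (m : Fin 2) (x : Euc 2) :
    Wf ε U x * (pd m (Wf ε U) x / Wf ε U x)^2 ≤ 4 * Sh U x^2 := by
  have hW := Wf_pos he U x
  have h := pow_le_pow_left₀ (abs_nonneg _) (pd_Wf_le he hU m x) 2
  rw [sq_abs, mul_pow, mul_pow, Real.sq_sqrt hW.le] at h
  have e : Wf ε U x * (pd m (Wf ε U) x / Wf ε U x)^2 = pd m (Wf ε U) x ^2 / Wf ε U x := by field_simp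
  rw [e, div_le_iff₀ hW]; linarith

lemma three_sq (a b c : ℝ) : (a+b+c)^2 ≤ 3*(a^2+b^2+c^2) := by
  nlinarith [sq_nonneg (a-b), sq_nonneg (a-c), sq_nonneg (b-c)]

lemma hee_aux {q w : ℝ} (hq : 1 ≤ q) (h0 : 0 ≤ w) (h1 : w ≤ 1) : q*w ≤ 1+(2*q-2)*w := by nlinarith

lemma pt_final {k q α T G y v e a0 a1 z0 z1 ω0 ω1 ρ0 ρ1 X : ℝ} (hk : 0 < k) (hk1 : k ≤ 1) (hq : 1 ≤ q) (hT : 0 < T) (α0 : 0 ≤ α)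
    (G0 : 0 ≤ G) (g1 : α*T ≤ G) (r0 : α*ρ0^2 ≤ 36*G) (r1 : α*ρ1^2 ≤ 36*G) (o0 : α*(T*ω0^2) ≤ 4*G) (o1 : α*(T*ω1^2) ≤ 4*G)
    (hee : q*(v^2/T) ≤ e) (ey : ∀ a, T*(y*q*(v*a/T))^2 = q*(y^2*((q*(v^2/T))*a^2)))
    (C2 : α*(y^2*e*(a0^2+a1^2)/4 - 200*q*(y^2*(ρ0^2+ρ1^2)+y^2*(T*(ω0^2+ω1^2))+(z0^2+z1^2)*T)) ≤ α*X) :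
    α*T*(z0 + y*(k*q/2)*ω0 + y*q*(v*a0/T))^2 + α*T*(z1 + y*(k*q/2)*ω1 + y*q*(v*a1/T))^2 ≤
      12*q*(α*X) + 200000*q^2*((y^2+(z0^2+z1^2))*G) := by
  have q0 : 0 ≤ q := by linarith
  have T0 : 0 ≤ T := hT.le
  have S (z ω a : ℝ) (hω : α * (T*ω^2) ≤ 4*G) : α*T*(z + y*(k*q/2)*ω + y*q*(v*a/T))^2 ≤
      3*(z^2*G) + 3*q^2*(y^2*G) + 3*q*(α*(y^2*e*a^2)) := by
    calc α*T*(z + y*(k*q/2)*ω + y*q*(v*a/T))^2 ≤ α*T*(3*(z^2 + (y*(k*q/2)*ω)^2 + (y*q*(v*a/T))^2)) := by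
          gcongr; exact three_sq _ _ _
      _ = 3*(z^2*(α*T)) + 3*((k*q/2)^2*(y^2*(α*(T*ω^2)))) + 3*(α*(T*(y*q*(v*a/T))^2)) := by ring
      _ ≤ 3*(z^2*G) + 3*((1*q/2)^2*(y^2*(4*G))) + 3*(α*(q*(y^2*(e*a^2)))) := by
          rw [ey]; gcongr
      _ = _ := by ring
  have S0 := S z0 ω0 a0 o0
  have S1 := S z1 ω1 a1 o1
  have L : α*(y^2*e*(a0^2+a1^2)/4) ≤ α*X + 200*q*(y^2*(72*G)+y^2*(8*G)+(z0^2+z1^2)*G) := by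
    have u1 : α*(200*q*(y^2*(ρ0^2+ρ1^2)+y^2*(T*(ω0^2+ω1^2))+(z0^2+z1^2)*T)) ≤ 200*q*(y^2*(72*G)+y^2*(8*G)+(z0^2+z1^2)*G) := by
      calc _ = 200*q*(y^2*(α*ρ0^2+α*ρ1^2)+y^2*(α*(T*ω0^2)+α*(T*ω1^2))+(z0^2+z1^2)*(α*T)) := by ring
        _ ≤ 200*q*(y^2*(36*G+36*G)+y^2*(4*G+4*G)+(z0^2+z1^2)*G) := by gcongr
        _ = _ := by ring
    linarith
  have L2 := mul_le_mul_of_nonneg_left L (by positivity : 0 ≤ 12*q)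
  have m1 : 0 ≤ y^2*G := by positivity
  have m2 : 0 ≤ (z0^2+z1^2)*G := by positivity
  have m3 : (z0^2+z1^2)*G ≤ q^2*((z0^2+z1^2)*G) := le_mul_of_one_le_left m2 (by nlinarith)
  have m4 : 0 ≤ q^2*(y^2*G) := by positivity
  have m5 : 0 ≤ q^2*((z0^2+z1^2)*G) := by positivity
  linarith

lemma pt_est {k p ε τ q : ℝ} {U η : Euc 2 → ℝ} (hk : 0 < k) (hk1 : k ≤ 1) (hp : |p-2| ≤ 1/2) (he : 0 < ε) (he1 : ε < 1) (hU : ContDiff ℝ 3 U)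
    (hη : ContDiff ℝ 1 η) (hτ : 0 < τ) (hτ1 : τ < 1) (hq : 1 ≤ q) (i j : Fin 2) (x : Euc 2) :
    pd 0 (ph k q ε τ i j η U) x ^ 2 + pd 1 (ph k q ε τ i j η U) x ^ 2 ≤
      12 * q * (pd2 i j (Xf p ε U 0) x * pd 0 (zt (k*q-(p-2)/2) q ε τ i j η U) x + pd2 i j (Xf p ε U 1) x * pd 1 (zt (k*q-(p-2)/2) q ε τ i j η U) x)
      + 200000 * q^2 * ((η x^2 + (pd 0 η x^2 + pd 1 η x^2)) * (af k q ε τ i j U x * Th U x ^ (2/k+2))) := by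
  have hW := Wf_pos he U x
  have hT := Tf_pos hτ i j U x
  obtain ⟨ρ, hρ, hρb⟩ := Xstruct he hp hU i j x
  have hb : |(p-2)/2| ≤ 1/4 := by rw [abs_div, abs_two]; linarith
  obtain ⟨g1, g2, g3, -⟩ := Gbounds (q := q) hk hk1 hW hT (Th_ge U x) (Sh_nonneg U x) (Sh_le_Th U x) (Wf_le_Th he1 U x) (Tf_le_Th hτ1 i j U x) hb
  have r0 := g2 _ (hρb 0)
  have r1 := g2 _ (hρb 1)
  have o0 := g3 _ (om_bound he hU 0 x)
  have o1 := g3 _ (om_bound he hU 1 x)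
  rw [pd_zt hU hη he hτ, pd_zt hU hη he hτ, pd_ph hU hη he hτ, pd_ph hU hη he hτ, hρ, hρ]
  have hc : |(p-2)/Wf ε U x| * (pd 0 U x^2 + pd 1 U x^2) ≤ 1/2 := by
    rw [abs_div, abs_of_pos hW, div_mul_eq_mul_div, div_le_iff₀ hW]
    have : pd 0 U x^2 + pd 1 U x^2 ≤ Wf ε U x := by unfold Wf; linarith
    gcongr
  have hs : 0 < √(Tf τ i j U x) := Real.sqrt_pos.2 hT
  have hs2 := Real.sq_sqrt hT.le
  have ht2 : (pd2 i j U x / √(Tf τ i j U x))^2 = pd2 i j U x^2 / Tf τ i j U x := by rw [div_pow, hs2]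
  have hvT : pd2 i j U x^2 / Tf τ i j U x ≤ 1 := by
    rw [div_le_one hT]; unfold Tf; linarith
  have htV : pd2 i j U x / √(Tf τ i j U x) * √(Tf τ i j U x) = pd2 i j U x := div_mul_cancel₀ _ hs.ne'
  have hκ : |k*q-(p-2)/2| ≤ 2*q := by
    have := abs_le.1 hb
    rw [abs_le]; constructor <;> nlinarith [this.1, this.2]
  have C := coer (t := pd2 i j U x / √(Tf τ i j U x)) (V := √(Tf τ i j U x)) (a0 := pd 0 (pd2 i j U) x) (a1 := pd 1 (pd2 i j U) x)
    (ρ0 := ρ 0) (ρ1 := ρ 1) (η := η x) (z0 := pd 0 η x) (z1 := pd 1 η x) (ω0 := pd 0 (Wf ε U) x / Wf ε U x) (ω1 := pd 1 (Wf ε U) x / Wf ε U x)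
    hc hq (by rw [ht2]; exact hvT) hκ rfl
  rw [ht2, htV, hs2] at C
  have hαpos : 0 < Wf ε U x ^ (k*q) * Tf τ i j U x ^ (q-1) := by positivity
  have eα : Wf ε U x ^ ((p-2)/2) * (Wf ε U x ^ (k*q-(p-2)/2) * Tf τ i j U x ^ (q-1)) = Wf ε U x ^ (k*q) * Tf τ i j U x ^ (q-1) := by
    rw [← mul_assoc, ← Real.rpow_add hW]; congr 2; ring
  have eφ : (Wf ε U x ^ (k*q/2) * Tf τ i j U x ^ (q/2))^2 = Wf ε U x ^ (k*q) * Tf τ i j U x ^ (q-1) * Tf τ i j U x := by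
    rw [mul_pow, ← Real.rpow_natCast, ← Real.rpow_mul hW.le, ← Real.rpow_natCast, ← Real.rpow_mul hT.le, Real.rpow_sub_one hT.ne', mul_assoc,
      div_mul_cancel₀ _ hT.ne']
    congr 2 <;> push_cast <;> ring
  have C2 := mul_le_mul_of_nonneg_left C hαpos.le
  have G0 : 0 ≤ af k q ε τ i j U x * Th U x ^ (2/k+2) := by
    have := Th_ge U x
    have : 0 < Th U x := by linarith
    unfold af; positivity
  change _ ≤ af k q ε τ i j U x * _ at g1
  change _ ≤ 36*(af k q ε τ i j U x * _) at r0 r1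
  change _ ≤ 4*(af k q ε τ i j U x * _) at o0 o1
  have hee : q * (pd2 i j U x^2 / Tf τ i j U x) ≤ 1 + (2*q-2)*(pd2 i j U x^2/Tf τ i j U x) := by
    exact hee_aux hq (by positivity) hvT
  have ey (a : ℝ) : Tf τ i j U x * (η x * q * (pd2 i j U x * a / Tf τ i j U x))^2 = q * (η x^2 * ((q * (pd2 i j U x^2 / Tf τ i j U x)) * a^2)) := by
    field_simp
  rw [mul_pow (Wf ε U x ^ (k*q/2) * Tf τ i j U x ^ (q/2)), mul_pow (Wf ε U x ^ (k*q/2) * Tf τ i j U x ^ (q/2)), eφ]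
  set G := af k q ε τ i j U x * Th U x ^ (2/k+2)
  set α := Wf ε U x ^ (k*q) * Tf τ i j U x ^ (q-1) with hα
  set T := Tf τ i j U x
  set ω0 := pd 0 (Wf ε U) x / Wf ε U x
  set ω1 := pd 1 (Wf ε U) x / Wf ε U x
  set v := pd2 i j U x
  set a0 := pd 0 (pd2 i j U) x
  set a1 := pd 1 (pd2 i j U) x
  set e := 1 + (2*q-2)*(v^2/T) with hedef
  set z0 := pd 0 η x
  set z1 := pd 1 η x
  set X := (a0 + (p-2)/Wf ε U x * ((pd 0 U x * a0 + pd 1 U x * a1) * pd 0 U x) + ρ 0) * (η x^2*e*a0 + 2*η x*z0*v + η x^2*(k*q-(p-2)/2)*v*ω0) +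
      (a1 + (p-2)/Wf ε U x * ((pd 0 U x * a0 + pd 1 U x * a1) * pd 1 U x) + ρ 1) * (η x^2*e*a1 + 2*η x*z1*v + η x^2*(k*q-(p-2)/2)*v*ω1) with hX
  have hXe : Wf ε U x ^ ((p-2)/2) * (a0 + (p-2)/Wf ε U x * ((pd 0 U x * a0 + pd 1 U x * a1) * pd 0 U x) + ρ 0) *
      (Wf ε U x ^ (k*q-(p-2)/2) * T ^ (q-1) * (η x^2*e*a0 + 2*η x*z0*v + η x^2*(k*q-(p-2)/2)*v*ω0)) +
      Wf ε U x ^ ((p-2)/2) * (a1 + (p-2)/Wf ε U x * ((pd 0 U x * a0 + pd 1 U x * a1) * pd 1 U x) + ρ 1) *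
      (Wf ε U x ^ (k*q-(p-2)/2) * T ^ (q-1) * (η x^2*e*a1 + 2*η x*z1*v + η x^2*(k*q-(p-2)/2)*v*ω1)) = α * X := by
    rw [← eα, hX]; ring
  rw [hXe]
  exact pt_final hk hk1 hq hT hαpos.le G0 g1 r0 r1 o0 o1 hee ey C2

lemma pt_f {k p ε τ q M : ℝ} {U η f : Euc 2 → ℝ} (hk : 0 < k) (hk1 : k ≤ 1) (hp : |p-2| ≤ 1/2) (he : 0 < ε) (he1 : ε < 1)
    (hτ : 0 < τ) (hτ1 : τ < 1) (i j : Fin 2) (x : Euc 2) (hf : |pd2 i j f x| ≤ M) :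
    pd2 i j f x * zt (k*q-(p-2)/2) q ε τ i j η U x ≤
      M * ((η x^2 + (pd 0 η x^2 + pd 1 η x^2)) * (af k q ε τ i j U x * Th U x ^ (2/k+2))) := by
  have hW := Wf_pos he U x
  have hT := Tf_pos hτ i j U x
  have hb : |(p-2)/2| ≤ 1/4 := by rw [abs_div, abs_two]; linarith
  obtain ⟨-, -, -, g⟩ := Gbounds (q := q) hk hk1 hW hT (Th_ge U x) (Sh_nonneg U x) (Sh_le_Th U x) (Wf_le_Th he1 U x) (Tf_le_Th hτ1 i j U x) hb
  have G0 : 0 ≤ af k q ε τ i j U x * Th U x ^ (2/k+2) := by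
    have := Th_ge U x
    have : 0 < Th U x := by linarith
    unfold af; positivity
  have M0 : 0 ≤ M := (abs_nonneg _).trans hf
  have hv : |pd2 i j U x| ≤ √(Tf τ i j U x) := Real.abs_le_sqrt (by unfold Tf; linarith)
  change _ ≤ af k q ε τ i j U x * _ at g
  calc _ ≤ |pd2 i j f x * zt (k*q-(p-2)/2) q ε τ i j η U x| := le_abs_self _
    _ = |pd2 i j f x| * (η x^2 * (Wf ε U x ^ (k*q-(p-2)/2) * Tf τ i j U x ^ (q-1) * |pd2 i j U x|)) := by
      unfold zt
      rw [abs_mul, abs_mul, abs_mul, abs_mul, abs_of_nonneg (sq_nonneg (η x)), abs_of_pos (Real.rpow_pos_of_pos hW _),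
        abs_of_pos (Real.rpow_pos_of_pos hT _)]; ring
    _ ≤ M * (η x^2 * (Wf ε U x ^ (k*q-(p-2)/2) * Tf τ i j U x ^ (q-1) * √(Tf τ i j U x))) := by gcongr
    _ ≤ M * ((η x^2 + (pd 0 η x^2 + pd 1 η x^2)) * (af k q ε τ i j U x * Th U x ^ (2/k+2))) := by
      gcongr
      linarith [sq_nonneg (pd 0 η x), sq_nonneg (pd 1 η x)]

lemma caccio {k p ε R M τ q : ℝ} {x₀ : Euc 2} {f U η : Euc 2 → ℝ} (h : Sol p ε R M x₀ f U) (hk : 0 < k) (hk1 : k ≤ 1) (hp : |p-2| ≤ 1/2)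
    (hη : ContDiff ℝ 1 η) (hηc : HasCompactSupport η) (ht : tsupport η ⊆ ball x₀ (3/2*R))
    (hτ : 0 < τ) (hτ1 : τ < 1) (hq : 1 ≤ q) (i j : Fin 2) :
    ∫ x, (pd 0 (ph k q ε τ i j η U) x ^ 2 + pd 1 (ph k q ε τ i j η U) x ^ 2) ≤
      (12*M+200000)*q^2 * ∫ x, (η x^2 + (pd 0 η x^2 + pd 1 η x^2)) * (af k q ε τ i j U x * Th U x ^ (2/k+2)) := by
  have hU := h.hU
  have sz := zt_contDiff (κ := k*q-(p-2)/2) (q := q) hU hη h.he0 hτ i j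
  have cz : HasCompactSupport (zt (k*q-(p-2)/2) q ε τ i j η U) :=
    hηc.mono' (by
      refine (Function.support_subset_iff'.2 fun x hx => ?_)
      have : η x = 0 := by by_contra hne; exact hx (subset_tsupport _ hne)
      simp [zt, this])
  have tz : tsupport (zt (k*q-(p-2)/2) q ε τ i j η U) ⊆ ball x₀ (3/2*R) := (tsupp_mono fun x hx => by simp [zt, hx]).trans ht
  have sp := ph_contDiff (k := k) (q := q) hU hη h.he0 hτ i j
  have cp : HasCompactSupport (ph k q ε τ i j η U) := hηc.mul_right
  have w := weak2 h sz cz tz i j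
  have ih : CCs (fun x => (η x^2 + (pd 0 η x^2 + pd 1 η x^2)) * (af k q ε τ i j U x * Th U x ^ (2/k+2))) := by
    have c0 : CCs η := ⟨hη.continuous, hηc⟩
    have : Continuous (fun x => af k q ε τ i j U x * Th U x ^ (2/k+2)) :=
      (af_cont hU h.he0 hτ i j).mul ((c_Th hU).rpow_const fun x => Or.inl (by have := Th_ge U x; linarith))
    exact ((c0.pow (n := 2) (by norm_num)).add (((pd_ccs 0 hη hηc).pow (n := 2) (by norm_num)).add ((pd_ccs 1 hη hηc).pow (n := 2) (by norm_num)))).mul_cont this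
  have i1 := (((pd_ccs 0 sp cp).pow (n := 2) (by norm_num)).add ((pd_ccs 1 sp cp).pow (n := 2) (by norm_num))).integrable
  have sX (m) : ContDiff ℝ 2 (Xf p ε U m) := Xf_contDiff h.he0 hU m
  have cX (m) : Continuous (pd2 i j (Xf p ε U m)) :=
    (pd_contDiff (m := 1) (n := 0) j (pd_contDiff (m := 2) (n := 1) i (sX m) le_rfl) le_rfl).continuous
  have i2 := (((pd_ccs 0 sz cz).mul_cont (cX 0)).add ((pd_ccs 1 sz cz).mul_cont (cX 1))).integrable
  have i2' : Integrable (fun x => (pd2 i j (Xf p ε U 0) x * pd 0 (zt (k*q-(p-2)/2) q ε τ i j η U) x + pd2 i j (Xf p ε U 1) x * pd 1 (zt (k*q-(p-2)/2) q ε τ i j η U) x)) := by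
    simpa [mul_comm] using i2
  have i3 : Integrable (fun x => pd2 i j f x * zt (k*q-(p-2)/2) q ε τ i j η U x) := by
    have : Continuous (pd2 i j f) :=
      (pd_contDiff (m := 1) (n := 0) j (pd_contDiff (m := 2) (n := 1) i h.hf le_rfl) le_rfl).continuous
    have := (CCs.mul_cont (⟨sz.continuous, cz⟩ : CCs _) this).integrable
    simpa [mul_comm] using this
  have q0 : 0 ≤ q := by linarith
  have m1 := integral_mono i1 ((i2'.const_mul (12*q)).add (ih.integrable.const_mul (200000*q^2)))
    (fun x => pt_est (k := k) (p := p) hk hk1 hp h.he0 h.he1 hU hη hτ hτ1 hq i j x)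
  have m2 := integral_mono i3 (ih.integrable.const_mul M) (fun x => pt_f hk hk1 hp h.he0 h.he1 hτ hτ1 i j x (h.bf2 i j x))
  simp only [Pi.add_apply] at m1
  rw [integral_add (i2'.const_mul (12*q)) (ih.integrable.const_mul (200000*q^2)), integral_const_mul, integral_const_mul, w] at m1
  rw [integral_const_mul] at m2
  set J := ∫ x, (η x^2 + (pd 0 η x^2 + pd 1 η x^2)) * (af k q ε τ i j U x * Th U x ^ (2/k+2)) with hJ
  have J0 : 0 ≤ J := by
    refine integral_nonneg fun x => ?_
    have := Th_ge U x
    have : 0 < Th U x := by linarith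
    have := Wf_pos h.he0 U x
    have := Tf_pos hτ i j U x
    simp only [Pi.zero_apply]
    unfold af; positivity
  have hM := h.hM
  have m3 := mul_le_mul_of_nonneg_left m2 (by positivity : 0 ≤ 12*q)
  have : q*(M*J) ≤ q^2*(M*J) := by
    have : 0 ≤ M*J := by positivity
    have : q ≤ q^2 := by nlinarith
    gcongr
  calc _ ≤ _ := m1
    _ ≤ 12*q*(M*J) + 200000*q^2*J := by gcongr
    _ ≤ _ := by linarith


theorem fd_nsq (u : Euc 2 → ℝ) (x : Euc 2) :
    ‖fderiv ℝ u x‖ ^ 2 = pd 0 u x ^ 2 + pd 1 u x ^ 2 := by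
  rw [← grad_sq, gradient, LinearIsometryEquiv.norm_map]

theorem lp_comp {g : Euc 2 → ℝ} {s : NNReal} (hs2 : s < 2) {x₀ : Euc 2} {R : ℝ} (hg : Continuous g)
    (hs : Function.support g ⊆ ball x₀ R) :
    eLpNorm g s volume ≤ eLpNorm g 2 volume * volume (ball x₀ R) ^ (1 / (s : ℝ) - 1 / 2) := by
  rw [← eLpNorm_restrict_eq_of_support_subset (p := s) hs,
    ← eLpNorm_restrict_eq_of_support_subset (p := 2) hs]
  have := eLpNorm_le_eLpNorm_mul_rpow_measure_univ (μ := volume.restrict (ball x₀ R))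
    (p := s) (q := 2) (by exact_mod_cast hs2.le) hg.aestronglyMeasurable
  simpa using this

theorem sobolev {r : ℝ} (hr : 2 < r) (x₀ : Euc 2) (R : ℝ) :
    ∃ C : ℝ, 0 ≤ C ∧ ∀ φ : Euc 2 → ℝ, ContDiff ℝ 1 φ → tsupport φ ⊆ ball x₀ R →
      (∫ x, |φ x| ^ r) ^ (1 / r) ≤ C * (∫ x, (pd 0 φ x ^ 2 + pd 1 φ x ^ 2)) ^ (1 / 2 : ℝ) := by
  have hr0 : 0 < r := by linarith
  obtain ⟨s, hs⟩ : ∃ s : NNReal, (s : ℝ) = 2 * r / (r + 2) := ⟨⟨2 * r / (r + 2), by positivity⟩, rfl⟩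
  obtain ⟨ρ, hρ⟩ : ∃ s : NNReal, (s : ℝ) = r := ⟨⟨r, hr0.le⟩, rfl⟩
  have hs1 : (1 : NNReal) ≤ s := by
    rw [← NNReal.coe_le_coe, hs, NNReal.coe_one, le_div_iff₀ (by linarith)]; linarith
  have hs2 : s < (2 : NNReal) := by
    rw [← NNReal.coe_lt_coe, hs, div_lt_iff₀ (by linarith)]
    push_cast
    linarith
  have hfin : Module.finrank ℝ (Euc 2) = 2 := by simp
  set K := eLpNormLESNormFDerivOfLeConst ℝ (volume : Measure (Euc 2)) (ball x₀ R) s ρ with hK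
  set V : ℝ≥0∞ := volume (ball x₀ R) ^ (1 / (s : ℝ) - 1 / 2) with hV
  have hVt : V ≠ ⊤ := by
    apply ENNReal.rpow_ne_top_of_nonneg _ measure_ball_lt_top.ne
    rw [sub_nonneg]
    apply one_div_le_one_div_of_le
    · have : (1 : ℝ) ≤ s := by exact_mod_cast hs1
      linarith
    · exact_mod_cast hs2.le
  refine ⟨K * V.toReal, by positivity, fun φ hφ hsupp => ?_⟩
  have hc : HasCompactSupport φ := by
    refine HasCompactSupport.of_support_subset_isCompact (isCompact_closedBall x₀ R) ?_
    exact (subset_tsupport φ).trans (hsupp.trans ball_subset_closedBall)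
  have h1 : eLpNorm φ ρ volume ≤ K * eLpNorm (fderiv ℝ φ) s volume := by
    apply eLpNorm_le_eLpNorm_fderiv_of_le volume hφ ((subset_tsupport φ).trans hsupp) hs1
    · rw [hfin]; exact_mod_cast hs2
    · rw [hfin, hρ, NNReal.coe_inv, hs]
      apply le_of_eq
      push_cast
      field_simp
      ring
    · exact isBounded_ball
  have hfd : Continuous (fderiv ℝ φ) := hφ.continuous_fderiv (by norm_num)
  have hfc : HasCompactSupport (fderiv ℝ φ) := hc.fderiv ℝ
  have hfs : Function.support (fderiv ℝ φ) ⊆ ball x₀ R :=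
    (support_fderiv_subset ℝ).trans hsupp
  have h2 : eLpNorm (fderiv ℝ φ) s volume ≤ eLpNorm (fderiv ℝ φ) 2 volume * V := by
    rw [← eLpNorm_norm (fderiv ℝ φ), ← eLpNorm_norm (fderiv ℝ φ)]
    exact lp_comp hs2 hfd.norm (fun x hx => hfs (fun h0 => hx (by simp [h0])))
  have m1 : MemLp φ ρ volume := hφ.continuous.memLp_of_hasCompactSupport hc
  have m2 : MemLp (fderiv ℝ φ) 2 volume := hfd.memLp_of_hasCompactSupport hfc
  have hρ0 : (ρ : ℝ≥0∞) ≠ 0 := by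
    have : (0 : ℝ) < ρ := by rw [hρ]; exact hr0
    exact_mod_cast (NNReal.coe_pos.1 this).ne'
  have h3 := h1.trans (mul_le_mul_right h2 (K : ℝ≥0∞))
  rw [m1.eLpNorm_eq_integral_rpow_norm hρ0 ENNReal.coe_ne_top,
    m2.eLpNorm_eq_integral_rpow_norm two_ne_zero ENNReal.ofNat_ne_top] at h3
  have e2 : (∫ a, ‖fderiv ℝ φ a‖ ^ (2 : ℝ≥0∞).toReal) = ∫ x, (pd 0 φ x ^ 2 + pd 1 φ x ^ 2) := by
    congr 1
    ext x
    rw [← fd_nsq]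
    simp
  rw [e2] at h3
  simp only [ENNReal.coe_toReal, hρ, Real.norm_eq_abs, ENNReal.toReal_ofNat] at h3
  have hI : 0 ≤ ∫ x, (pd 0 φ x ^ 2 + pd 1 φ x ^ 2) := integral_nonneg fun x => by positivity
  rw [← ENNReal.ofReal_toReal hVt, ← ENNReal.ofReal_mul (by positivity), ← ENNReal.ofReal_coe_nnreal,
    ← ENNReal.ofReal_mul (by positivity), ENNReal.ofReal_le_ofReal_iff (by positivity)] at h3
  rw [one_div, one_div]
  linarith

theorem st_deriv_bdd : ∃ C : ℝ, 0 ≤ C ∧ ∀ t, |deriv Real.smoothTransition t| ≤ C := by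
  have hc : Continuous (deriv Real.smoothTransition) :=
    (Real.smoothTransition.contDiff (n := 1)).continuous_deriv le_rfl
  obtain ⟨C, hC⟩ := (isCompact_Icc (a := (0 : ℝ)) (b := 1)).exists_bound_of_continuousOn hc.continuousOn
  refine ⟨max C 0, le_max_right _ _, fun t => ?_⟩
  by_cases ht : t ∈ Icc (0 : ℝ) 1
  · exact (hC t ht).trans (le_max_left _ _)
  · have : deriv Real.smoothTransition t = 0 := by
      rw [mem_Icc, not_and_or, not_le, not_le] at ht
      rcases ht with ht | ht
      · have : Real.smoothTransition =ᶠ[𝓝 t] fun _ => 0 := by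
          filter_upwards [Iio_mem_nhds ht] with y hy using Real.smoothTransition.zero_of_nonpos (le_of_lt hy)
        rw [this.deriv_eq]; simp
      · have : Real.smoothTransition =ᶠ[𝓝 t] fun _ => 1 := by
          filter_upwards [Ioi_mem_nhds ht] with y hy using Real.smoothTransition.one_of_one_le (le_of_lt hy)
        rw [this.deriv_eq]; simp
    rw [this]; simp

theorem cut_hh : ∃ A : ℝ, 0 ≤ A ∧ ∀ (x₀ : Euc 2) (h' h : ℝ), 0 < h' → h' < h →
    ∃ η : Euc 2 → ℝ, ContDiff ℝ 1 η ∧ HasCompactSupport η ∧ tsupport η ⊆ closedBall x₀ h ∧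
      (∀ x, 0 ≤ η x) ∧ (∀ x, η x ≤ 1) ∧ (∀ x ∈ ball x₀ h', η x = 1) ∧
      (∀ i x, |pd i η x| ≤ A / (h - h')) := by
  obtain ⟨A, hA0, hA⟩ := st_deriv_bdd
  refine ⟨2 * A, by positivity, fun x₀ h' h h0 hh => ?_⟩
  have hD : 0 < h ^ 2 - h' ^ 2 := by nlinarith
  set ζ : Euc 2 → ℝ := fun x => (h ^ 2 - ‖x - x₀‖ ^ 2) / (h ^ 2 - h' ^ 2) with hζ
  have hζs : ContDiff ℝ 1 ζ := by
    apply ContDiff.div_const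
    exact contDiff_const.sub ((contDiff_id.sub contDiff_const).norm_sq ℝ)
  set η : Euc 2 → ℝ := fun x => Real.smoothTransition (ζ x) with hη
  have hηs : ContDiff ℝ 1 η := Real.smoothTransition.contDiff.comp hζs
  have hz : ∀ x, x ∉ ball x₀ h → η x = 0 := by
    intro x hx
    apply Real.smoothTransition.zero_of_nonpos
    rw [mem_ball, dist_eq_norm, not_lt] at hx
    apply div_nonpos_of_nonpos_of_nonneg _ hD.le
    nlinarith
  have hts : tsupport η ⊆ closedBall x₀ h := by
    apply closure_minimal _ isClosed_closedBall
    intro x hx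
    by_contra hn
    exact hx (hz x fun hm => hn (ball_subset_closedBall hm))
  have hcs : HasCompactSupport η := HasCompactSupport.of_support_subset_isCompact
    (isCompact_closedBall x₀ h) ((subset_tsupport η).trans hts)
  refine ⟨η, hηs, hcs, hts, fun x => Real.smoothTransition.nonneg _,
    fun x => Real.smoothTransition.le_one _, fun x hx => ?_, fun i x => ?_⟩
  · apply Real.smoothTransition.one_of_one_le
    rw [mem_ball, dist_eq_norm] at hx
    rw [le_div_iff₀ hD]
    have := norm_nonneg (x - x₀)
    nlinarith
  · by_cases hx : x ∈ closedBall x₀ h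
    swap
    · have : η =ᶠ[𝓝 x] fun _ => 0 := by
        filter_upwards [isClosed_closedBall.isOpen_compl.mem_nhds hx] with y hy
        exact hz y fun hm => hy (ball_subset_closedBall hm)
      rw [pd, this.fderiv_eq]
      simp
      have : 0 < h - h' := by linarith
      positivity
    have hd : HasDerivAt Real.smoothTransition (deriv Real.smoothTransition (ζ x)) (ζ x) :=
      ((Real.smoothTransition.contDiff (n := 1)).differentiable (by norm_num) _).hasDerivAt
    have hζd : HasFDerivAt ζ ((h ^ 2 - h' ^ 2)⁻¹ • ((0 : Euc 2 →L[ℝ] ℝ) - (2 : ℕ) • (innerSL ℝ (x - x₀) : Euc 2 →L[ℝ] ℝ))) x := by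
      have h1 : HasFDerivAt (fun y : Euc 2 => ‖y - x₀‖ ^ 2) ((2 : ℕ) • (innerSL ℝ (x - x₀) : Euc 2 →L[ℝ] ℝ)) x := by
        simpa using ((hasFDerivAt_id x).sub_const x₀).norm_sq
      have := ((hasFDerivAt_const (h ^ 2) x).sub h1).const_mul (h ^ 2 - h' ^ 2)⁻¹
      refine this.congr_of_eventuallyEq (Filter.Eventually.of_forall fun y => ?_)
      simp [hζ, div_eq_inv_mul]
    have e1 : pd i ζ x = (h ^ 2 - h' ^ 2)⁻¹ * (-(2 * (x - x₀) i)) := by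
      rw [pd, hζd.fderiv]
      simp [EuclideanSpace.inner_single_right]
    rw [hη, pd_comp i (hζs.differentiable (by norm_num) x) hd, abs_mul, e1, abs_mul, abs_neg, abs_mul,
      abs_of_pos (inv_pos.2 hD)]
    have hxi : |(x - x₀) i| ≤ h := by
      have := EuclideanSpace.norm_eq (x - x₀)
      have h2 := PiLp.norm_apply_le (x - x₀) i
      rw [Real.norm_eq_abs] at h2
      rw [mem_closedBall, dist_eq_norm] at hx
      linarith
    have hdl : 0 < h - h' := by linarith
    have hb : (h ^ 2 - h' ^ 2)⁻¹ * (|2| * |(x - x₀) i|) ≤ 2 / (h - h') := by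
      rw [abs_of_pos (by norm_num : (0:ℝ) < 2), inv_mul_le_iff₀ hD]
      have : (h ^ 2 - h' ^ 2) * (2 / (h - h')) = 2 * (h + h') := by
        field_simp
        ring
      rw [this]
      nlinarith
    calc _ ≤ A * (2 / (h - h')) := mul_le_mul (hA _) hb (by positivity) hA0
      _ = _ := by ring


theorem c_memLp {a : Euc 2 → ℝ} (ha : Continuous a) (x₀ : Euc 2) (h : ℝ) (p : ℝ≥0∞) :
    MemLp a p (volume.restrict (ball x₀ h)) := by
  have : IsFiniteMeasure (volume.restrict (ball x₀ h)) :=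
    ⟨by rw [Measure.restrict_apply_univ]; exact measure_ball_lt_top⟩
  obtain ⟨C, hC⟩ := (isCompact_closedBall x₀ h).exists_bound_of_continuousOn ha.continuousOn
  refine MemLp.of_bound ha.aestronglyMeasurable C ?_
  filter_upwards [ae_restrict_mem measurableSet_ball] with x hx
  exact hC x (ball_subset_closedBall hx)

theorem holder_step {a T : Euc 2 → ℝ} (ha : Continuous a) (ha0 : ∀ x, 0 ≤ a x) (hT : Continuous T)
    (hT1 : ∀ x, 1 ≤ T x) {ν κ K h R : ℝ} {S : ℕ} (hν : 2 < ν) (hS : κ * (ν / (ν - 2)) ≤ S)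
    (hhR : h ≤ R) {x₀ : Euc 2} (hK : ∫ x in ball x₀ R, T x ^ S ≤ K) :
    ∫ x in ball x₀ h, a x * T x ^ κ ≤
      (∫ x in ball x₀ h, a x ^ (ν / 2)) ^ (2 / ν) * K ^ ((ν - 2) / ν) := by
  have hT0 : ∀ x, 0 < T x := fun x => lt_of_lt_of_le one_pos (hT1 x)
  have hc : Real.HolderConjugate (ν / 2) (ν / (ν - 2)) := by
    rw [Real.holderConjugate_iff]
    refine ⟨by linarith, ?_⟩
    have : ν - 2 ≠ 0 := by linarith
    field_simp
    ring
  have hTk : Continuous fun x => T x ^ κ := hT.rpow_const fun x => Or.inl (hT0 x).ne'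
  have h1 := integral_mul_le_Lp_mul_Lq_of_nonneg (μ := volume.restrict (ball x₀ h)) hc
    (f := a) (g := fun x => T x ^ κ) (Filter.Eventually.of_forall ha0)
    (Filter.Eventually.of_forall fun x => (rpow_pos_of_pos (hT0 x) _).le)
    (c_memLp ha x₀ h _) (c_memLp hTk x₀ h _)
  rw [one_div_div, one_div_div] at h1
  refine h1.trans (mul_le_mul_of_nonneg_left ?_ (by
    apply rpow_nonneg
    exact integral_nonneg fun x => rpow_nonneg (ha0 x) _))
  apply rpow_le_rpow (integral_nonneg fun x => rpow_nonneg (rpow_nonneg (hT0 x).le _) _) _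
    (div_nonneg (by linarith) (by linarith))
  have hint : IntegrableOn (fun x => T x ^ S) (ball x₀ R) :=
    cint (hT.pow S) x₀ R
  refine le_trans ?_ hK
  refine le_trans (b := ∫ x in ball x₀ h, T x ^ S) ?_ ?_
  · apply setIntegral_mono
    · exact cint (hTk.rpow_const fun x => Or.inl (rpow_pos_of_pos (hT0 x) _).ne') x₀ h
    · exact hint.mono_set (ball_subset_ball hhR)
    · intro x
      show (T x ^ κ) ^ (ν / (ν - 2)) ≤ T x ^ S
      rw [← rpow_mul (hT0 x).le, ← rpow_natCast]
      exact rpow_le_rpow_of_exponent_le (hT1 x) hS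
  · exact setIntegral_mono_set hint (Filter.Eventually.of_forall fun x => (pow_pos (hT0 x) S).le)
      (ball_subset_ball hhR).eventuallyLE

theorem half_alg {Cs c q D d I K ν : ℝ} (hν : 2 < ν) (hq : 0 ≤ q) (hd : 0 < d) (hI : 0 ≤ I)
    (hc : 0 ≤ c) (hD : 0 ≤ D) (hK : 0 ≤ K) :
    Cs * (c * q ^ 2 * (D / d ^ 2 * (I ^ (2 / ν) * K))) ^ (1 / 2 : ℝ) =
      Cs * (c * D * K) ^ (1 / 2 : ℝ) * (q / d) * I ^ (1 / ν) := by
  have e : c * q ^ 2 * (D / d ^ 2 * (I ^ (2 / ν) * K)) = (c * D * K) * (q / d * I ^ (1 / ν)) ^ (2 : ℝ) := by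
    rw [mul_rpow (by positivity) (by positivity), ← rpow_mul hI,
      show 1 / ν * 2 = 2 / ν by ring, rpow_two, div_pow]
    ring
  rw [e, mul_rpow (by positivity) (by positivity), ← rpow_mul (by positivity)]
  norm_num
  ring

theorem revtau {k l : ℝ} (r : ℝ) (hk0 : 0 < k) (hk1 : k ≤ 1) (hl : 1 < l) (i j : Fin 2) :
    ∃ c : ℝ, 0 < c ∧ ∀ (R M ν : ℝ) (x₀ : Euc 2), 0 < R → 2 * l / (l - 1) < ν → ν < r →
      ∃ C : ℝ, 0 ≤ C ∧ ∀ p ε f U τ q h' h, 1 < p → |p - 2| < c → Sol p ε R M x₀ f U → 0 < τ → τ < 1 →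
        1 / k ≤ q → 0 < h' → h' < h → h < R →
        (∫ x in ball x₀ h', (Wf ε U x ^ (k * q / 2) * Tf τ i j U x ^ (q / 2)) ^ r) ^ (1 / r) ≤
          C * (q / (h - h')) * (∫ x in ball x₀ h, af k q ε τ i j U x ^ (ν / 2)) ^ (1 / ν) := by
  obtain ⟨N, hN⟩ := exists_nat_ge ((2 / k + 2) * l)
  obtain ⟨c, hc, hD⟩ := Dfinal N
  refine ⟨min c (1 / 2), by positivity, fun R M ν x₀ hR hν hνr => ?_⟩
  have hν2 : 2 < ν := by
    refine lt_trans ?_ hν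
    rw [lt_div_iff₀ (by linarith)]
    linarith
  have hr2 : 2 < r := by linarith
  have hml : ν / (ν - 2) ≤ l := by
    rw [div_lt_iff₀ (by linarith)] at hν
    rw [div_le_iff₀ (by linarith)]
    nlinarith
  have hS : (2 / k + 2) * (ν / (ν - 2)) ≤ ((2 * N + 4 : ℕ) : ℝ) := by
    have h1 : (2 / k + 2) * (ν / (ν - 2)) ≤ (2 / k + 2) * l :=
      mul_le_mul_of_nonneg_left hml (by positivity)
    have : (0 : ℝ) ≤ N := Nat.cast_nonneg N
    push_cast
    linarith
  obtain ⟨K, hK⟩ := hD R M x₀ hR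
  obtain ⟨Cs, hCs0, hCs⟩ := sobolev hr2 x₀ R
  obtain ⟨A, hA0, hA⟩ := cut_hh
  set D := R ^ 2 + 2 * (2 * A) ^ 2 with hDdef
  have hD0 : 0 ≤ D := by positivity
  refine ⟨Cs * ((12 * |M| + 200000) * D * |K| ^ ((ν - 2) / ν)) ^ (1 / 2 : ℝ), by positivity, ?_⟩
  intro p ε f U τ q h' h hp hpc sol hτ hτ1 hq hh0 hhh hhR
  have hM : 1 ≤ M := sol.hM
  have hq1 : 1 ≤ q := by
    refine le_trans ?_ hq
    rw [le_div_iff₀ hk0]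
    linarith
  have hd : 0 < h - h' := by linarith
  obtain ⟨η, hη, hηc, hηt, hη0, hη1, hηe, hηd⟩ := hA x₀ h' ((h + h') / 2) hh0 (by linarith)
  have hth : tsupport η ⊆ ball x₀ h := hηt.trans (closedBall_subset_ball (by linarith))
  have hthR : tsupport η ⊆ ball x₀ R := hth.trans (ball_subset_ball hhR.le)
  have cac := caccio sol hk0 hk1 (hpc.le.trans (min_le_right _ _)) hη hηc
    (hthR.trans (ball_subset_ball (by linarith))) hτ hτ1 hq1 i j
  have hphC := ph_contDiff (k := k) (q := q) sol.hU hη sol.he0 hτ i j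
  have hpht : tsupport (ph k q ε τ i j η U) ⊆ tsupport η := by
    apply closure_mono
    intro x hx hx0
    exact hx (by simp [ph, hx0])
  have sob := hCs _ hphC (hpht.trans hthR)
  have hphc : HasCompactSupport (ph k q ε τ i j η U) := by
    refine HasCompactSupport.of_support_subset_isCompact (isCompact_closedBall x₀ R) ?_
    exact (subset_tsupport _).trans ((hpht.trans hthR).trans ball_subset_closedBall)
  have haf := af_cont (k := k) (q := q) sol.hU sol.he0 hτ i j
  have haf0 : ∀ x, 0 ≤ af k q ε τ i j U x := fun x => by
    have := Wf_pos sol.he0 U x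
    have := Tf_pos hτ i j U x
    unfold af
    positivity
  have hG0 : ∀ x, 0 ≤ Wf ε U x ^ (k * q / 2) * Tf τ i j U x ^ (q / 2) := fun x => by
    have := Wf_pos sol.he0 U x
    have := Tf_pos hτ i j U x
    positivity
  have st1 : ∫ x in ball x₀ h', (Wf ε U x ^ (k * q / 2) * Tf τ i j U x ^ (q / 2)) ^ r ≤
      ∫ x, |ph k q ε τ i j η U x| ^ r := by
    have e : ∫ x in ball x₀ h', (Wf ε U x ^ (k * q / 2) * Tf τ i j U x ^ (q / 2)) ^ r =
        ∫ x in ball x₀ h', |ph k q ε τ i j η U x| ^ r := by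
      apply setIntegral_congr_fun measurableSet_ball
      intro x hx
      simp only [ph, hηe x hx, one_mul]
      rw [abs_of_nonneg (hG0 x)]
    rw [e]
    refine setIntegral_le_integral ?_ (Filter.Eventually.of_forall fun x => by positivity)
    refine (hphC.continuous.abs.rpow_const fun x => Or.inr (by linarith)).integrable_of_hasCompactSupport ?_
    refine HasCompactSupport.of_support_subset_isCompact hphc ?_
    intro x hx
    apply subset_tsupport
    intro h0
    exact hx (by simp [h0]; rw [zero_rpow (by linarith)])
  have hTh : Continuous (fun x => Th U x ^ (2 / k + 2)) :=
    (c_Th sol.hU).rpow_const fun x => Or.inr (by positivity)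
  have st2 : ∫ x, (η x^2 + (pd 0 η x^2 + pd 1 η x^2)) * (af k q ε τ i j U x * Th U x ^ (2/k+2)) ≤
      D / (h - h') ^ 2 * ∫ x in ball x₀ h, af k q ε τ i j U x * Th U x ^ (2/k+2) := by
    have e : ∫ x, (η x^2 + (pd 0 η x^2 + pd 1 η x^2)) * (af k q ε τ i j U x * Th U x ^ (2/k+2)) =
        ∫ x in ball x₀ h, (η x^2 + (pd 0 η x^2 + pd 1 η x^2)) * (af k q ε τ i j U x * Th U x ^ (2/k+2)) := by
      symm
      apply setIntegral_eq_integral_of_forall_compl_eq_zero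
      intro x hx
      have hxt : x ∉ tsupport η := fun hm => hx (hth hm)
      have h0 : ∀ m, pd m η x = 0 := by
        intro m
        have : fderiv ℝ η x = 0 := by
          by_contra hne
          exact hxt (support_fderiv_subset ℝ hne)
        simp [pd, this]
      rw [h0, h0, image_eq_zero_of_notMem_tsupport hxt]
      simp
    have hpdc : ∀ m, Continuous (pd m η) := fun m =>
      (hη.continuous_fderiv (by norm_num)).clm_apply continuous_const
    rw [e, ← integral_const_mul]
    apply setIntegral_mono
    · exact cint (((hη.continuous.pow 2).add (((hpdc 0).pow 2).add ((hpdc 1).pow 2))).mul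
        (haf.mul hTh)) x₀ h
    · exact cint (continuous_const.mul (haf.mul hTh)) x₀ h
    · intro x
      have hz : 0 ≤ af k q ε τ i j U x * Th U x ^ (2/k+2) :=
        mul_nonneg (haf0 x) (rpow_nonneg (by linarith [Th_ge U x]) _)
      refine mul_le_mul_of_nonneg_right ?_ hz
      have hb : ∀ m, pd m η x ^ 2 ≤ (2 * A) ^ 2 / (h - h') ^ 2 := by
        intro m
        rw [← div_pow, ← sq_abs]
        refine pow_le_pow_left₀ (abs_nonneg _) ((hηd m x).trans (le_of_eq ?_)) 2
        have : (h + h') / 2 - h' = (h - h') / 2 := by ring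
        rw [this]
        field_simp
      have h1 : η x ^ 2 ≤ R ^ 2 / (h - h') ^ 2 := by
        have : (1 : ℝ) ≤ R ^ 2 / (h - h') ^ 2 := by
          rw [← div_pow]
          apply one_le_pow₀
          rw [le_div_iff₀ hd]
          linarith
        refine le_trans ?_ this
        have := hη0 x
        have := hη1 x
        nlinarith
      have e2 : D / (h - h') ^ 2 = R ^ 2 / (h - h') ^ 2 + ((2 * A) ^ 2 / (h - h') ^ 2 + (2 * A) ^ 2 / (h - h') ^ 2) := by
        rw [hDdef]; ring
      rw [e2]
      linarith [hb 0, hb 1]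
  have hKK : ∫ x in ball x₀ R, Th U x ^ (2 * N + 4) ≤ |K| :=
    (hK p ε f U hp (hpc.trans_le (min_le_left _ _)) sol).trans (le_abs_self K)
  have st3 := holder_step haf haf0 (c_Th sol.hU) (fun x => Th_ge U x) hν2 hS hhR.le hKK
  have hI : 0 ≤ ∫ x in ball x₀ h, af k q ε τ i j U x ^ (ν / 2) :=
    integral_nonneg fun x => rpow_nonneg (haf0 x) _
  rw [abs_of_nonneg (by linarith : 0 ≤ M)]
  rw [← half_alg hν2 (by linarith) hd hI (by linarith) hD0 (by positivity)]
  refine (rpow_le_rpow (integral_nonneg fun x => rpow_nonneg (hG0 x) _) st1 (by positivity)).trans ?_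
  refine sob.trans (mul_le_mul_of_nonneg_left ?_ hCs0)
  refine rpow_le_rpow (integral_nonneg fun x => by positivity) ?_ (by norm_num)
  refine cac.trans (mul_le_mul_of_nonneg_left ?_ (mul_nonneg (by linarith) (sq_nonneg q)))
  exact st2.trans (mul_le_mul_of_nonneg_left st3 (by positivity))


theorem g_le_alg {w v τ k q r : ℝ} (hw : 0 < w) (hτ : 0 < τ) (hq : 0 < q) (hr : 0 < r) :
    (w ^ (k / 2) * |v|) ^ (r * q) ≤ (w ^ (k * q / 2) * (v ^ 2 + τ) ^ (q / 2)) ^ r := by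
  rw [mul_comm r q, rpow_mul (by positivity)]
  apply rpow_le_rpow (by positivity) _ hr.le
  rw [mul_rpow (by positivity) (abs_nonneg v), ← rpow_mul hw.le, show k / 2 * q = k * q / 2 by ring]
  apply mul_le_mul_of_nonneg_left _ (by positivity)
  have : |v| ^ q = (v ^ 2) ^ (q / 2) := by
    rw [← sq_abs, ← rpow_natCast, ← rpow_mul (abs_nonneg v)]
    congr 1
    push_cast
    ring
  rw [this]
  exact rpow_le_rpow (by positivity) (by linarith) (by linarith)

theorem g_lim_alg {w v k q ν : ℝ} (hw : 0 < w) (hk : 0 < k) (hq : 1 / k < q) (hν : 0 < ν) :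
    Filter.Tendsto (fun τ : ℝ => (w ^ (k * q - 1) * (v ^ 2 + τ) ^ (q - 1 / k)) ^ (ν / 2)) (𝓝[>] 0)
      (𝓝 ((w ^ (k / 2) * |v|) ^ (ν * (q - 1 / k)))) := by
  have he : 0 < q - 1 / k := by linarith
  have hc : Continuous (fun τ : ℝ => (w ^ (k * q - 1) * (v ^ 2 + τ) ^ (q - 1 / k)) ^ (ν / 2)) := by
    apply Continuous.rpow_const _ (fun x => Or.inr (by positivity))
    apply Continuous.mul continuous_const
    exact Continuous.rpow_const (by fun_prop) (fun x => Or.inr he.le)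
  have h1 := (hc.tendsto 0).mono_left (nhdsWithin_le_nhds (s := Ioi 0))
  have e : (w ^ (k * q - 1) * (v ^ 2 + 0) ^ (q - 1 / k)) ^ (ν / 2) =
      (w ^ (k / 2) * |v|) ^ (ν * (q - 1 / k)) := by
    have e1 : k * q - 1 = (k / 2) * 2 * (q - 1 / k) := by field_simp
    rw [add_zero, ← sq_abs v, ← rpow_natCast, e1, rpow_mul hw.le, rpow_mul hw.le,
      ← mul_rpow (by positivity) (by positivity)]
    push_cast
    rw [← mul_rpow (by positivity) (by positivity), ← rpow_mul (by positivity), ← rpow_mul (by positivity)]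
    congr 1
    ring
  rwa [e] at h1

theorem lim_gint {ε : ℝ} (he : 0 < ε) {U : Euc 2 → ℝ} (hU : ContDiff ℝ 3 U) {k q ν : ℝ} (hk : 0 < k)
    (hq : 1 / k < q) (hν : 0 < ν) (i j : Fin 2) (x₀ : Euc 2) (h : ℝ) :
    Filter.Tendsto (fun τ : ℝ => ∫ x in ball x₀ h, af k q ε τ i j U x ^ (ν / 2)) (𝓝[>] 0)
      (𝓝 (∫ x in ball x₀ h, gfun k ε i j U x ^ (ν * (q - 1 / k)))) := by
  have he' : 0 < q - 1 / k := by linarith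
  have hcont : ∀ τ : ℝ, 0 < τ → Continuous fun x => af k q ε τ i j U x ^ (ν / 2) := fun τ hτ =>
    (af_cont hU he hτ i j).rpow_const fun x => Or.inr (by positivity)
  apply tendsto_integral_filter_of_dominated_convergence (fun x => af k q ε 1 i j U x ^ (ν / 2))
  · filter_upwards [self_mem_nhdsWithin] with τ hτ
    exact (hcont τ hτ).aestronglyMeasurable
  · filter_upwards [Ioo_mem_nhdsGT (show (0 : ℝ) < 1 by norm_num)] with τ hτ
    refine Filter.Eventually.of_forall fun x => ?_
    have hW := Wf_pos he U x
    have hT := Tf_pos hτ.1 i j U x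
    have hTT : Tf τ i j U x ≤ Tf 1 i j U x := by unfold Tf; linarith [hτ.2]
    have h0 : 0 ≤ af k q ε τ i j U x := by unfold af; positivity
    rw [Real.norm_of_nonneg (rpow_nonneg h0 _)]
    apply rpow_le_rpow h0 _ (by positivity)
    unfold af
    exact mul_le_mul_of_nonneg_left (rpow_le_rpow hT.le hTT he'.le) (by positivity)
  · exact cint (hcont 1 one_pos) x₀ h
  · refine Filter.Eventually.of_forall fun x => ?_
    rw [gfun_eq]
    exact g_lim_alg (Wf_pos he U x) hk hq hν

theorem revU {k l : ℝ} (r : ℝ) (hk0 : 0 < k) (hk1 : k ≤ 1) (hl : 1 < l) (i j : Fin 2) :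
    ∃ c : ℝ, 0 < c ∧ ∀ (R M ν : ℝ) (x₀ : Euc 2), 0 < R → 2 * l / (l - 1) < ν → ν < r →
      ∃ C : ℝ, 0 < C ∧ ∀ p ε f U q h' h, 1 < p → |p - 2| < c → Sol p ε R M x₀ f U →
        1 / k ≤ q → 0 < h' → h' < h → h < R →
        lpOn (gfun k ε i j U) (r * q) (ball x₀ h') ^ q ≤
          C * (q / (h - h')) * lpOn (gfun k ε i j U) (ν * (q - 1 / k)) (ball x₀ h) ^ (q - 1 / k) := by
  obtain ⟨c, hc, H⟩ := revtau r hk0 hk1 hl i j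
  refine ⟨c, hc, fun R M ν x₀ hR hν hνr => ?_⟩
  have hν0 : 0 < ν := by
    refine lt_trans ?_ hν
    have : 0 < l - 1 := by linarith
    positivity
  have hr0 : 0 < r := by linarith
  obtain ⟨C, hC, H⟩ := H R M ν x₀ hR hν hνr
  set V := volume.real (ball x₀ R) ^ (1 / ν) with hV
  have hV0 : 0 ≤ V := by positivity
  refine ⟨C * (V + 1) + 1, by positivity, fun p ε f U q h' h hp hpc sol hq h0 hhh hhR => ?_⟩
  have hq0 : 0 < q := lt_of_lt_of_le (by positivity) hq
  have hd : 0 < h - h' := by linarith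
  have hqd : 0 ≤ q / (h - h') := by positivity
  have he := sol.he0
  have g0 : ∀ x, 0 ≤ gfun k ε i j U x := fun x => by
    rw [gfun_eq]
    have := Wf_pos he U x
    positivity
  have gI0 : ∀ (e s : ℝ), 0 ≤ ∫ x in ball x₀ s, gfun k ε i j U x ^ e := fun e s =>
    integral_nonneg fun x => rpow_nonneg (g0 x) _
  have eL : lpOn (gfun k ε i j U) (r * q) (ball x₀ h') ^ q =
      (∫ x in ball x₀ h', gfun k ε i j U x ^ (r * q)) ^ (1 / r) := by
    unfold lpOn
    rw [← rpow_mul (gI0 _ _)]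
    congr 1
    field_simp
  have low : ∀ τ : ℝ, 0 < τ → τ < 1 →
      (∫ x in ball x₀ h', gfun k ε i j U x ^ (r * q)) ^ (1 / r) ≤
      C * (q / (h - h')) * (∫ x in ball x₀ h, af k q ε τ i j U x ^ (ν / 2)) ^ (1 / ν) := by
    intro τ hτ hτ1
    refine le_trans ?_ (H p ε f U τ q h' h hp hpc sol hτ hτ1 hq h0 hhh hhR)
    apply rpow_le_rpow (gI0 _ _) _ (by positivity)
    have hWc : Continuous (Wf ε U) := by
      have := Wr_contDiff sol.hU he 1
      simpa using this.continuous
    have hTc : Continuous (Tf τ i j U) := (Tf_contDiff sol.hU τ i j).continuous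
    apply int_mono_ball
    · have : gfun k ε i j U = fun x => Wf ε U x ^ (k/2) * |pd2 i j U x| := funext fun x => gfun_eq ..
      rw [this]
      exact ((hWc.rpow_const fun x => Or.inr (by positivity)).mul (c_pd2 i j sol.hU).abs).rpow_const
        fun x => Or.inr (by positivity)
    · exact ((hWc.rpow_const fun x => Or.inr (by positivity)).mul
        (hTc.rpow_const fun x => Or.inr (by positivity))).rpow_const fun x => Or.inr (by positivity)
    · intro x _
      rw [gfun_eq]
      exact g_le_alg (Wf_pos he U x) hτ hq0 hr0
  rw [eL]
  rcases hq.eq_or_lt with hq | hq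
  · have e1 : q - 1 / k = 0 := by linarith
    have e2 : k * q - 1 = 0 := by rw [← hq]; field_simp; norm_num
    rw [e1, rpow_zero, mul_one]
    refine (low (1 / 2) (by norm_num) (by norm_num)).trans ?_
    have : ∀ x, af k q ε (1 / 2) i j U x ^ (ν / 2) = 1 := fun x => by
      unfold af
      rw [e1, e2]; simp
    simp only [this]
    rw [int_const_ball, mul_one]
    have hvol : volume.real (ball x₀ h) ^ (1 / ν) ≤ V := by
      apply rpow_le_rpow measureReal_nonneg _ (by positivity)
      exact measureReal_mono (ball_subset_ball hhR.le) measure_ball_lt_top.ne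
    calc _ ≤ C * (q / (h - h')) * V := mul_le_mul_of_nonneg_left hvol (by positivity)
      _ = (C * V) * (q / (h - h')) := by ring
      _ ≤ _ := mul_le_mul_of_nonneg_right (by nlinarith) hqd
  · have he' : 0 < q - 1 / k := by linarith
    have eR : lpOn (gfun k ε i j U) (ν * (q - 1 / k)) (ball x₀ h) ^ (q - 1 / k) =
        (∫ x in ball x₀ h, gfun k ε i j U x ^ (ν * (q - 1 / k))) ^ (1 / ν) := by
      unfold lpOn
      rw [← rpow_mul (gI0 _ _)]
      congr 1
      rw [one_div, mul_inv, mul_assoc, inv_mul_cancel₀ he'.ne', mul_one, one_div]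
    rw [eR]
    have lim := ((lim_gint he sol.hU hk0 hq hν0 i j x₀ h).rpow_const
      (p := 1 / ν) (Or.inr (by positivity))).const_mul (C * (q / (h - h')))
    have := ge_of_tendsto lim (by
      filter_upwards [Ioo_mem_nhdsGT (show (0 : ℝ) < 1 by norm_num)] with τ hτ
      exact low τ hτ.1 hτ.2)
    refine this.trans (mul_le_mul_of_nonneg_right (mul_le_mul_of_nonneg_right ?_ hqd)
      (rpow_nonneg (gI0 _ _) _))
    nlinarith


theorem cut_mul {n : ℕ} {χ g : Euc 2 → ℝ} {S : Set (Euc 2)} (hS : IsOpen S) (hχ : ContDiff ℝ n χ)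
    (ht : tsupport χ ⊆ S) (hg : ContDiffOn ℝ n g S) : ContDiff ℝ n fun x => χ x * g x := by
  rw [contDiff_iff_contDiffAt]
  intro x
  by_cases hx : x ∈ S
  · exact hχ.contDiffAt.mul (hg.contDiffAt (hS.mem_nhds hx))
  · have hx' : x ∉ tsupport χ := fun h => hx (ht h)
    have : (fun y => χ y * g y) =ᶠ[𝓝 x] fun _ => 0 := by
      filter_upwards [notMem_tsupport_iff_eventuallyEq.1 hx'] with y hy
      simp [hy]
    exact contDiffAt_const.congr_of_eventuallyEq this

theorem gfun_congr (k ε : ℝ) (i j : Fin 2) {u v : Euc 2 → ℝ} {x : Euc 2} (h : u =ᶠ[𝓝 x] v) :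
    gfun k ε i j u x = gfun k ε i j v x := by
  rw [gfun_eq, gfun_eq, Wf_congr ε h, pd2_congr i j h]

theorem lpOn_congr {g g' : Euc 2 → ℝ} (e : ℝ) {x₀ : Euc 2} {s : ℝ} (H : ∀ x ∈ ball x₀ s, g x = g' x) :
    lpOn g e (ball x₀ s) = lpOn g' e (ball x₀ s) := by
  unfold lpOn
  congr 1
  apply setIntegral_congr_fun measurableSet_ball
  intro x hx
  simp only [H x hx]

theorem globalize {Ω : Set (Euc 2)} {x₀ : Euc 2} {R p : ℝ} {f u : Euc 2 → ℝ} (hΩ : IsOpen Ω)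
    (hR : 0 < R) (hB : closedBall x₀ (2 * R) ⊆ Ω) (hp : 1 < p) (hf : ContDiffOn ℝ 2 f Ω)
    (hu : ContDiffOn ℝ 1 u (closedBall x₀ (2 * R))) :
    ∃ M : ℝ, ∀ ε ∈ Ioo (0 : ℝ) 1, ∀ uε : Euc 2 → ℝ, ContDiffOn ℝ 3 uε (ball x₀ (2 * R)) →
      ContinuousOn uε (closedBall x₀ (2 * R)) → SolvesReg p ε f uε (ball x₀ (2 * R)) →
      (∀ x ∈ sphere x₀ (2 * R), uε x = u x) →
      ∃ F U, Sol p ε R M x₀ F U ∧ ∀ x ∈ ball x₀ R, uε =ᶠ[𝓝 x] U := by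
  let b : ContDiffBump x₀ := ⟨7 / 4 * R, 15 / 8 * R, by linarith, by linarith⟩
  have sm : ∀ n : ℕ, ContDiff ℝ n b := fun n => b.contDiff
  have cs : HasCompactSupport b := b.hasCompactSupport
  have ts : tsupport b ⊆ ball x₀ (2 * R) := by
    rw [b.tsupport_eq]
    exact closedBall_subset_ball (show 15 / 8 * R < 2 * R by linarith)
  have b1 : ∀ x ∈ ball x₀ (3 / 2 * R), ∀ᶠ y in 𝓝 x, b y = 1 := by
    intro x hx
    filter_upwards [isOpen_ball.mem_nhds hx] with y hy
    apply b.one_of_mem_closedBall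
    exact ball_subset_closedBall (ball_subset_ball (show 3 / 2 * R ≤ 7 / 4 * R by linarith) hy)
  set F : Euc 2 → ℝ := fun x => b x * f x with hF
  have hFs : ContDiff ℝ 2 F :=
    cut_mul hΩ (sm 2) (ts.trans (ball_subset_closedBall.trans hB)) hf
  have hFc : HasCompactSupport F := cs.mul_right
  obtain ⟨C0, hC0⟩ := ccs_bdd ⟨hFs.continuous, hFc⟩
  have c1 (i) := ccs_bdd (pd_ccs i (hFs.of_le (by norm_num)) hFc)
  have c2 (i j) := ccs_bdd (pd_ccs j (pd_contDiff (m := 2) (n := 1) i hFs (by norm_num)) (pd_cs i hFc))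
  choose C1 hC1 using c1
  choose C2 hC2 using c2
  obtain ⟨Mf, hMf⟩ := (isCompact_closedBall x₀ (2 * R)).exists_bound_of_continuousOn
    (hf.continuousOn.mono hB)
  obtain ⟨Mu, hMu⟩ := (isCompact_closedBall x₀ (2 * R)).exists_bound_of_continuousOn
    hu.continuousOn
  obtain ⟨M0, hM0⟩ := sup_bound_abs (Mf := Mf) (Mu := Mu) hp hR x₀
  set M : ℝ := 1 + |M0| + |C0| + ∑ i, |C1 i| + ∑ i, ∑ j, |C2 i j| with hM
  have n1 : 0 ≤ ∑ i, |C1 i| := Finset.sum_nonneg fun i _ => abs_nonneg _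
  have n2 : 0 ≤ ∑ i, ∑ j, |C2 i j| := Finset.sum_nonneg fun i _ => Finset.sum_nonneg fun j _ => abs_nonneg _
  have a0 := abs_nonneg M0
  have a1 := abs_nonneg C0
  refine ⟨M, fun ε he uε h3 hc hs hb => ⟨F, fun x => b x * uε x, ?_, ?_⟩⟩
  swap
  · intro x hx
    filter_upwards [b1 x (ball_subset_ball (by linarith) hx)] with y hy
    rw [hy, one_mul]
  have hcd : ∀ x ∈ ball x₀ (2 * R), ContDiffAt ℝ 2 uε x := fun x hx =>
    (h3.contDiffAt (isOpen_ball.mem_nhds hx)).of_le (by norm_num)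
  have hL : ∀ x ∈ ball x₀ (2 * R), Lreg p ε uε x = - f x := fun x hx =>
    solves_Lreg he.1 hs hx (hcd x hx)
  have hbd := hM0 ε he uε hcd hc
    (fun x hx => by rw [hL x hx, abs_neg]; exact hMf x (ball_subset_closedBall hx))
    (fun x hx => by rw [hb x hx]; exact hMu x (sphere_subset_closedBall hx))
  have hsub : ball x₀ (3 / 2 * R) ⊆ ball x₀ (2 * R) := ball_subset_ball (by linarith)
  refine ⟨he.1, he.2, cut_mul isOpen_ball (sm 3) ts h3, cs.mul_right, hFs, ?_, ?_, ?_, ?_, ?_, ?_⟩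
  · intro x hx
    have ev : (fun x => b x * uε x) =ᶠ[𝓝 x] uε := by
      filter_upwards [b1 x hx] with y hy
      rw [hy, one_mul]
    rw [Lreg_congr p ε ev, hL x (hsub hx), hF]
    simp only [(b1 x hx).self_of_nhds, one_mul]
  · intro x hx
    simp only [(b1 x hx).self_of_nhds, one_mul]
    have := hbd x (ball_subset_closedBall (hsub hx))
    have := le_abs_self M0
    linarith
  · intro x
    have := hC0 x
    have := le_abs_self C0
    linarith
  · intro i x
    have h1 := hC1 i x
    have h2 := le_abs_self (C1 i)
    have h3 := Finset.single_le_sum (f := fun i => |C1 i|) (fun i _ => abs_nonneg _) (Finset.mem_univ i)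
    linarith
  · intro i j x
    have h1 : |pd2 i j F x| ≤ C2 i j := hC2 i j x
    have h2 := le_abs_self (C2 i j)
    have h3 := Finset.single_le_sum (f := fun j => |C2 i j|) (fun i _ => abs_nonneg _) (Finset.mem_univ j)
    have h4 := Finset.single_le_sum (f := fun i => ∑ j, |C2 i j|)
      (fun i _ => Finset.sum_nonneg fun j _ => abs_nonneg _) (Finset.mem_univ i)
    linarith
  · linarith

/-- The two-dimensional version of Proposition 3.2 (Remark 3.3 of the paper): the
reverse-Hölder inequality for `g_ε` with the Sobolev exponent `2*` replaced by an
arbitrary fixed `r > 2l/(l-1)`. -/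
theorem stmt4 (k l r : ℝ) (hk0 : 0 < k) (hk1 : k ≤ 1) (hl : 1 < l)
    (hr : 2 * l / (l - 1) < r) (i j : Fin 2) :
    ∃ c : ℝ, 0 < c ∧
      ∀ (Ω : Set (Euc 2)) (x₀ : Euc 2) (R p : ℝ) (f u : Euc 2 → ℝ),
        IsOpen Ω → IsConnected Ω → x₀ ∈ Ω → 0 < R → closedBall x₀ (2 * R) ⊆ Ω →
        1 < p → |p - 2| < c →
        ContDiffOn ℝ 2 f Ω →
        ContDiffOn ℝ 1 u (closedBall x₀ (2 * R)) →
        IsWeakPSol p f u (ball x₀ (2 * R)) →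
        ∀ ν : ℝ, 2 * l / (l - 1) < ν → ν < r →
          ∃ C : ℝ, 0 < C ∧
            ∀ ε : ℝ, ε ∈ Set.Ioo (0 : ℝ) 1 →
              ∀ uε : Euc 2 → ℝ,
                ContDiffOn ℝ 3 uε (ball x₀ (2 * R)) →
                ContinuousOn uε (closedBall x₀ (2 * R)) →
                SolvesReg p ε f uε (ball x₀ (2 * R)) →
                (∀ x ∈ sphere x₀ (2 * R), uε x = u x) →
                ∀ q : ℝ, 1 / k ≤ q →
                  ∀ h' h : ℝ, 0 < h' → h' < h → h < R →
                    lpOn (gfun k ε i j uε) (r * q) (ball x₀ h') ^ q ≤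
                      C * (q / (h - h')) *
                        lpOn (gfun k ε i j uε) (ν * (q - 1 / k)) (ball x₀ h) ^ (q - 1 / k) := by
  obtain ⟨c, hc, H⟩ := revU r hk0 hk1 hl i j
  refine ⟨c, hc, fun Ω x₀ R p f u hΩ _ _ hR hB hp hpc hf hu _ ν hν hνr => ?_⟩
  obtain ⟨M, hM⟩ := globalize hΩ hR hB hp hf hu
  obtain ⟨C, hC, H⟩ := H R M ν x₀ hR hν hνr
  refine ⟨C, hC, fun ε he uε h3 hcc hs hb q hq h' h h0 hhh hhR => ?_⟩
  obtain ⟨F, U, sol, hU⟩ := hM ε he uε h3 hcc hs hb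
  have key := H p ε F U q h' h hp hpc sol hq h0 hhh hhR
  rw [lpOn_congr (g := gfun k ε i j uε) (g' := gfun k ε i j U) (r * q)
      fun x hx => gfun_congr k ε i j (hU x (ball_subset_ball (by linarith) hx)),
    lpOn_congr (g := gfun k ε i j uε) (g' := gfun k ε i j U) (ν * (q - 1 / k))
      fun x hx => gfun_congr k ε i j (hU x (ball_subset_ball hhR.le hx))]
  exact key

end
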